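/- arXiv:2506.13242 — 4 statements merged into one kernel-verified Lean document; each statement's English description precedes it below -/
import Mathlib

section
/- There exists a bilinear algorithm of rank 48 for 4×4 by 4×4 matrix multiplication over the field ℚ of rational numbers; that is, there exist families of matrices u t, v t ∈ M₄(ℚ) and w t ∈ M₄(ℚ), indexed by t ∈ {1,…,48}, such that for all A, B ∈ M₄(ℚ) and all indices i, j one has (A·B)ᵢⱼ = ∑_{t=1}^{48} (w t)ᵢⱼ · (∑_{p,q} (u t)_{p,q} A_{p,q}) · (∑_{p,q} (v t)_{p,q} B_{p,q}). In particular, two 4×4 rational matrices can be multiplied using only 48 scalar multiplications. -/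
/-- Matrices `X`, listed with integer weights `c`, contributing the cyclically invariant terms
`c • X ⊗ X ⊗ X` to a decomposition of a multiple of the `4 × 4` matrix multiplication tensor. -/
def cyclicFixedTerms : List (ℤ × Matrix (Fin 4) (Fin 4) ℤ) := [
  (5832000, !![1, 0, -1, 0; 0, 0, 0, 0; 0, 0, 0, 0; 0, 0, 0, 0]),
  (91125, !![0, 0, 0, 0; 0, 0, 0, 0; 0, 0, 0, 0; 0, 5, 0, 4]),
  (-1, !![160, 80, -208, 40; 64, -40, 32, 16; 160, -100, 80, 40; -80, 5, 32, -20]),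
  (8, !![10, 20, 2, 40; 16, -40, 32, 64; 10, -25, 20, 40; -20, -130, 32, -80]),
  (-8, !![10, -40, 44, 40; 16, -10, -16, 64; 10, 50, -100, 40; -20, 35, -16, -80]),
  (8, !![80, -20, 28, 20; 32, 100, -32, 8; 80, 25, 10, 20; -40, 55, -32, -10])]

/-- Triples of matrices `(X, Y, Z)`, listed with integer weights `c`, contributing
`c • (X ⊗ Y ⊗ Z + Y ⊗ Z ⊗ X + Z ⊗ X ⊗ Y)` to the same decomposition. -/
def cyclicOrbitTerms : List (ℤ × Matrix (Fin 4) (Fin 4) ℤ × Matrix (Fin 4) (Fin 4) ℤ ×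
    Matrix (Fin 4) (Fin 4) ℤ) := [
  (-1166400,
    !![0, 1, 0, -1; 0, 0, 0, 0; 0, 0, 0, 0; 0, 0, 0, 0],
    !![0, 0, 0, 0; 1, 0, -1, 0; 0, 0, 0, 0; 0, 0, 0, 0],
    !![0, 0, 0, 0; 0, 0, 0, 0; 5, 0, 4, 0; 0, 0, 0, 0]),
  (-291600,
    !![0, 0, 0, 0; 0, 1, 0, -1; 0, 0, 0, 0; 0, 0, 0, 0],
    !![0, 0, 0, 0; 0, 0, 0, 0; 0, 0, 0, 0; 5, 0, 4, 0],
    !![0, 0, 0, 0; 0, 0, 0, 0; 0, 5, 0, 4; 0, 0, 0, 0]),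
  (14400,
    !![0, 0, 4, 5; 0, 0, 0, 0; 0, 0, 0, 0; 0, 0, 0, 0],
    !![1, 0, -1, 0; 1, 0, -1, 0; 1, 0, -1, 0; 1, 0, -1, 0],
    !![20, -20, 0, 0; -16, 16, 0, 0; -25, 25, 0, 0; 20, -20, 0, 0]),
  (3600,
    !![0, 0, 4, 5; 0, 0, 4, 5; 0, 0, 4, 5; 0, 0, 4, 5],
    !![0, 0, 0, 0; 0, 0, 0, 0; 0, 0, 0, 0; 1, -1, 0, 0],
    !![0, 100, 0, 80; 0, -80, 0, -64; 0, -125, 0, -100; 0, 100, 0, 80]),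
  (-14400,
    !![5, -5, 0, 0; -4, 4, 0, 0; 5, -5, 0, 0; -4, 4, 0, 0],
    !![0, 0, 0, 0; 4, 5, 0, 0; 0, 0, 0, 0; 0, 0, 0, 0],
    !![5, 0, 4, 0; 5, 0, 4, 0; 5, 0, 4, 0; 5, 0, 4, 0]),
  (14400,
    !![0, 0, 0, 0; 1, -1, 0, 0; 0, 0, 0, 0; 0, 0, 0, 0],
    !![25, 0, 20, 0; -20, 0, -16, 0; 25, 0, 20, 0; -20, 0, -16, 0],
    !![4, 5, 0, 0; 4, 5, 0, 0; 4, 5, 0, 0; 4, 5, 0, 0]),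
  (3600,
    !![0, 0, 0, 0; 0, 0, 0, 0; 0, 0, 4, 5; 0, 0, 0, 0],
    !![0, 4, 0, -4; 0, 4, 0, -4; 0, -5, 0, 5; 0, -5, 0, 5],
    !![0, 0, 20, -20; 0, 0, -16, 16; 0, 0, -25, 25; 0, 0, 20, -20]),
  (-3600,
    !![0, 0, 16, 20; 0, 0, 16, 20; 0, 0, -20, -25; 0, 0, -20, -25],
    !![0, 0, 0, 0; 0, 0, 0, 0; 0, 0, 1, -1; 0, 0, 0, 0],
    !![0, 20, 0, -20; 0, -16, 0, 16; 0, -25, 0, 25; 0, 20, 0, -20]),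
  (4500,
    !![0, 20, 0, 16; 0, 20, 0, 16; 0, -25, 0, -20; 0, -25, 0, -20],
    !![0, 0, 5, -5; 0, 0, -4, 4; 0, 0, 5, -5; 0, 0, -4, 4],
    !![0, 0, 0, 0; 0, 0, 0, 0; 0, 0, 0, 0; 4, 5, 0, 0]),
  (18000,
    !![5, 0, -5, 0; -4, 0, 4, 0; 5, 0, -5, 0; -4, 0, 4, 0],
    !![16, 20, 0, 0; 16, 20, 0, 0; -20, -25, 0, 0; -20, -25, 0, 0],
    !![0, 0, 1, -1; 0, 0, 0, 0; 0, 0, 0, 0; 0, 0, 0, 0]),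
  (-12,
    !![20, -20, 12, 0; -8, 20, -8, 8; 20, 25, 0, 30; -20, 5, -8, -10],
    !![40, -40, 44, 100; 64, 80, -16, 16; 40, 50, -10, 10; 10, 35, -16, -20],
    !![80, -20, -8, 20; 128, 40, -128, 32; 80, 25, -80, 20; -160, 130, -128, -40]),
  (12,
    !![40, 20, -48, 0; -16, -20, 32, 16; 40, -25, 0, 60; -40, -5, 32, -20],
    !![20, 40, -11, 5; 32, 10, 4, 8; 20, -50, 25, 5; -40, -35, 4, -10],
    !![80, 40, -176, 200; 128, -80, 64, 32; 80, -50, 40, 20; 20, -35, 64, -40]),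
  (-24,
    !![10, 20, -2, 20; 24, 0, 8, 16; 10, -25, 10, -10; 0, -30, 8, -20],
    !![40, 20, -112, 160; 16, -100, 128, 64; 40, -25, -40, 160; -20, -55, 128, -80],
    !![10, 20, -7, -5; 4, -10, 8, 16; 10, -25, 20, 40; -50, -55, 8, -20]),
  (12,
    !![20, -20, 28, -10; 8, 10, -32, 32; 20, 25, -80, 80; -100, 55, -32, -40],
    !![20, -80, 52, 80; 8, 40, -8, 32; 20, 100, -20, 80; -10, -5, -8, -40],
    !![20, -20, 8, 40; 48, 0, -32, 32; 20, 25, -40, -20; 0, 30, -32, -40])]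

/-- The 48 weighted rank-one terms `(c, X, Y, Z)`. -/
def trilinearTerms : List (ℤ × Matrix (Fin 4) (Fin 4) ℤ × Matrix (Fin 4) (Fin 4) ℤ ×
    Matrix (Fin 4) (Fin 4) ℤ) :=
  cyclicFixedTerms.map (fun (c, X) => (c, X, X, X)) ++
    cyclicOrbitTerms.flatMap (fun (c, X, Y, Z) => [(c, X, Y, Z), (c, Y, Z, X), (c, Z, X, Y)])

theorem length_trilinearTerms : trilinearTerms.length = 48 := rfl

/-- The Brent equations: the weighted terms add up to `5832000` times the tensor of the trilinear
form `trace (A * B * C)`. -/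
theorem brent_trilinearTerms : ∀ p q r s j i : Fin 4,
    (trilinearTerms.map fun (c, X, Y, Z) => c * X p q * Y r s * Z j i).sum =
      if q = r ∧ s = j ∧ p = i then 5832000 else 0 := by
  -- Spelling out `Int.add` and `Int.mul` makes the kernel evaluation several times faster.
  have h : ∀ p q r s j i : Fin 4,
      trilinearTerms.foldr (fun t a => Int.add (Int.mul (Int.mul (Int.mul t.1 (t.2.1 p q))
        (t.2.2.1 r s)) (t.2.2.2 j i)) a) 0 =
        if q = r ∧ s = j ∧ p = i then 5832000 else 0 := by
    decide +kernel
  intro p q r s j i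
  rw [← h, List.sum_eq_foldr, List.foldr_map]
  rfl

/-- The Brent equations over `ℚ`, as sums over `Fin 48`. -/
theorem sum_get_trilinearTerms (p q r s j i : Fin 4) :
    ∑ t : Fin 48, (let x := trilinearTerms.get (t.cast length_trilinearTerms.symm)
      ((x.1 * x.2.1 p q * x.2.2.1 r s * x.2.2.2 j i : ℤ) : ℚ)) =
      if q = r ∧ s = j ∧ p = i then 5832000 else 0 := by
  have h := brent_trilinearTerms p q r s j i
  rw [← List.ofFn_get trilinearTerms, List.map_ofFn, List.sum_ofFn] at h
  rw [← Int.cast_sum]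
  exact_mod_cast congrArg (Int.cast : ℤ → ℚ) h

/-- There exists a bilinear algorithm of rank 48 for 4×4 by 4×4 matrix
multiplication over the field ℚ of rational numbers. -/
theorem rational_rank48_bilinear_algorithm_4x4 :
    ∃ u v w : Fin 48 → Matrix (Fin 4) (Fin 4) ℚ,
      ∀ (A B : Matrix (Fin 4) (Fin 4) ℚ) (i j : Fin 4),
        (A * B) i j =
          ∑ t : Fin 48,
            w t i j * (∑ p : Fin 4, ∑ q : Fin 4, u t p q * A p q) *
              (∑ p : Fin 4, ∑ q : Fin 4, v t p q * B p q) := by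
  let T := fun t : Fin 48 => trilinearTerms.get (t.cast length_trilinearTerms.symm)
  refine ⟨fun t => (T t).2.1.map (↑), fun t => (T t).2.2.1.map (↑),
    fun t => Matrix.of fun i j => ((T t).1 * (T t).2.2.2 j i / 5832000 : ℚ), fun A B i j => ?_⟩
  have key (p q r s : Fin 4) :
      ∑ t, ((T t).1 * (T t).2.2.2 j i / 5832000 : ℚ) * ((T t).2.1 p q * A p q) *
        ((T t).2.2.1 r s * B r s) = if q = r ∧ s = j ∧ p = i then A p q * B r s else 0 := by
    have h := sum_get_trilinearTerms p q r s j i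
    calc _ = (∑ t, (((T t).1 * (T t).2.1 p q * (T t).2.2.1 r s * (T t).2.2.2 j i : ℤ) : ℚ)) *
          (A p q * B r s / 5832000) := by
            rw [Finset.sum_mul]
            refine Finset.sum_congr rfl fun t _ => ?_
            push_cast
            ring
      _ = _ := by
            rw [h]
            split_ifs <;> ring
  calc (A * B) i j
      = ∑ p, ∑ q, ∑ r, ∑ s, if q = r ∧ s = j ∧ p = i then A p q * B r s else 0 := by
        simp [Matrix.mul_apply, ite_and]
    _ = ∑ p, ∑ q, ∑ r, ∑ s, ∑ t, ((T t).1 * (T t).2.2.2 j i / 5832000 : ℚ) *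
          ((T t).2.1 p q * A p q) * ((T t).2.2.1 r s * B r s) := by
        simp only [key]
    _ = _ := by
        simp_rw [Finset.sum_comm (s := (Finset.univ : Finset (Fin 4)))
          (t := (Finset.univ : Finset (Fin 48)))]
        refine Finset.sum_congr rfl fun t _ => ?_
        simp only [Matrix.map_apply, Matrix.of_apply, ← Finset.mul_sum, ← Finset.sum_mul]
end

section
/- Let R be a commutative ring in which 2 is invertible. Then there exists a bilinear algorithm of rank 48 for 4×4 by 4×4 matrix multiplication over R; that is, there exist families of matrices u t, v t, w t ∈ M₄(R), t ∈ {1,…,48}, such that for all A, B ∈ M₄(R) and all i, j: (A·B)ᵢⱼ = ∑_{t=1}^{48} (w t)ᵢⱼ · (∑_{p,q} (u t)_{p,q} A_{p,q}) · (∑_{p,q} (v t)_{p,q} B_{p,q}). -/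
/-- The product of the linear forms with coefficient matrices `x.1` and `x.2.1`, evaluated at the
matrix units `(p, q)` and `(p', q')`, times the `(i, j)` entry of `x.2.2`. -/
def trilinearCoeff (x : Matrix (Fin 4) (Fin 4) ℤ × Matrix (Fin 4) (Fin 4) ℤ ×
    Matrix (Fin 4) (Fin 4) ℤ) (p q p' q' i j : Fin 4) : ℤ :=
  x.2.2 i j * (x.1 p q * x.2.1 p' q')

/-- Eight of the terms of `matMulTerms`. -/
def matMulTermsA : List (Matrix (Fin 4) (Fin 4) ℤ × Matrix (Fin 4) (Fin 4) ℤ ×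
    Matrix (Fin 4) (Fin 4) ℤ) := [
  (!![0, 1, -1, 0; 0, 1, -1, 0; 0, 1, -1, 0; 0, 1, -1, 0],
   !![0, 0, 0, 0; 0, 0, 1, 1; 0, 0, 0, 0; 0, 0, 0, 0],
   !![0, 0, 0, 0; 4, 4, 4, 4; 4, 4, 4, 4; 0, 0, 0, 0]),
  (!![1, 0, 0, 1; -1, 0, 0, -1; 1, 0, 0, 1; -1, 0, 0, -1],
   !![0, 0, 0, 0; 0, 0, 0, 0; 0, 0, 0, 0; 1, -1, 0, 0],
   !![4, -4, 4, -4; 0, 0, 0, 0; 0, 0, 0, 0; -4, 4, -4, 4]),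
  (!![0, 0, 0, 0; 1, 0, 0, 1; 0, 0, 0, 0; 0, 0, 0, 0],
   !![1, 0, 0, -1; 1, 0, 0, -1; 1, 0, 0, -1; 1, 0, 0, -1],
   !![4, -4, 4, -4; 4, -4, 4, -4; 0, 0, 0, 0; 0, 0, 0, 0]),
  (!![1, -1, 0, 0; -1, 1, 0, 0; 1, -1, 0, 0; -1, 1, 0, 0],
   !![1, -1, 0, 0; -1, 1, 0, 0; 1, -1, 0, 0; -1, 1, 0, 0],
   !![0, 0, 0, 0; 0, 0, 0, 0; 4, 0, 0, 0; -4, 0, 0, 0]),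
  (!![0, 0, 0, 0; 0, 0, 0, 0; 0, 0, 0, 0; 0, 1, -1, 0],
   !![0, 1, 1, 0; 0, -1, -1, 0; 0, 1, 1, 0; 0, -1, -1, 0],
   !![0, 0, 0, 0; 0, 0, 0, 0; 4, 4, 4, 4; -4, -4, -4, -4]),
  (!![0, 0, 1, 1; 0, 0, 1, 1; 0, 0, 1, 1; 0, 0, 1, 1],
   !![0, 0, 1, 1; 0, 0, 1, 1; 0, 0, 1, 1; 0, 0, 1, 1],
   !![0, 0, 4, 0; 0, 0, 4, 0; 0, 0, 0, 0; 0, 0, 0, 0]),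
  (!![0, 0, 0, 0; 0, 0, 0, 0; 0, 0, 0, 0; 0, 0, 1, 1],
   !![0, 0, 0, 0; 0, 0, 0, 0; 0, 0, 0, 0; 0, 1, 1, 0],
   !![0, 0, -16, 0; 0, 0, 0, 0; 0, 0, 0, 0; 0, 0, 16, 0]),
  (!![0, 0, 0, 0; 1, -1, 0, 0; 0, 0, 0, 0; 0, 0, 0, 0],
   !![0, 0, 0, 0; 1, 0, 0, -1; 0, 0, 0, 0; 0, 0, 0, 0],
   !![0, 0, 0, 0; -16, 0, 0, 0; -16, 0, 0, 0; 0, 0, 0, 0])]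

/-- Eight of the terms of `matMulTerms`. -/
def matMulTermsB : List (Matrix (Fin 4) (Fin 4) ℤ × Matrix (Fin 4) (Fin 4) ℤ ×
    Matrix (Fin 4) (Fin 4) ℤ) := [
  (!![-1, 0, 0, -1; 1, 0, 0, 1; 1, 0, 0, 1; -1, 0, 0, -1],
   !![0, 0, 1, -1; 0, 0, -1, 1; 0, 0, -1, 1; 0, 0, 1, -1],
   !![-2, 2, -2, 2; 0, 0, 0, 0; 0, 0, 0, 0; -2, 2, -2, 2]),
  (!![0, 0, -1, -1; 0, 0, 1, 1; 0, 0, 1, 1; 0, 0, -1, -1],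
   !![0, 0, 0, 0; 0, 0, 0, 0; 0, 0, 1, -1; 0, 0, 0, 0],
   !![0, 0, -8, 0; 0, 0, 8, 0; 0, 0, 0, 0; 0, 0, 0, 0]),
  (!![0, 0, 0, 0; 0, 0, 0, 0; 0, 1, 1, 0; 0, 0, 0, 0],
   !![0, 0, 0, 0; 0, -1, 1, 0; 0, 0, 0, 0; 0, 0, 0, 0],
   !![0, 0, 0, 0; 0, -16, 0, 0; 0, -16, 0, 0; 0, 0, 0, 0]),
  (!![0, 0, 0, 0; 0, 0, 0, 0; 0, 0, 1, -1; 0, 0, 0, 0],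
   !![0, 1, -1, 0; 0, -1, 1, 0; 0, 1, -1, 0; 0, -1, 1, 0],
   !![0, 0, 0, 0; 0, 0, 0, 0; 4, 4, -4, -4; -4, -4, 4, 4]),
  (!![-1, 0, 0, 1; 0, 0, 0, 0; 0, 0, 0, 0; 0, 0, 0, 0],
   !![0, 0, 0, 0; 0, 0, 0, 0; 0, 0, 0, 0; 1, 0, 0, 1],
   !![0, 0, 0, 16; 0, 0, 0, 0; 0, 0, 0, 0; 0, 0, 0, -16]),
  (!![1, 1, 0, 0; 0, 0, 0, 0; 0, 0, 0, 0; 0, 0, 0, 0],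
   !![1, 0, 0, 1; 1, 0, 0, 1; 1, 0, 0, 1; 1, 0, 0, 1],
   !![4, -4, -4, 4; 4, -4, -4, 4; 0, 0, 0, 0; 0, 0, 0, 0]),
  (!![1, -1, 0, 0; 1, -1, 0, 0; -1, 1, 0, 0; -1, 1, 0, 0],
   !![1, 1, 0, 0; 0, 0, 0, 0; 0, 0, 0, 0; 0, 0, 0, 0],
   !![0, 0, 0, 0; 0, 0, 0, 0; -8, 0, 0, 0; -8, 0, 0, 0]),
  (!![0, 1, -1, 0; 0, 1, -1, 0; 0, -1, 1, 0; 0, -1, 1, 0],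
   !![1, 1, 0, 0; 1, 1, 0, 0; -1, -1, 0, 0; -1, -1, 0, 0],
   !![0, 0, 0, 0; 2, 2, 2, 2; -2, -2, -2, -2; 0, 0, 0, 0])]

/-- Eight of the terms of `matMulTerms`. -/
def matMulTermsC : List (Matrix (Fin 4) (Fin 4) ℤ × Matrix (Fin 4) (Fin 4) ℤ ×
    Matrix (Fin 4) (Fin 4) ℤ) := [
  (!![1, 1, 0, 0; -1, -1, 0, 0; -1, -1, 0, 0; 1, 1, 0, 0],
   !![0, 0, 0, 0; 0, 0, 1, -1; 0, 0, 0, 0; 0, 0, 0, 0],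
   !![0, 0, 0, 0; 4, -4, -4, 4; 4, -4, -4, 4; 0, 0, 0, 0]),
  (!![-1, 0, 0, 1; 1, 0, 0, -1; 1, 0, 0, -1; -1, 0, 0, 1],
   !![0, 0, 1, -1; 0, 0, -1, 1; 0, 0, 1, -1; 0, 0, -1, 1],
   !![0, 0, 0, 0; 0, 0, 0, 0; 0, 0, 0, -4; 0, 0, 0, 4]),
  (!![0, 0, 0, 0; 0, 0, 0, 0; 0, 0, 1, 1; 0, 0, 0, 0],
   !![0, 1, -1, 0; 0, 1, -1, 0; 0, -1, 1, 0; 0, -1, 1, 0],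
   !![0, 0, 0, 0; 0, 0, -8, 0; 0, 0, 8, 0; 0, 0, 0, 0]),
  (!![0, 0, 0, 0; 0, 0, 0, 0; 1, 0, 0, 1; 0, 0, 0, 0],
   !![0, 1, -1, 0; 0, 0, 0, 0; 0, 0, 0, 0; 0, 0, 0, 0],
   !![0, 0, 0, 0; 0, 0, 0, 0; -8, 8, -8, 8; -8, 8, -8, 8]),
  (!![-1, 1, 0, 0; 0, 0, 0, 0; 0, 0, 0, 0; 0, 0, 0, 0],
   !![1, 0, 0, 1; -1, 0, 0, -1; -1, 0, 0, -1; 1, 0, 0, 1],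
   !![-8, 0, 0, 0; 0, 0, 0, 0; 0, 0, 0, 0; -8, 0, 0, 0]),
  (!![0, 1, -1, 0; 0, 0, 0, 0; 0, 0, 0, 0; 0, 0, 0, 0],
   !![0, 0, 0, 0; 0, 0, 0, 0; 1, 0, 0, 1; 0, 0, 0, 0],
   !![-8, -8, -8, -8; 8, 8, 8, 8; 0, 0, 0, 0; 0, 0, 0, 0]),
  (!![0, 1, 1, 0; 0, 1, 1, 0; 0, -1, -1, 0; 0, -1, -1, 0],
   !![1, 1, 0, 0; 1, 1, 0, 0; 1, 1, 0, 0; 1, 1, 0, 0],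
   !![0, 4, 0, 0; 0, 4, 0, 0; 0, 0, 0, 0; 0, 0, 0, 0]),
  (!![0, 0, 1, -1; 0, 0, 1, -1; 0, 0, -1, 1; 0, 0, -1, 1],
   !![0, 0, 0, 0; 0, 0, 0, 0; 0, 0, 0, 0; 1, 1, 0, 0],
   !![-4, -4, 4, 4; 0, 0, 0, 0; 0, 0, 0, 0; 4, 4, -4, -4])]

/-- Eight of the terms of `matMulTerms`. -/
def matMulTermsD : List (Matrix (Fin 4) (Fin 4) ℤ × Matrix (Fin 4) (Fin 4) ℤ ×
    Matrix (Fin 4) (Fin 4) ℤ) := [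
  (!![-1, 0, -1, 0; 1, 0, -1, 2; 0, 0, 0, 0; 0, 0, 0, 0],
   !![1, 1, -1, -1; 1, 1, -1, -1; 3, -1, 1, -3; 1, 1, -1, -1],
   !![-2, 0, 0, 2; 0, 2, -2, 0; 0, 0, 0, 0; 0, 0, 0, 0]),
  (!![0, -1, 0, 1; 0, 0, 0, 0; 0, 0, 0, 0; 0, 1, 2, 1],
   !![0, 0, 1, 0; 0, 0, -1, 0; 0, 0, -1, 0; 0, 2, 1, 0],
   !![0, 4, 4, 0; 0, 0, 0, 0; 0, 0, 0, 0; 0, 4, -4, 0]),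
  (!![0, 1, -1, 0; 0, 0, -1, 1; 0, 0, -1, 1; 0, 1, -1, 0],
   !![-1, -1, -1, -1; -1, -1, 3, 3; 1, 1, 1, 1; -1, -1, -1, -1],
   !![-1, -1, 1, 1; -1, -1, -1, -1; -1, -1, -1, -1; -1, -1, 1, 1]),
  (!![-1, 1, 0, 0; 1, -1, 0, 0; 0, 1, 1, 0; 0, -1, -1, 0],
   !![0, -1, 0, 0; 0, 1, 0, 0; 2, -1, 0, 0; 0, 1, 0, 0],
   !![0, 4, 0, 0; 0, -4, 0, 0; 4, 0, 0, 0; -4, 0, 0, 0]),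
  (!![-1, -1, 0, 0; 1, 0, 0, 1; -1, 0, 0, -1; 1, 1, 0, 0],
   !![-1, 1, -1, 1; -1, 1, -1, 1; 1, -1, 1, -1; 3, -3, -1, 1],
   !![1, -1, 1, -1; 1, -1, -1, 1; -1, 1, 1, -1; -1, 1, -1, 1]),
  (!![-1, 0, 0, 1; -1, 0, 0, 1; 0, 0, 1, 1; 0, 0, 1, 1],
   !![0, 0, 2, 1; 0, 0, 0, 1; 0, 0, 0, 1; 0, 0, 0, 1],
   !![0, 0, -4, 0; 0, 0, -4, 0; 0, 0, 0, 4; 0, 0, 0, 4]),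
  (!![0, 0, 0, 0; 2, -1, 0, -1; 0, 1, 0, -1; 0, 0, 0, 0],
   !![-1, 0, 0, 0; -1, 0, 0, 2; 1, 0, 0, 0; 1, 0, 0, 0],
   !![0, 0, 0, 0; -4, 0, 0, -4; -4, 0, 0, 4; 0, 0, 0, 0]),
  (!![0, 0, 0, 0; 0, 0, 0, 0; -1, 0, -1, 0; 1, 2, -1, 0],
   !![1, 3, 3, 1; 1, -1, -1, 1; -1, 1, 1, -1; 1, -1, -1, 1],
   !![0, 0, 0, 0; 0, 0, 0, 0; 0, -2, -2, 0; 2, 0, 0, 2])]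

/-- Eight of the terms of `matMulTerms`. -/
def matMulTermsE : List (Matrix (Fin 4) (Fin 4) ℤ × Matrix (Fin 4) (Fin 4) ℤ ×
    Matrix (Fin 4) (Fin 4) ℤ) := [
  (!![1, 2, -1, 0; -1, 0, -1, 0; 0, 0, 0, 0; 0, 0, 0, 0],
   !![1, 1, 1, 1; 1, 1, 1, 1; 3, -1, -1, 3; 1, 1, 1, 1],
   !![0, 2, 2, 0; -2, 0, 0, -2; 0, 0, 0, 0; 0, 0, 0, 0]),
  (!![2, -1, 0, -1; 0, 0, 0, 0; 0, 0, 0, 0; 0, 1, 0, -1],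
   !![0, 0, 0, 1; 0, 0, 0, -1; 0, 0, 0, -1; 2, 0, 0, 1],
   !![-4, 0, 0, 4; 0, 0, 0, 0; 0, 0, 0, 0; -4, 0, 0, -4]),
  (!![0, 1, -1, 0; 0, 0, -1, 1; 0, 0, 1, -1; 0, -1, 1, 0],
   !![-1, -1, 1, 1; -1, -1, 1, 1; 1, 1, -1, -1; 3, 3, 1, 1],
   !![-1, -1, 1, 1; 1, 1, 1, 1; -1, -1, -1, -1; 1, 1, -1, -1]),
  (!![1, -1, 0, 0; 1, -1, 0, 0; 0, 1, 1, 0; 0, 1, 1, 0],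
   !![1, 2, 0, 0; 1, 0, 0, 0; 1, 0, 0, 0; 1, 0, 0, 0],
   !![0, 4, 0, 0; 0, 4, 0, 0; 4, 0, 0, 0; 4, 0, 0, 0]),
  (!![-1, -1, 0, 0; 1, 0, 0, 1; 1, 0, 0, 1; -1, -1, 0, 0],
   !![1, -1, -1, 1; 1, -1, 3, -3; -1, 1, 1, -1; 1, -1, -1, 1],
   !![-1, 1, -1, 1; 1, -1, -1, 1; 1, -1, -1, 1; -1, 1, -1, 1]),
  (!![1, 0, 0, -1; -1, 0, 0, 1; 0, 0, 1, 1; 0, 0, -1, -1],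
   !![0, 0, -1, 0; 0, 0, 1, 0; 0, 0, -1, 2; 0, 0, 1, 0],
   !![0, 0, -4, 0; 0, 0, 4, 0; 0, 0, 0, 4; 0, 0, 0, -4]),
  (!![0, 0, 0, 0; 0, -1, 0, 1; 0, 1, 2, 1; 0, 0, 0, 0],
   !![0, -1, 0, 0; 0, -1, 2, 0; 0, 1, 0, 0; 0, 1, 0, 0],
   !![0, 0, 0, 0; 0, 4, -4, 0; 0, 4, 4, 0; 0, 0, 0, 0]),
  (!![0, 0, 0, 0; 0, 0, 0, 0; 1, 0, -1, 2; -1, 0, -1, 0],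
   !![-1, -3, 3, 1; -1, 1, -1, 1; 1, -1, 1, -1; -1, 1, -1, 1],
   !![0, 0, 0, 0; 0, 0, 0, 0; -2, 0, 0, 2; 0, 2, -2, 0])]

/-- Eight of the terms of `matMulTerms`. -/
def matMulTermsF : List (Matrix (Fin 4) (Fin 4) ℤ × Matrix (Fin 4) (Fin 4) ℤ ×
    Matrix (Fin 4) (Fin 4) ℤ) := [
  (!![0, 0, 0, 0; 0, 0, 0, 0; 0, 0, 0, 0; 0, 1, 1, 0],
   !![0, 1, 1, 0; 0, -1, -1, 0; 0, -1, -1, 0; 0, 1, 1, 0],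
   !![0, -8, 0, 0; 0, 0, 0, 0; 0, 0, 0, 0; 0, -8, 0, 0]),
  (!![0, 0, 0, 0; 0, 0, 1, -1; 0, 0, 0, 0; 0, 0, 0, 0],
   !![0, 0, 0, 0; 0, 0, 0, 0; 1, 0, 0, -1; 0, 0, 0, 0],
   !![-8, -8, 8, 8; 8, 8, -8, -8; 0, 0, 0, 0; 0, 0, 0, 0]),
  (!![0, 1, 1, 0; 0, -1, -1, 0; 0, 1, 1, 0; 0, -1, -1, 0],
   !![0, 0, 0, 0; 0, 0, 0, 0; -1, 1, 0, 0; 0, 0, 0, 0],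
   !![0, 8, 0, 0; 0, -8, 0, 0; 0, 0, 0, 0; 0, 0, 0, 0]),
  (!![0, 0, 1, -1; 0, 0, 1, -1; 0, 0, 1, -1; 0, 0, 1, -1],
   !![0, 0, 1, 1; 0, 0, -1, -1; 0, 0, -1, -1; 0, 0, 1, 1],
   !![2, 2, -2, -2; 0, 0, 0, 0; 0, 0, 0, 0; 2, 2, -2, -2]),
  (!![-1, 0, 0, 1; -1, 0, 0, 1; -1, 0, 0, 1; -1, 0, 0, 1],
   !![0, 0, 1, 1; 0, 0, 0, 0; 0, 0, 0, 0; 0, 0, 0, 0],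
   !![0, 0, 0, 0; 0, 0, 0, 0; 0, 0, 0, -8; 0, 0, 0, -8]),
  (!![-1, -1, 0, 0; 1, 1, 0, 0; -1, -1, 0, 0; 1, 1, 0, 0],
   !![1, -1, 0, 0; 1, -1, 0, 0; -1, 1, 0, 0; -1, 1, 0, 0],
   !![0, 0, 0, 0; 2, -2, -2, 2; -2, 2, 2, -2; 0, 0, 0, 0]),
  (!![0, 0, 0, 0; 0, 0, 0, 0; 0, 0, 0, 0; 1, 1, 0, 0],
   !![0, 1, 1, 0; 0, 0, 0, 0; 0, 0, 0, 0; 0, 0, 0, 0],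
   !![0, 0, 0, 0; 0, 0, 0, 0; -8, 8, 8, -8; -8, 8, 8, -8]),
  (!![0, 0, 0, 0; 1, 0, 0, -1; 0, 0, 0, 0; 0, 0, 0, 0],
   !![-1, 0, 0, 1; -1, 0, 0, 1; 1, 0, 0, -1; 1, 0, 0, -1],
   !![0, 0, 0, 0; 0, 0, 0, 8; 0, 0, 0, -8; 0, 0, 0, 0])]

/-- The 48 terms `(u, v, 16 • w)` of an integral multiple of a rank-48 bilinear algorithm for
`4 × 4` matrix multiplication. -/
def matMulTerms : List (Matrix (Fin 4) (Fin 4) ℤ × Matrix (Fin 4) (Fin 4) ℤ ×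
    Matrix (Fin 4) (Fin 4) ℤ) :=
  matMulTermsA ++ matMulTermsB ++ matMulTermsC ++ matMulTermsD ++ matMulTermsE ++ matMulTermsF

theorem List.sum_map_filter_of_eq_zero {α M : Type*} [AddMonoid M] (P : α → Bool) (f : α → M)
    (hf : ∀ x, P x = false → f x = 0) (l : List α) :
    ((l.filter P).map f).sum = (l.map f).sum := by
  induction l with
  | nil => rfl
  | cons x l ih =>
    cases hx : P x
    · simp [hx, ih, hf x hx]
    · simp [hx, ih]

theorem sum_trilinearCoeff_matMulTerms (p q p' q' i j : Fin 4) :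
    (matMulTerms.map fun x => trilinearCoeff x p q p' q' i j).sum =
      if i = p ∧ q = p' ∧ q' = j then 16 else 0 := by
  rw [← List.sum_map_filter_of_eq_zero (fun x => x.2.2 i j != 0) _
      (by simp +contextual [trilinearCoeff]),
    ← List.sum_map_filter_of_eq_zero (fun x => x.1 p q != 0) _
      (by simp +contextual [trilinearCoeff])]
  revert i j p q p' q'
  decide +kernel

theorem length_matMulTerms : matMulTerms.length = 48 := rfl

/-- The `t`-th term of the algorithm. -/
def matMulTerm (t : Fin 48) : Matrix (Fin 4) (Fin 4) ℤ × Matrix (Fin 4) (Fin 4) ℤ ×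
    Matrix (Fin 4) (Fin 4) ℤ :=
  matMulTerms.get (t.cast length_matMulTerms.symm)

theorem sum_trilinearCoeff_matMulTerm (p q p' q' i j : Fin 4) :
    ∑ t, trilinearCoeff (matMulTerm t) p q p' q' i j =
      if i = p ∧ q = p' ∧ q' = j then 16 else 0 := by
  rw [← sum_trilinearCoeff_matMulTerms, ← Fin.sum_univ_fun_getElem]
  exact Fintype.sum_equiv (finCongr length_matMulTerms.symm) _ _ fun _ => rfl

/-- For any commutative ring `R` in which 2 is invertible, there exists a
bilinear algorithm of rank 48 for 4×4 by 4×4 matrix multiplication over `R`. -/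
theorem rank48_bilinear_algorithm_4x4_of_invertible_two
    (R : Type*) [CommRing R] [Invertible (2 : R)] :
    ∃ u v w : Fin 48 → Matrix (Fin 4) (Fin 4) R,
      ∀ (A B : Matrix (Fin 4) (Fin 4) R) (i j : Fin 4),
        (A * B) i j =
          ∑ t : Fin 48,
            w t i j * (∑ p : Fin 4, ∑ q : Fin 4, u t p q * A p q) *
              (∑ p : Fin 4, ∑ q : Fin 4, v t p q * B p q) := by
  refine ⟨fun t => (matMulTerm t).1.map (↑), fun t => (matMulTerm t).2.1.map (↑),
    fun t => (⅟2 : R) ^ 4 • (matMulTerm t).2.2.map (↑), fun A B i j => ?_⟩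
  have h16 : (⅟2 : R) ^ 4 * 16 = 1 := by
    rw [show (16 : R) = 2 ^ 4 by norm_num, ← mul_pow, invOf_mul_self, one_pow]
  have hcoeff (p q p' q' : Fin 4) :
      ∑ t, ((trilinearCoeff (matMulTerm t) p q p' q' i j : ℤ) : R) =
        if i = p ∧ q = p' ∧ q' = j then 16 else 0 := by
    rw [← Int.cast_sum, sum_trilinearCoeff_matMulTerm]
    split_ifs <;> simp
  symm
  calc
    _ = ∑ t, ∑ p', ∑ q', ∑ p, ∑ q, (⅟2 : R) ^ 4 *
          (((trilinearCoeff (matMulTerm t) p q p' q' i j : ℤ) : R) * (A p q * B p' q')) := by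
      simp only [Finset.mul_sum, Finset.sum_mul, Matrix.smul_apply, Matrix.map_apply, smul_eq_mul,
        trilinearCoeff, Int.cast_mul]
      congr! 5
      ring
    _ = ∑ p', ∑ q', ∑ p, ∑ q, (⅟2 : R) ^ 4 *
          ((∑ t, ((trilinearCoeff (matMulTerm t) p q p' q' i j : ℤ) : R)) *
            (A p q * B p' q')) := by
      simp only [Finset.sum_mul, Finset.mul_sum]
      rw [Finset.sum_comm]
      refine Finset.sum_congr rfl fun p' _ => ?_
      rw [Finset.sum_comm]
      refine Finset.sum_congr rfl fun q' _ => ?_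
      rw [Finset.sum_comm]
      refine Finset.sum_congr rfl fun p _ => ?_
      rw [Finset.sum_comm]
    _ = (A * B) i j := by
      simp [hcoeff, Matrix.mul_apply, ite_and, ← mul_assoc, h16]
end

section
/- There exists a bilinear algorithm of rank 48 for 4×4 by 4×4 matrix multiplication over ℚ in which every entry of every matrix u t and of every matrix v t (t = 1,…,48) belongs to {−1, 0, 1}, and every entry of every matrix w t is a rational number of the form z/8 with z an integer (i.e., 8·(w t)ᵢⱼ ∈ ℤ for all t, i, j). -/
/-- A `4 × 4` integer matrix whose entries, shifted by `m`, are the base `2 * m + 1` digits of `c`,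
read row by row from the least significant digit. -/
def digitMatrix (m c : ℕ) : Matrix (Fin 4) (Fin 4) ℤ :=
  fun i j => ((c / (2 * m + 1) ^ (4 * i.val + j.val) % (2 * m + 1) : ℕ) : ℤ) - m

theorem digitMatrix_one_mem (c : ℕ) (i j : Fin 4) :
    digitMatrix 1 c i j = -1 ∨ digitMatrix 1 c i j = 0 ∨ digitMatrix 1 c i j = 1 := by
  have h := Nat.mod_lt (c / 3 ^ (4 * i.val + j.val)) (show 0 < 3 by norm_num)
  simp only [digitMatrix]
  omega

/-- The coefficient matrices `(u, v, 2 * w)` of the algorithm, one triple per product; the first two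
are ternary and the third has entries between `-2` and `2`, encoded as in `digitMatrix`. -/
def rank48Codes : List (ℕ × ℕ × ℕ) :=
  [(25827376, 37663420, 90942345312),
   (8766832, 21525656, 88968945312),
   (21521884, 21483988, 76387695072),
   (21470864, 21522704, 90918945312),
   (21536484, 17271184, 76294100064),
   (21525328, 18295348, 88989225312),
   (31090756, 36405976, 76294095072),
   (20447356, 21720220, 76390820064),
   (21524918, 21523354, 77512698442),
   (21687410, 17271832, 76538475938),
   (31745398, 37466590, 77516598442),
   (26307058, 36589684, 76294005312),
   (34811410, 21523388, 76537695938),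
   (23137366, 21722650, 76334570312),
   (21582418, 21470216, 76331445312),
   (21523606, 18294862, 76294010312),
   (34975410, 21785840, 76294335936),
   (31746918, 42784240, 76293948432),
   (8403410, 4307296, 76049805312),
   (21523363, 16739662, 76293815520),
   (11552198, 21520736, 75075195312),
   (21523369, 21464302, 76218945504),
   (23117683, 21525574, 126993945312),
   (26306329, 36049414, 123168825312),
   (25828016, 43046680, 76293964062),
   (8609392, 21789080, 76304101562),
   (30969724, 21310784, 76247070312),
   (21523352, 21523351, 61668907752),
   (20473764, 4304704, 76293867812),
   (21523384, 16740391, 63578352760),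
   (31089298, 35872267, 134981295552),
   (20460478, 21523387, 136744100560),
   (20447276, 21722164, 76237695560),
   (30913636, 36576562, 76293855552),
   (35697088, 18294376, 63598730312),
   (21713604, 17273128, 76538321186),
   (22002224, 21457094, 61706445312),
   (21521964, 21654574, 77418948682),
   (8235472, 21524684, 63862695938),
   (11655616, 37597810, 62868198442),
   (34975250, 21787136, 76303710938),
   (31392678, 42915460, 76293960942),
   (36746930, 4308592, 76538007812),
   (21700483, 16739419, 63578482552),
   (12614918, 21651956, 77465820312),
   (21523449, 21457741, 61743907560),
   (22586323, 21525331, 86044100560),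
   (12134569, 36042853, 88106415552)]

theorem rank48Codes_length : rank48Codes.length = 48 := rfl

/-- The Brent equations for the integer coefficients. -/
theorem rank48Codes_brent (i j p q r s : Fin 4) :
    (rank48Codes.map fun c =>
      digitMatrix 2 c.2.2 i j * digitMatrix 1 c.1 p q * digitMatrix 1 c.2.1 r s).sum =
      if p = i ∧ q = r ∧ s = j then 2 else 0 := by
  revert i j p q r s
  decide +kernel

/-- The `t`-th triple of `rank48Codes`. -/
def rank48Code (t : Fin 48) : ℕ × ℕ × ℕ := rank48Codes.get (t.cast rank48Codes_length.symm)

theorem sum_rank48Code (f : ℕ × ℕ × ℕ → ℤ) :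
    ∑ t : Fin 48, f (rank48Code t) = (rank48Codes.map f).sum :=
  Fin.sum_univ_fun_getElem rank48Codes f

theorem rank48Code_brent (i j p q r s : Fin 4) :
    ∑ t : Fin 48, (digitMatrix 2 (rank48Code t).2.2 i j : ℚ) / 2 *
      digitMatrix 1 (rank48Code t).1 p q * digitMatrix 1 (rank48Code t).2.1 r s =
      if p = i ∧ q = r ∧ s = j then 1 else 0 := by
  have h := (sum_rank48Code _).trans (rank48Codes_brent i j p q r s)
  have h' := congrArg (fun n : ℤ => (n : ℚ) / 2) h
  simp only [Int.cast_sum, Int.cast_mul, Finset.sum_div] at h'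
  calc _ = _ := Finset.sum_congr rfl fun t _ => by ring
    _ = _ := h'
    _ = _ := by split_ifs <;> norm_num

/-- A family of matrices satisfying the Brent equations computes the matrix product. -/
theorem mul_apply_eq_sum_of_brent {R ι l m n : Type*} [CommRing R] [Fintype ι] [Fintype l]
    [Fintype m] [Fintype n] [DecidableEq l] [DecidableEq m] [DecidableEq n]
    {u : ι → Matrix l m R} {v : ι → Matrix m n R} {w : ι → Matrix l n R}
    (h : ∀ i j p q r s, ∑ t, w t i j * u t p q * v t r s =
      if p = i ∧ q = r ∧ s = j then 1 else 0)
    (A : Matrix l m R) (B : Matrix m n R) (i : l) (j : n) :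
    (A * B) i j = ∑ t, w t i j * (∑ p, ∑ q, u t p q * A p q) * (∑ r, ∑ s, v t r s * B r s) := by
  have expand (t : ι) :
      w t i j * (∑ p, ∑ q, u t p q * A p q) * (∑ r, ∑ s, v t r s * B r s) =
        ∑ x : (l × m) × (m × n),
          w t i j * u t x.1.1 x.1.2 * v t x.2.1 x.2.2 * (A x.1.1 x.1.2 * B x.2.1 x.2.2) := by
    simp only [← Fintype.sum_prod_type', Finset.mul_sum _ _ (w t i j), Fintype.sum_mul_sum]
    exact Finset.sum_congr rfl fun x _ => by ring
  simp only [expand]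
  rw [Finset.sum_comm]
  simp only [← Finset.sum_mul, h, Fintype.sum_prod_type, ite_and, ite_mul, one_mul, zero_mul,
    Finset.sum_ite_irrel, Finset.sum_const_zero, Finset.sum_ite_eq, Finset.sum_ite_eq',
    Finset.mem_univ, if_true, Matrix.mul_apply]

/-- There exists a bilinear algorithm of rank 48 for 4×4 by 4×4 matrix
multiplication over ℚ in which every entry of every `u t` and `v t` lies in
{−1, 0, 1}, and every entry of every `w t` is an integer divided by 8. -/
theorem rational_rank48_bilinear_algorithm_4x4_small_coefficients :
    ∃ u v w : Fin 48 → Matrix (Fin 4) (Fin 4) ℚ,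
      (∀ (A B : Matrix (Fin 4) (Fin 4) ℚ) (i j : Fin 4),
        (A * B) i j =
          ∑ t : Fin 48,
            w t i j * (∑ p : Fin 4, ∑ q : Fin 4, u t p q * A p q) *
              (∑ p : Fin 4, ∑ q : Fin 4, v t p q * B p q)) ∧
      (∀ (t : Fin 48) (i j : Fin 4), u t i j = -1 ∨ u t i j = 0 ∨ u t i j = 1) ∧
      (∀ (t : Fin 48) (i j : Fin 4), v t i j = -1 ∨ v t i j = 0 ∨ v t i j = 1) ∧
      (∀ (t : Fin 48) (i j : Fin 4), ∃ z : ℤ, 8 * w t i j = (z : ℚ)) := by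
  refine ⟨fun t => (digitMatrix 1 (rank48Code t).1).map (↑),
    fun t => (digitMatrix 1 (rank48Code t).2.1).map (↑),
    fun t => (digitMatrix 2 (rank48Code t).2.2).map fun z => (z : ℚ) / 2,
    mul_apply_eq_sum_of_brent rank48Code_brent, fun t i j => ?_, fun t i j => ?_, fun t i j => ?_⟩
  · simp only [Matrix.map_apply]
    exact_mod_cast digitMatrix_one_mem (rank48Code t).1 i j
  · simp only [Matrix.map_apply]
    exact_mod_cast digitMatrix_one_mem (rank48Code t).2.1 i j
  · exact ⟨4 * digitMatrix 2 (rank48Code t).2.2 i j, by simp; ring⟩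
end

section
/- (de Groot's transitivity theorem.) Let u t, v t, w t ∈ M₂(ℝ), t = 1,…,7, be any family such that for all X, Y, Z ∈ M₂(ℝ): ∑_{t=1}^{7} ⟨u t, X⟩·⟨v t, Y⟩·⟨w t, Z⟩ = Tr(X·Y·Z), and let s t, p t, q t ∈ M₂(ℝ), t = 1,…,7, be another family satisfying the same identity (for instance Strassen's decomposition). Then there exist invertible matrices U, V, W ∈ GL₂(ℝ), a permutation σ of {1,…,7}, and nonzero scalars α_t, β_t, γ_t ∈ ℝ with α_t·β_t·γ_t = 1 for each t, such that u_{σ(t)} = α_t·(Uᵀ)⁻¹·(s t)·Vᵀ, v_{σ(t)} = β_t·(Vᵀ)⁻¹·(p t)·Wᵀ, and w_{σ(t)} = γ_t·(Wᵀ)⁻¹·(q t)·Uᵀ for all t; i.e., the isotropy group acts transitively on the rank-7 decompositions of the 2×2 matrix-multiplication tensor over ℝ. -/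
open Matrix

/-- The Frobenius inner product of two matrices of the same shape. -/
def frob {F : Type*} [CommRing F] {a b : ℕ}
    (M N : Matrix (Fin a) (Fin b) F) : F :=
  ∑ i : Fin a, ∑ j : Fin b, M i j * N i j

namespace DeGroot

/-- The 2×2 real matrices. -/
abbrev M2 := Matrix (Fin 2) (Fin 2) ℝ

/-- `(u, v, w)` is a rank-7 decomposition of the 2×2 matrix-multiplication tensor. -/
def IsDec (u v w : Fin 7 → M2) : Prop :=
  ∀ X Y Z : M2, ∑ t, frob (u t) X * frob (v t) Y * frob (w t) Z = trace (X * Y * Z)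

/-- Some three members of the family are linearly dependent. -/
def Dep (a : Fin 7 → M2) : Prop :=
  ∃ (s : Finset (Fin 7)) (c : Fin 7 → ℝ), s.card ≤ 3 ∧ (∃ t ∈ s, c t ≠ 0) ∧
    ∑ t ∈ s, c t • a t = 0

/-- The quarter turn of a plane vector. -/
def perp (x : Fin 2 → ℝ) : Fin 2 → ℝ := ![-x 1, x 0]

/-- The area form of the plane. -/
def area (x y : Fin 2 → ℝ) : ℝ := x 0 * y 1 - x 1 * y 0

lemma frob_eq (M N : M2) :
    frob M N = M 0 0 * N 0 0 + M 0 1 * N 0 1 + M 1 0 * N 1 0 + M 1 1 * N 1 1 := by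
  simp [frob, Fin.sum_univ_two]; ring

lemma frob_add (M N N' : M2) : frob M (N + N') = frob M N + frob M N' := by
  simp [frob_eq]; ring

lemma frob_sub (M N N' : M2) : frob M (N - N') = frob M N - frob M N' := by
  simp [frob_eq]; ring

lemma frob_smul (M N : M2) (c : ℝ) : frob M (c • N) = c * frob M N := by
  simp [frob_eq]; ring

@[simp] lemma frob_zero (M : M2) : frob M 0 = 0 := by
  simp [frob_eq]

lemma frob_comm (M N : M2) : frob M N = frob N M := by
  simp [frob_eq]; ring

/-- The Frobenius pairing with a fixed matrix, as a linear form. -/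
def frobL (M : M2) : M2 →ₗ[ℝ] ℝ where
  toFun := frob M
  map_add' := frob_add M
  map_smul' c N := frob_smul M N c

lemma frob_sum {ι : Type*} (s : Finset ι) (M : M2) (N : ι → M2) :
    frob M (∑ t ∈ s, N t) = ∑ t ∈ s, frob M (N t) := map_sum (frobL M) N s

lemma frob_vecMulVec (M : M2) (x a : Fin 2 → ℝ) : frob M (vecMulVec x a) = (x ᵥ* M) ⬝ᵥ a := by
  simp [frob_eq, vecMulVec_apply, dotProduct, vecMul, Fin.sum_univ_two]; ring

lemma frob_eq_trace (M N : M2) : frob M N = trace (Mᵀ * N) := by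
  simp [frob_eq, trace, Matrix.mul_apply, Fin.sum_univ_two]; ring

lemma frob_self_eq_zero {M : M2} (h : frob M M = 0) : M = 0 := by
  rw [frob_eq] at h
  have h0 := mul_self_nonneg (M 0 0)
  have h1 := mul_self_nonneg (M 0 1)
  have h2 := mul_self_nonneg (M 1 0)
  have h3 := mul_self_nonneg (M 1 1)
  ext i j
  fin_cases i <;> fin_cases j <;> simp <;> apply mul_self_eq_zero.mp <;> linarith

lemma eq_zero_of_frob {M : M2} (h : ∀ N, frob M N = 0) : M = 0 := frob_self_eq_zero (h M)

lemma perp_ne_zero {x : Fin 2 → ℝ} (hx : x ≠ 0) : perp x ≠ 0 := by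
  intro h
  apply hx
  have h0 := congrFun h 0
  have h1 := congrFun h 1
  simp [perp] at h0 h1
  ext i; fin_cases i <;> simp [h0, h1]

lemma exists_perp (a : Fin 2 → ℝ) : ∃ x, perp x = a := by
  refine ⟨![a 1, -a 0], ?_⟩
  ext i; fin_cases i <;> simp [perp]

lemma dot_eq (x y : Fin 2 → ℝ) : x ⬝ᵥ y = x 0 * y 0 + x 1 * y 1 := by
  simp [dotProduct, Fin.sum_univ_two]

lemma dot_self_ne_zero {x : Fin 2 → ℝ} (hx : x ≠ 0) : x ⬝ᵥ x ≠ 0 :=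
  fun h => hx (dotProduct_self_eq_zero.mp h)

/-- Two plane vectors annihilated by a nonzero vector are parallel. -/
lemma area_eq_zero_of_dot {p q a : Fin 2 → ℝ} (ha : a ≠ 0) (hp : p ⬝ᵥ a = 0) (hq : q ⬝ᵥ a = 0) :
    area p q = 0 := by
  rw [dot_eq] at hp hq
  by_contra h
  apply ha
  have h0 : area p q * a 0 = 0 := by simp only [area]; linear_combination q 1 * hp - p 1 * hq
  have h1 : area p q * a 1 = 0 := by simp only [area]; linear_combination p 0 * hq - q 0 * hp
  ext i; fin_cases i
  · simpa [h] using h0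
  · simpa [h] using h1

lemma eq_zero_of_area_ne_zero {p q a : Fin 2 → ℝ} (h : area p q ≠ 0) (hp : p ⬝ᵥ a = 0)
    (hq : q ⬝ᵥ a = 0) : a = 0 := by
  by_contra ha
  exact h (area_eq_zero_of_dot ha hp hq)

lemma area_ne_zero_of_dot {p q a : Fin 2 → ℝ} (hp : p ≠ 0) (hpa : p ⬝ᵥ a = 0)
    (hqa : q ⬝ᵥ a ≠ 0) : area p q ≠ 0 := by
  intro h
  rw [dot_eq] at hpa hqa
  simp only [area] at h
  have hq0 : p 0 * (q 0 * a 0 + q 1 * a 1) = 0 := by linear_combination q 0 * hpa + a 1 * h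
  have hq1 : p 1 * (q 0 * a 0 + q 1 * a 1) = 0 := by linear_combination q 1 * hpa - a 0 * h
  apply hp
  ext i; fin_cases i
  · simpa [hqa] using hq0
  · simpa [hqa] using hq1

lemma area_comm (p q : Fin 2 → ℝ) : area p q = - area q p := by simp only [area]; ring

lemma exists_dot_eq {p q : Fin 2 → ℝ} (h : area p q ≠ 0) (c d : ℝ) :
    ∃ a, p ⬝ᵥ a = c ∧ q ⬝ᵥ a = d := by
  refine ⟨![(c * q 1 - d * p 1) / area p q, (d * p 0 - c * q 0) / area p q], ?_, ?_⟩ <;>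
  · simp only [dot_eq, cons_val_zero, cons_val_one]
    field_simp
    simp only [area]; ring

/-- Fewer than four linear forms on the matrix space have a common nonzero zero. -/
lemma exists_common_zero (s : Finset (Fin 7)) (hs : s.card < 4) (a : Fin 7 → M2) :
    ∃ Y : M2, Y ≠ 0 ∧ ∀ t ∈ s, frob (a t) Y = 0 := by
  let φ : M2 →ₗ[ℝ] (s → ℝ) := LinearMap.pi fun t => frobL (a t)
  have hφ : LinearMap.ker φ ≠ ⊥ := by
    apply LinearMap.ker_ne_bot_of_finrank_lt
    simp [M2, Module.finrank_matrix]
    omega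
  obtain ⟨Y, hY, hY0⟩ := Submodule.exists_mem_ne_zero_of_ne_bot hφ
  exact ⟨Y, hY0, fun t ht => congrFun (LinearMap.mem_ker.mp hY) ⟨t, ht⟩⟩

lemma exists_common_zero₃ (A B C : M2) :
    ∃ Y : M2, Y ≠ 0 ∧ frob A Y = 0 ∧ frob B Y = 0 ∧ frob C Y = 0 := by
  obtain ⟨Y, hY, h⟩ := exists_common_zero {0, 1, 2} (by decide) ![A, B, C, 0, 0, 0, 0]
  exact ⟨Y, hY, h 0 (by simp), h 1 (by simp), h 2 (by simp)⟩

/-- Linear forms indexed by `s` with no common nonzero zero are at least four in number. -/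
lemma four_le_card {s : Finset (Fin 7)} {a : Fin 7 → M2}
    (h : ∀ Y, (∀ t ∈ s, frob (a t) Y = 0) → Y = 0) : 4 ≤ s.card := by
  by_contra hs
  obtain ⟨Y, hY, hY'⟩ := exists_common_zero s (by omega) a
  exact hY (h Y hY')

/-- Four linear forms with no common nonzero zero take arbitrary values. -/
lemma exists_prescribed {s : Finset (Fin 7)} {a : Fin 7 → M2} (hs : s.card = 4)
    (h : ∀ Y, (∀ t ∈ s, frob (a t) Y = 0) → Y = 0) (c : Fin 7 → ℝ) :
    ∃ Y, ∀ t ∈ s, frob (a t) Y = c t := by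
  let φ : M2 →ₗ[ℝ] (s → ℝ) := LinearMap.pi fun t => frobL (a t)
  have hinj : Function.Injective φ := by
    rw [← LinearMap.ker_eq_bot, LinearMap.ker_eq_bot']
    intro Y hY
    exact h Y fun t ht => congrFun hY ⟨t, ht⟩
  have hsurj : Function.Surjective φ := by
    rwa [← LinearMap.injective_iff_surjective_of_finrank_eq_finrank]
    simp [M2, Module.finrank_matrix, hs]
  obtain ⟨Y, hY⟩ := hsurj fun t => c t
  exact ⟨Y, fun t ht => congrFun hY ⟨t, ht⟩⟩

/-- A nonzero singular 2×2 matrix is an outer product. -/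
lemma exists_vecMulVec {X : M2} (hX : X ≠ 0) (hdet : X.det = 0) :
    ∃ x a : Fin 2 → ℝ, x ≠ 0 ∧ a ≠ 0 ∧ X = vecMulVec x a := by
  rw [det_fin_two] at hdet
  have key : ∃ x a : Fin 2 → ℝ, X = vecMulVec x a := by
    by_cases h0 : X 0 0 = 0 ∧ X 0 1 = 0
    · refine ⟨![0, 1], X 1, ?_⟩
      ext i j; fin_cases i <;> fin_cases j <;> simp [vecMulVec_apply, h0]
    · by_cases h00 : X 0 0 = 0
      · have h01 : X 0 1 ≠ 0 := fun h => h0 ⟨h00, h⟩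
        refine ⟨![1, X 1 1 / X 0 1], X 0, ?_⟩
        ext i j; fin_cases i <;> fin_cases j <;> simp [vecMulVec_apply, h01]
        rw [h00]; simpa [h00, h01] using hdet
      · refine ⟨![1, X 1 0 / X 0 0], X 0, ?_⟩
        ext i j; fin_cases i <;> fin_cases j <;> simp [vecMulVec_apply, h00]
        field_simp; linarith
  obtain ⟨x, a, rfl⟩ := key
  refine ⟨x, a, ?_, ?_, rfl⟩ <;> rintro rfl <;> simp at hX

lemma vecMulVec_ne_zero {x a : Fin 2 → ℝ} (hx : x ≠ 0) (ha : a ≠ 0) : vecMulVec x a ≠ (0 : M2) := by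
  obtain ⟨i, hi⟩ := Function.ne_iff.mp hx
  obtain ⟨j, hj⟩ := Function.ne_iff.mp ha
  intro h
  have := congrFun (congrFun h i) j
  simp [vecMulVec_apply] at this
  simp_all

lemma perp_vecMul_vecMulVec (x a : Fin 2 → ℝ) : perp x ᵥ* vecMulVec x a = 0 := by
  ext i; simp [perp, vecMul, dotProduct, Fin.sum_univ_two, vecMulVec_apply]; ring

/-- A matrix killed on the left by `perp x` has its columns on the line of `x`. -/
lemma eq_vecMulVec_of_perp {x : Fin 2 → ℝ} (hx : x ≠ 0) {X : M2} (h : perp x ᵥ* X = 0) :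
    ∃ a, X = vecMulVec x a := by
  have hd := dot_self_ne_zero hx
  rw [dot_eq] at hd
  refine ⟨fun j => (x 0 * X 0 j + x 1 * X 1 j) / (x 0 * x 0 + x 1 * x 1), ?_⟩
  ext i j
  have := congrFun h j
  simp only [perp, vecMul, dotProduct, Fin.sum_univ_two, cons_val_zero, cons_val_one,
    Pi.zero_apply] at this
  rw [vecMulVec_apply]
  fin_cases i
  · change X 0 j = x 0 * _
    rw [← mul_div_assoc, eq_div_iff hd]
    linear_combination -(x 1 * this)
  · change X 1 j = x 1 * _
    rw [← mul_div_assoc, eq_div_iff hd]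
    linear_combination x 0 * this

lemma isUnit_of_det_ne_zero {X : M2} (h : X.det ≠ 0) : IsUnit X :=
  (Matrix.isUnit_iff_isUnit_det X).mpr (isUnit_iff_ne_zero.mpr h)

lemma eq_zero_of_mul_eq_zero {X Y : M2} (h : X.det ≠ 0) (hXY : X * Y = 0) : Y = 0 := by
  exact (isUnit_of_det_ne_zero h).mul_right_eq_zero.mp hXY

namespace IsDec

variable {u v w : Fin 7 → M2}

lemma rotate (h : IsDec u v w) : IsDec v w u := by
  intro X Y Z
  rw [Matrix.trace_mul_cycle, ← h Z X Y]
  exact Finset.sum_congr rfl fun t _ => by ring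

lemma mul_eq (h : IsDec u v w) (X Y : M2) :
    X * Y = ∑ t, (frob (u t) X * frob (v t) Y) • (w t)ᵀ := by
  rw [← sub_eq_zero]
  apply eq_zero_of_frob
  intro N
  have := h X Y Nᵀ
  have e : ∀ M : M2, frob M N = trace (M * Nᵀ) := by
    intro M; rw [frob_comm, frob_eq_trace, Matrix.trace_mul_comm]
  rw [frob_comm, frob_sub, frob_sum, frob_comm, e, ← this, sub_eq_zero]
  refine Finset.sum_congr rfl fun t _ => ?_
  simp [frob_eq]; ring

end IsDec

end DeGroot

namespace DeGroot

lemma area_eq_neg_dot (y z : Fin 2 → ℝ) : area y z = -(y ⬝ᵥ perp z) := by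
  simp only [area, dot_eq, perp, cons_val_zero, cons_val_one]; ring

lemma dot_perp_self (x : Fin 2 → ℝ) : x ⬝ᵥ perp x = 0 := by
  simp only [dot_eq, perp, cons_val_zero, cons_val_one]; ring

lemma exists_dot_eq_zero (q : Fin 2 → ℝ) : ∃ b, b ≠ 0 ∧ q ⬝ᵥ b = 0 := by
  by_cases hq : q = 0
  · exact ⟨1, one_ne_zero, by simp [hq]⟩
  · exact ⟨perp q, perp_ne_zero hq, dot_perp_self q⟩

lemma eq_zero_of_forall_vecMul {z : Fin 2 → ℝ} (hz : z ≠ 0) {Y : M2}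
    (h : ∀ X : M2, (z ᵥ* X) ᵥ* Y = 0) : Y = 0 := by
  have hb : ∀ b, b ᵥ* Y = 0 := by
    intro b
    have := h (vecMulVec z b)
    rw [vecMul_vecMulVec, smul_vecMul] at this
    exact (smul_eq_zero.mp this).resolve_left (dot_self_ne_zero hz)
  ext i j
  simpa [Matrix.single_one_vecMul] using congrFun (hb (Pi.single i 1)) j

/-- A vanishing linear combination of four independent members has zero coefficients. -/
lemma coeff_eq_zero {s : Finset (Fin 7)} {a : Fin 7 → M2} (hs : s.card = 4)
    (h : ∀ Y, (∀ t ∈ s, frob (a t) Y = 0) → Y = 0) {c : Fin 7 → ℝ}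
    (hc : ∑ t ∈ s, c t • a t = 0) {r : Fin 7} (hr : r ∈ s) : c r = 0 := by
  obtain ⟨Y, hY⟩ := exists_prescribed hs h (Pi.single r 1)
  have : frob Y (∑ t ∈ s, c t • a t) = 0 := by rw [hc, frob_zero]
  rw [frob_sum, Finset.sum_eq_single_of_mem r hr] at this
  · rw [frob_smul, frob_comm, hY r hr] at this
    simpa using this
  · intro t ht htr
    rw [frob_smul, frob_comm, hY t ht, Pi.single_eq_of_ne htr, mul_zero]

lemma Dep.of_sum {s : Finset (Fin 7)} {a : Fin 7 → M2} {c : Fin 7 → ℝ} (hs : s.card ≤ 3)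
    {r : Fin 7} (hr : c r ≠ 0) (hc : ∑ t, c t • a t = 0) (h : ∀ t, t ∉ s → c t = 0) : Dep a := by
  refine ⟨s, c, hs, ⟨r, ?_, hr⟩, ?_⟩
  · by_contra hrs
    exact hr (h r hrs)
  · rw [← hc]
    refine Finset.sum_subset (Finset.subset_univ s) fun t _ ht => ?_
    rw [h t ht, zero_smul]

namespace IsDec

variable {u v w : Fin 7 → M2}

lemma vecMul_mul_eq (h : IsDec u v w) (z : Fin 2 → ℝ) (X Y : M2) :
    (z ᵥ* X) ᵥ* Y = ∑ t, (frob (u t) X * frob (v t) Y) • (w t *ᵥ z) := by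
  rw [vecMul_vecMul, h.mul_eq]
  ext j
  simp only [vecMul, dotProduct, Matrix.sum_apply, Finset.sum_apply, Matrix.smul_apply,
    Pi.smul_apply, smul_eq_mul, transpose_apply, mulVec, Finset.mul_sum]
  rw [Finset.sum_comm]
  exact Finset.sum_congr rfl fun t _ => Finset.sum_congr rfl fun i _ => by ring

lemma eq_zero (h : IsDec u v w) {X : M2} (hX : ∀ t, frob (u t) X = 0) : X = 0 := by
  have := h.mul_eq X 1
  simpa [hX] using this

lemma exists_partner (h : IsDec u v w) {x : Fin 2 → ℝ} {i : Fin 7} (hi : x ᵥ* u i ≠ 0) :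
    ∃ j, area (x ᵥ* u i) (x ᵥ* u j) ≠ 0 := by
  by_contra! hc
  have hx : x ≠ 0 := by rintro rfl; simp at hi
  refine vecMulVec_ne_zero hx (perp_ne_zero hi) (h.eq_zero fun t => ?_)
  rw [frob_vecMulVec]
  have := hc t
  rw [area_comm, area_eq_neg_dot] at this
  simpa using this

lemma exists_vecMul_ne_zero (h : IsDec u v w) {x : Fin 2 → ℝ} (hx : x ≠ 0) :
    ∃ i, x ᵥ* u i ≠ 0 := by
  by_contra! hc
  refine vecMulVec_ne_zero hx hx (h.eq_zero fun t => ?_)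
  rw [frob_vecMulVec, hc t, zero_dotProduct]

/-- The relation among the `v`s expressing that outer products with column `x` have no component
across `x`. -/
lemma relation (h : IsDec u v w) (x a m : Fin 2 → ℝ) :
    ∑ t, (((x ᵥ* u t) ⬝ᵥ a) * ((w t *ᵥ perp x) ⬝ᵥ m)) • v t = 0 := by
  apply eq_zero_of_frob
  intro Y
  have := congrArg (· ⬝ᵥ m) (h.vecMul_mul_eq (perp x) (vecMulVec x a) Y)
  simp only [perp_vecMul_vecMulVec, zero_vecMul, zero_dotProduct, sum_dotProduct,
    smul_dotProduct, frob_vecMulVec] at this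
  rw [frob_comm, frob_sum, this]
  refine Finset.sum_congr rfl fun t _ => ?_
  rw [frob_smul, frob_comm, smul_eq_mul]
  ring

lemma eq_zero_of_pair (h : IsDec u v w) {x : Fin 2 → ℝ} {i j : Fin 7}
    (hij : area (x ᵥ* u i) (x ᵥ* u j) ≠ 0) {Y : M2}
    (hY : ∀ t, t ≠ i → t ≠ j → w t *ᵥ perp x ≠ 0 → frob (v t) Y = 0) : Y = 0 := by
  have hx : x ≠ 0 := by rintro rfl; simp [area] at hij
  refine eq_zero_of_forall_vecMul (perp_ne_zero hx) fun X => ?_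
  obtain ⟨a, hai, haj⟩ := exists_dot_eq hij (frob (u i) X) (frob (u j) X)
  have e : perp x ᵥ* X = perp x ᵥ* (X - vecMulVec x a) := by
    rw [vecMul_sub, perp_vecMul_vecMulVec, sub_zero]
  rw [e, h.vecMul_mul_eq]
  refine Finset.sum_eq_zero fun t _ => ?_
  rw [frob_sub, frob_vecMulVec]
  by_cases hti : t = i
  · rw [hti, hai]; simp
  by_cases htj : t = j
  · rw [htj, haj]; simp
  by_cases hw : w t *ᵥ perp x = 0
  · rw [hw, smul_zero]
  · rw [hY t hti htj hw]; simp

lemma pair_unique (h : IsDec u v w) {x : Fin 2 → ℝ} {i j t t' : Fin 7}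
    (hij : area (x ᵥ* u i) (x ᵥ* u j) ≠ 0) (hti : t ≠ i) (htj : t ≠ j) (hti' : t' ≠ i)
    (htj' : t' ≠ j) (ht : w t *ᵥ perp x = 0) (ht' : w t' *ᵥ perp x = 0) : t = t' := by
  by_contra hne
  have hij' : i ≠ j := by rintro rfl; simp [area, mul_comm] at hij
  obtain ⟨Y, hY, hY'⟩ := exists_common_zero {i, j, t, t'}ᶜ (by
    rw [Finset.card_compl, Finset.card_insert_of_notMem, Finset.card_insert_of_notMem,
      Finset.card_pair hne] <;> simp [*, Ne.symm, Ne.symm hti, Ne.symm htj, Ne.symm hti', Ne.symm htj']) v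
  refine hY (h.eq_zero_of_pair hij fun r hri hrj hr => hY' r ?_)
  simp only [Finset.mem_compl, Finset.mem_insert, Finset.mem_singleton, not_or]
  refine ⟨hri, hrj, ?_, ?_⟩ <;> rintro rfl <;> contradiction

lemma exists_area_ne_zero (h : IsDec u v w) {x : Fin 2 → ℝ} {i j : Fin 7}
    (hij : area (x ᵥ* u i) (x ᵥ* u j) ≠ 0) {k : Fin 2 → ℝ} (hk : k ≠ 0) (r : Fin 7) :
    ∃ t, t ≠ i ∧ t ≠ j ∧ t ≠ r ∧ area (w t *ᵥ perp x) k ≠ 0 := by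
  by_contra! hc
  have hx : x ≠ 0 := by rintro rfl; simp [area] at hij
  obtain ⟨X, hX, hXi, hXj, hXr⟩ := exists_common_zero₃ (u i) (u j) (u r)
  by_cases hz : perp x ᵥ* X = 0
  · obtain ⟨a, rfl⟩ := eq_vecMulVec_of_perp hx hz
    rw [frob_vecMulVec] at hXi hXj
    apply hX
    rw [eq_zero_of_area_ne_zero hij hXi hXj]
    simp
  · have key := congrArg (· ⬝ᵥ perp k)
      (h.vecMul_mul_eq (perp x) X (vecMulVec (perp x ᵥ* X) (perp k)))
    simp only [vecMul_vecMulVec, sum_dotProduct, smul_dotProduct] at key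
    rw [Finset.sum_eq_zero] at key
    · rw [smul_eq_zero] at key
      rcases key with key | key
      · exact dot_self_ne_zero hz key
      · exact dot_self_ne_zero (perp_ne_zero hk) key
    · intro t _
      by_cases hti : t = i
      · simp [hti, hXi]
      by_cases htj : t = j
      · simp [htj, hXj]
      by_cases htr : t = r
      · simp [htr, hXr]
      · have := hc t hti htj htr
        rw [area_eq_neg_dot, neg_eq_zero] at this
        rw [this, smul_zero]

open Classical in
lemma card_le_two_of_vecMul (h : IsDec u v w) {x : Fin 2 → ℝ} (hx : x ≠ 0) {s : Finset (Fin 7)}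
    (hs : ∀ t ∈ s, x ᵥ* u t = 0) : s.card ≤ 2 := by
  by_contra hcard
  set Q : Finset (Fin 7) := {t | x ᵥ* u t ≠ 0} with hQ
  have hQs : Q.card + s.card ≤ 7 := by
    rw [← Finset.card_union_of_disjoint]
    · exact (Finset.card_le_univ _)
    · rw [Finset.disjoint_left]
      intro t ht hts
      exact (Finset.mem_filter.mp ht).2 (hs t hts)
  have hinj : ∀ Y, (∀ t ∈ Q, frob (v t) Y = 0) → Y = 0 := by
    intro Y hY
    refine eq_zero_of_forall_vecMul hx fun X => ?_
    have hz := h.vecMul_mul_eq x (vecMulVec x (x ᵥ* X)) Y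
    rw [Finset.sum_eq_zero, vecMul_vecMulVec, smul_vecMul] at hz
    · exact (smul_eq_zero.mp hz).resolve_left (dot_self_ne_zero hx)
    · intro t _
      by_cases ht : x ᵥ* u t = 0
      · simp [frob_vecMulVec, ht]
      · simp [hY t (by simp [hQ, ht])]
  have h4 := four_le_card hinj
  have hQ4 : Q.card = 4 := by omega
  have hw : ∀ t ∈ Q, w t *ᵥ perp x = 0 := by
    intro t ht
    have hpt := (Finset.mem_filter.mp ht).2
    by_contra hwt
    have hr := h.relation x (x ᵥ* u t) (w t *ᵥ perp x)
    rw [← Finset.sum_subset (Finset.subset_univ Q)] at hr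
    · have := coeff_eq_zero hQ4 hinj hr ht
      exact mul_ne_zero (dot_self_ne_zero hpt) (dot_self_ne_zero hwt) this
    · intro r _ hr
      have : x ᵥ* u r = 0 := by simpa [hQ] using hr
      simp [this]
  obtain ⟨i, hi⟩ := h.exists_vecMul_ne_zero hx
  obtain ⟨j, hj⟩ := h.exists_partner hi
  have hlt : 1 < (Q \ {i, j}).card := by
    have := Finset.le_card_sdiff {i, j} Q
    have := Finset.card_le_two (a := i) (b := j)
    omega
  obtain ⟨t, ht, t', ht', hne⟩ := Finset.one_lt_card.mp hlt
  simp only [Finset.mem_sdiff, Finset.mem_insert, Finset.mem_singleton, not_or] at ht ht'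
  exact hne (h.pair_unique hj ht.2.1 ht.2.2 ht'.2.1 ht'.2.2 (hw t ht.1) (hw t' ht'.1))

open Classical in
lemma card_le_two_of_mulVec (h : IsDec u v w) {a : Fin 2 → ℝ} (ha : a ≠ 0) {s : Finset (Fin 7)}
    (hs : ∀ t ∈ s, w t *ᵥ a = 0) : s.card ≤ 2 := by
  by_contra hcard
  obtain ⟨x, rfl⟩ := exists_perp a
  have hx : x ≠ 0 := by rintro rfl; simp [perp] at ha
  have hpair : ∀ {i j}, area (x ᵥ* u i) (x ᵥ* u j) ≠ 0 → (s \ {i, j}).card ≤ 1 := by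
    intro i j hij
    rw [Finset.card_le_one]
    intro t ht t' ht'
    simp only [Finset.mem_sdiff, Finset.mem_insert, Finset.mem_singleton, not_or] at ht ht'
    exact h.pair_unique hij ht.2.1 ht.2.2 ht'.2.1 ht'.2.2 (hs t ht.1) (hs t' ht'.1)
  have hp : ∀ t ∈ sᶜ, x ᵥ* u t = 0 := by
    intro t ht
    by_contra hpt
    obtain ⟨j, hj⟩ := h.exists_partner hpt
    have h1 := hpair hj
    rw [Finset.sdiff_insert_of_notMem (Finset.mem_compl.mp ht)] at h1
    have := Finset.le_card_sdiff {j} s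
    rw [Finset.card_singleton] at this
    omega
  have h2 := h.card_le_two_of_vecMul hx hp
  rw [Finset.card_compl, Fintype.card_fin] at h2
  obtain ⟨i, hi⟩ := h.exists_vecMul_ne_zero hx
  obtain ⟨j, hj⟩ := h.exists_partner hi
  have h1 := hpair hj
  have := Finset.le_card_sdiff {i, j} s
  have := Finset.card_le_two (a := i) (b := j)
  omega

lemma four_le_card_of_det (h : IsDec u v w) {X : M2} (hX : X.det ≠ 0) {s : Finset (Fin 7)}
    (hs : ∀ t, t ∉ s → frob (u t) X = 0) : 4 ≤ s.card := by
  refine four_le_card (a := v) fun Y hY => eq_zero_of_mul_eq_zero hX ?_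
  rw [h.mul_eq]
  refine Finset.sum_eq_zero fun t _ => ?_
  by_cases ht : t ∈ s
  · simp [hY t ht]
  · simp [hs t ht]

lemma two_le_card (h : IsDec u v w) {X : M2} (hX : X ≠ 0) {s : Finset (Fin 7)}
    (hf : ∀ t, t ∉ s → frob (u t) X = 0) : 2 ≤ s.card := by
  by_cases hdet : X.det = 0
  · obtain ⟨x, a, hx, ha, rfl⟩ := exists_vecMulVec hX hdet
    by_contra hc
    obtain ⟨i, hi⟩ := Finset.card_le_one_iff_subset_singleton.mp (show s.card ≤ 1 by omega)
    obtain ⟨b, hb, hvb⟩ := exists_dot_eq_zero (a ᵥ* v i)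
    have hz := h.vecMul_mul_eq x (vecMulVec x a) (vecMulVec a b)
    rw [Finset.sum_eq_zero, vecMul_vecMulVec, vecMul_vecMulVec, smul_dotProduct] at hz
    · exact (smul_ne_zero (smul_ne_zero (dot_self_ne_zero hx) (dot_self_ne_zero ha)) hb) hz
    · intro t _
      by_cases ht : t ∈ s
      · rw [Finset.mem_singleton.mp (hi ht), frob_vecMulVec (v i), hvb]; simp
      · rw [hf t ht]; simp
  · have := h.four_le_card_of_det hdet hf
    omega

open Classical in
/-- If all but two of the forms `u` vanish at some nonzero matrix, then three of the `v`s are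
linearly dependent. -/
lemma dep_of_two (h : IsDec u v w) {X : M2} (hX : X ≠ 0) {s : Finset (Fin 7)} (hs : s.card ≤ 2)
    (hf : ∀ t, t ∉ s → frob (u t) X = 0) : Dep v := by
  by_contra hdep
  have hdet : X.det = 0 := by
    by_contra hd
    have := h.four_le_card_of_det hd hf
    omega
  obtain ⟨x, a, hx, ha, rfl⟩ := exists_vecMulVec hX hdet
  simp only [frob_vecMulVec] at hf
  set S : Finset (Fin 7) := {t | w t *ᵥ perp x = 0} with hS
  set S' : Finset (Fin 7) := {t | (x ᵥ* u t) ⬝ᵥ a ≠ 0} with hS'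
  have hsub : S' ⊆ S := by
    intro t ht
    have hpt := (Finset.mem_filter.mp ht).2
    rw [hS, Finset.mem_filter]
    refine ⟨Finset.mem_univ _, ?_⟩
    by_contra hwt
    refine hdep (Dep.of_sum (s := s) (by omega) (r := t) ?_
      (h.relation x a (w t *ᵥ perp x)) ?_)
    · exact mul_ne_zero hpt (dot_self_ne_zero hwt)
    · intro r hr
      rw [hf r hr, zero_mul]
  have hS2 : S.card ≤ 2 := h.card_le_two_of_mulVec (perp_ne_zero hx) (by simp [hS])
  have hS'2 : 2 ≤ S'.card := h.two_le_card hX fun t ht => by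
    rw [frob_vecMulVec]
    simpa [hS'] using ht
  have hcard := Finset.card_le_card hsub
  have hSS' : S' = S := Finset.eq_of_subset_of_card_le hsub (by omega)
  obtain ⟨r, hr⟩ : S'.Nonempty := Finset.card_pos.mp (by omega)
  have hra := (Finset.mem_filter.mp hr).2
  set P : Finset (Fin 7) := {t | x ᵥ* u t = 0} with hP
  have hP2 : P.card ≤ 2 := h.card_le_two_of_vecMul hx (by simp [hP])
  obtain ⟨t, ht⟩ : ∃ t, t ∉ S ∪ P := by
    by_contra! hc
    have h7 : S ∪ P = Finset.univ := Finset.eq_univ_iff_forall.mpr hc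
    have := Finset.card_union_le S P
    rw [h7, Finset.card_univ, Fintype.card_fin] at this
    omega
  rw [Finset.mem_union, not_or] at ht
  have hwt : w t *ᵥ perp x ≠ 0 := by simpa [hS] using ht.1
  have hpt : x ᵥ* u t ≠ 0 := by simpa [hP] using ht.2
  have hta : (x ᵥ* u t) ⬝ᵥ a = 0 := by
    have := ht.1
    rw [← hSS'] at this
    simpa [hS'] using this
  have hgood := area_ne_zero_of_dot hpt hta hra
  set K : Finset (Fin 7) := (insert t S)ᶜ with hK
  have hK4 : K.card = 4 := by
    rw [hK, Finset.card_compl, Finset.card_insert_of_notMem ht.1, Fintype.card_fin]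
    omega
  have hmemK : ∀ k, k ∈ K ↔ k ≠ t ∧ w k *ᵥ perp x ≠ 0 := by
    intro k; simp [hK, hS]
  have hKinj : ∀ Y, (∀ k ∈ K, frob (v k) Y = 0) → Y = 0 := fun Y hY =>
    h.eq_zero_of_pair hgood fun k hk _ hwk => hY k ((hmemK k).mpr ⟨hk, hwk⟩)
  have hpar : ∀ k, area (w k *ᵥ perp x) (w t *ᵥ perp x) ≠ 0 → (x ᵥ* u k) ⬝ᵥ (x ᵥ* u t) = 0 := by
    intro k hk
    rw [area_eq_neg_dot, neg_ne_zero] at hk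
    have hkK : k ∈ K := by
      rw [hmemK]
      constructor
      · rintro rfl
        exact hk (dot_perp_self _)
      · intro h0
        simp [h0] at hk
    have hrel := h.relation x (x ᵥ* u t) (perp (w t *ᵥ perp x))
    rw [← Finset.sum_subset (Finset.subset_univ K)] at hrel
    · exact (mul_eq_zero.mp (coeff_eq_zero hK4 hKinj hrel hkK)).resolve_right hk
    · intro l _ hl
      rw [hmemK, not_and_or, not_not, not_not] at hl
      rcases hl with rfl | hl
      · rw [dot_perp_self, mul_zero, zero_smul]
      · rw [hl, zero_dotProduct, mul_zero, zero_smul]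
  obtain ⟨t1, ht1, -, -, ha1⟩ := h.exists_area_ne_zero hgood hwt t
  obtain ⟨t2, ht2, -, ht21, ha2⟩ := h.exists_area_ne_zero hgood hwt t1
  refine hdep (Dep.of_sum (s := (insert t1 (insert t2 S))ᶜ) ?_ (r := t) ?_
    (h.relation x (x ᵥ* u t) (w t *ᵥ perp x)) ?_)
  · rw [Finset.card_compl, Finset.card_insert_of_notMem, Finset.card_insert_of_notMem,
      Fintype.card_fin]
    · omega
    · intro hm
      have : w t2 *ᵥ perp x = 0 := by simpa [hS] using hm
      simp [this, area] at ha2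
    · intro hm
      rcases Finset.mem_insert.mp hm with rfl | hm
      · exact ht21 rfl
      have : w t1 *ᵥ perp x = 0 := by simpa [hS] using hm
      simp [this, area] at ha1
  · exact mul_ne_zero (dot_self_ne_zero hpt) (dot_self_ne_zero hwt)
  · intro k hk
    rw [Finset.mem_compl, not_not] at hk
    rcases Finset.mem_insert.mp hk with rfl | hk
    · rw [hpar _ ha1, zero_mul]
    rcases Finset.mem_insert.mp hk with rfl | hk
    · rw [hpar _ ha2, zero_mul]
    have : w k *ᵥ perp x = 0 := by simpa [hS] using hk
    rw [this, zero_dotProduct, mul_zero]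

end IsDec

end DeGroot

namespace DeGroot

lemma exists_smul_perp {ξ x : Fin 2 → ℝ} (hξ : ξ ≠ 0) (h : x ⬝ᵥ ξ = 0) : ∃ c : ℝ, x = c • perp ξ := by
  have hd := dot_self_ne_zero hξ
  rw [dot_eq] at h hd
  refine ⟨(x 1 * ξ 0 - x 0 * ξ 1) / (ξ 0 * ξ 0 + ξ 1 * ξ 1), ?_⟩
  ext i
  rw [Pi.smul_apply, smul_eq_mul, div_mul_eq_mul_div, eq_div_iff hd]
  fin_cases i
  · simp only [perp, Fin.zero_eta, cons_val_zero]
    linear_combination ξ 0 * h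
  · simp only [perp, Fin.mk_one, cons_val_one, cons_val_fin_one]
    linear_combination ξ 1 * h

lemma exists_smul_of_area {x y : Fin 2 → ℝ} (hx : x ≠ 0) (h : area x y = 0) : ∃ c : ℝ, y = c • x := by
  obtain ⟨z, rfl⟩ := exists_perp x
  refine exists_smul_perp (by rintro rfl; simp [perp] at hx) ?_
  simp only [area, perp, dot_eq, cons_val_zero, cons_val_one] at h ⊢
  linarith

lemma frob_vecMulVec_vecMulVec (x a y b : Fin 2 → ℝ) :
    frob (vecMulVec x a) (vecMulVec y b) = (x ⬝ᵥ y) * (a ⬝ᵥ b) := by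
  simp only [frob_eq, vecMulVec_apply, dot_eq]; ring

lemma det_vecMulVec_add (x a y b : Fin 2 → ℝ) :
    (vecMulVec x a + vecMulVec y b).det = area x y * area a b := by
  simp only [det_fin_two, Matrix.add_apply, vecMulVec_apply, area]; ring

lemma frob_transpose (A B : M2) : frob Aᵀ Bᵀ = frob A B := by
  simp only [frob_eq, transpose_apply]; ring

lemma vecMul_eq_zero_of_common {x a y b : Fin 2 → ℝ} (hx : x ≠ 0) (ha : a ≠ 0) (hy : y ≠ 0)
    (hb : b ≠ 0) (h : area x y = 0) (hf : frob (vecMulVec x a) (vecMulVec y b) = 0) {A : M2}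
    (h0 : frob A (vecMulVec x a) = 0) (h1 : frob A (vecMulVec y b) = 0) : x ᵥ* A = 0 := by
  obtain ⟨c, rfl⟩ := exists_smul_of_area hx h
  have hc : c ≠ 0 := by rintro rfl; simp at hy
  rw [frob_vecMulVec_vecMulVec, dotProduct_smul, smul_eq_mul] at hf
  have hab : a ⬝ᵥ b = 0 := (mul_eq_zero.mp hf).resolve_left (mul_ne_zero hc (dot_self_ne_zero hx))
  have harea : area a b ≠ 0 := area_ne_zero_of_dot ha hab (dot_self_ne_zero hb)
  rw [frob_vecMulVec] at h0 h1
  rw [smul_vecMul, smul_dotProduct, smul_eq_mul] at h1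
  refine eq_zero_of_area_ne_zero harea ?_ ?_
  · rw [dotProduct_comm, h0]
  · rw [dotProduct_comm]
    exact (mul_eq_zero.mp h1).resolve_left hc

/-- A pencil of 2×2 matrices contains an invertible one, unless its members share a column line
or a row line. -/
lemma exists_det_ne_zero_of_pencil {X₀ X₁ : M2} (h₀ : X₀ ≠ 0) (h₁ : X₁ ≠ 0) (hf : frob X₀ X₁ = 0)
    (hx : ¬ ∃ x : Fin 2 → ℝ, x ≠ 0 ∧ ∀ A, frob A X₀ = 0 → frob A X₁ = 0 → x ᵥ* A = 0)
    (ha : ¬ ∃ a : Fin 2 → ℝ, a ≠ 0 ∧ ∀ A, frob A X₀ = 0 → frob A X₁ = 0 → A *ᵥ a = 0) :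
    ∃ X : M2, X.det ≠ 0 ∧ ∀ A, frob A X₀ = 0 → frob A X₁ = 0 → frob A X = 0 := by
  by_contra! hc
  have hc' : ∀ X : M2, (∀ A, frob A X₀ = 0 → frob A X₁ = 0 → frob A X = 0) → X.det = 0 := by
    intro X hX
    by_contra hd
    obtain ⟨A, hA₀, hA₁, hA⟩ := hc X hd
    exact hA (hX A hA₀ hA₁)
  obtain ⟨x, a, hx0, ha0, rfl⟩ := exists_vecMulVec h₀ (hc' _ fun A h _ => h)
  obtain ⟨y, b, hy0, hb0, rfl⟩ := exists_vecMulVec h₁ (hc' _ fun A _ h => h)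
  have hd := hc' (vecMulVec x a + vecMulVec y b) fun A h h' => by rw [frob_add, h, h', add_zero]
  rw [det_vecMulVec_add, mul_eq_zero] at hd
  rcases hd with hd | hd
  · exact hx ⟨x, hx0, fun A h h' => vecMul_eq_zero_of_common hx0 ha0 hy0 hb0 hd hf h h'⟩
  · refine ha ⟨a, ha0, fun A h h' => ?_⟩
    rw [← vecMul_transpose]
    rw [← frob_transpose, transpose_vecMulVec, transpose_vecMulVec] at hf
    rw [← frob_transpose, transpose_vecMulVec] at h h'
    exact vecMul_eq_zero_of_common ha0 hx0 hb0 hy0 hd hf h h'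

lemma sq_eq (M : M2) : M * M = M.trace • M - M.det • (1 : M2) := by
  ext i j
  fin_cases i <;> fin_cases j <;>
    simp [Matrix.mul_apply, Fin.sum_univ_two, trace, det_fin_two] <;> ring

namespace IsDec

variable {u v w : Fin 7 → M2}

lemma injective_of_det (h : IsDec u v w) {X : M2} (hX : X.det ≠ 0) {s : Finset (Fin 7)}
    (hs : ∀ t, t ∉ s → frob (u t) X = 0) (Y : M2) (hY : ∀ t ∈ s, frob (v t) Y = 0) : Y = 0 := by
  refine eq_zero_of_mul_eq_zero hX ?_
  rw [h.mul_eq]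
  refine Finset.sum_eq_zero fun t _ => ?_
  by_cases ht : t ∈ s
  · simp [hY t ht]
  · simp [hs t ht]

lemma frob_ne_zero_of_det (h : IsDec u v w) {X : M2} (hX : X.det ≠ 0) {s : Finset (Fin 7)}
    (hs : ∀ t, t ∉ s → frob (u t) X = 0) (hcard : s.card = 4) {t : Fin 7} (ht : t ∈ s) :
    frob (u t) X ≠ 0 := by
  intro h0
  have := h.four_le_card_of_det hX (s := s.erase t) fun r hr => by
    by_cases hrt : r = t
    · rw [hrt, h0]
    · exact hs r fun hrs => hr (Finset.mem_erase.mpr ⟨hrt, hrs⟩)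
  rw [Finset.card_erase_of_mem ht] at this
  omega

/-- If only four products contribute to `X * _`, these diagonalise left multiplication by `M`
wherever no other product contributes to `X * M * _`. -/
lemma ratio_eq (h : IsDec u v w) {X M Y : M2} (hX : X.det ≠ 0) {s : Finset (Fin 7)}
    (hs : ∀ t, t ∉ s → frob (u t) X = 0) (hcard : s.card = 4)
    (hY : ∀ t, t ∉ s → frob (u t) (X * M) * frob (v t) Y = 0) {t : Fin 7} (ht : t ∈ s) :
    frob (u t) X * frob (v t) (M * Y) = frob (u t) (X * M) * frob (v t) Y := by
  obtain ⟨Y', hY'⟩ := exists_prescribed hcard (h.injective_of_det hX hs)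
    fun t => frob (u t) (X * M) * frob (v t) Y / frob (u t) X
  have e : X * (Y' - M * Y) = 0 := by
    rw [Matrix.mul_sub, ← Matrix.mul_assoc, h.mul_eq X, h.mul_eq (X * M), sub_eq_zero]
    refine Finset.sum_congr rfl fun r _ => ?_
    by_cases hr : r ∈ s
    · have := h.frob_ne_zero_of_det hX hs hcard hr
      rw [hY' r hr, mul_div_cancel₀ _ this]
    · rw [hs r hr, hY r hr, zero_mul]
  have e' := sub_eq_zero.mp (eq_zero_of_mul_eq_zero hX e)
  rw [← e', hY' t ht, mul_div_cancel₀ _ (h.frob_ne_zero_of_det hX hs hcard ht)]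

open Classical in
/-- Some two of the `u`s share neither a left nor a right null line. -/
lemma exists_pair (h : IsDec u v w) (hdep : ¬ Dep u) :
    ∃ i j, i ≠ j ∧ (∀ x, x ≠ 0 → x ᵥ* u i = 0 → x ᵥ* u j ≠ 0) ∧
      (∀ a, a ≠ 0 → u i *ᵥ a = 0 → u j *ᵥ a ≠ 0) := by
  have h0 : u 0 ≠ 0 := fun h0 => hdep ⟨{0}, 1, by simp, by simp, by simp [h0]⟩
  by_cases hd : (u 0).det = 0
  · obtain ⟨ξ, α, hξ, hα, he⟩ := exists_vecMulVec h0 hd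
    set P : Finset (Fin 7) := {t | perp ξ ᵥ* u t = 0} with hP
    set S : Finset (Fin 7) := {t | u t *ᵥ perp α = 0} with hS
    have hP2 : P.card ≤ 2 := h.card_le_two_of_vecMul (perp_ne_zero hξ) (by simp [hP])
    have hS2 : S.card ≤ 2 := h.rotate.card_le_two_of_mulVec (perp_ne_zero hα) (by simp [hS])
    obtain ⟨j, hj⟩ : ∃ t, t ∉ P ∪ S := by
      by_contra! hc
      have h7 : P ∪ S = Finset.univ := Finset.eq_univ_iff_forall.mpr hc
      have := Finset.card_union_le P S
      rw [h7, Finset.card_univ, Fintype.card_fin] at this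
      omega
    rw [Finset.mem_union, not_or] at hj
    have hjP : perp ξ ᵥ* u j ≠ 0 := by simpa [hP] using hj.1
    have hjS : u j *ᵥ perp α ≠ 0 := by simpa [hS] using hj.2
    refine ⟨0, j, ?_, ?_, ?_⟩
    · rintro rfl
      exact hjP (by rw [he, perp_vecMul_vecMulVec])
    · intro x hx hx0
      rw [he, vecMul_vecMulVec] at hx0
      obtain ⟨c, rfl⟩ := exists_smul_perp hξ ((smul_eq_zero.mp hx0).resolve_right hα)
      rw [smul_vecMul]
      exact smul_ne_zero (by rintro rfl; simp at hx) hjP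
    · intro a ha ha0
      rw [he, ← vecMul_transpose, transpose_vecMulVec, vecMul_vecMulVec] at ha0
      obtain ⟨c, rfl⟩ := exists_smul_perp hα ((smul_eq_zero.mp ha0).resolve_right hξ)
      rw [mulVec_smul]
      exact smul_ne_zero (by rintro rfl; simp at ha) hjS
  · exact ⟨0, 1, by decide,
      fun x hx hx0 => absurd (Matrix.eq_zero_of_vecMul_eq_zero hd hx0) hx,
      fun a ha ha0 => absurd (Matrix.eq_zero_of_mulVec_eq_zero hd ha0) ha⟩

lemma exists_det_ne_zero_of_pair {i j : Fin 7}
    (hx : ∀ x, x ≠ 0 → x ᵥ* u i = 0 → x ᵥ* u j ≠ 0)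
    (ha : ∀ a, a ≠ 0 → u i *ᵥ a = 0 → u j *ᵥ a ≠ 0) :
    ∃ X : M2, X.det ≠ 0 ∧ frob (u i) X = 0 ∧ frob (u j) X = 0 := by
  obtain ⟨X₀, hX₀, hi₀, hj₀, -⟩ := exists_common_zero₃ (u i) (u j) 0
  obtain ⟨X₁, hX₁, hi₁, hj₁, hf⟩ := exists_common_zero₃ (u i) (u j) X₀
  obtain ⟨X, hX, hA⟩ := exists_det_ne_zero_of_pencil hX₀ hX₁ hf
    (fun ⟨x, hx0, hA⟩ => hx x hx0 (hA _ hi₀ hi₁) (hA _ hj₀ hj₁))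
    (fun ⟨a, ha0, hA⟩ => ha a ha0 (hA _ hi₀ hi₁) (hA _ hj₀ hj₁))
  exact ⟨X, hX, hA _ hi₀ hi₁, hA _ hj₀ hj₁⟩

lemma exists_singular (h : IsDec u v w) {i j : Fin 7} (hij : i ≠ j) :
    ∃ X : M2, X ≠ 0 ∧ X.det = 0 ∧ frob (u i) X = 0 ∧ frob (u j) X = 0 := by
  by_contra! hc
  have hdet : ∀ X, X ≠ 0 → frob (u i) X = 0 → frob (u j) X = 0 → X.det ≠ 0 :=
    fun X h0 hi hj hd => hc X h0 hd hi hj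
  obtain ⟨k, hk⟩ : ∃ k, k ∉ ({i, j} : Finset (Fin 7)) := by
    by_contra! hc
    have h7 : ({i, j} : Finset (Fin 7)) = Finset.univ := Finset.eq_univ_iff_forall.mpr hc
    have := Finset.card_le_two (a := i) (b := j)
    rw [h7, Finset.card_univ, Fintype.card_fin] at this
    omega
  obtain ⟨X, hX, hXi, hXj, hXk⟩ := exists_common_zero₃ (u i) (u j) (u k)
  obtain ⟨X', hX', hXi', hXj', hf⟩ := exists_common_zero₃ (u i) (u j) X
  have hXd := hdet X hX hXi hXj
  obtain ⟨M, rfl⟩ : ∃ M, X' = X * M := by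
    refine ⟨X⁻¹ * X', ?_⟩
    rw [Matrix.mul_nonsing_inv_cancel_left _ _ (isUnit_iff_ne_zero.mpr hXd)]
  set s : Finset (Fin 7) := (insert k {i, j})ᶜ with hs
  have hcard : s.card = 4 := by
    rw [hs, Finset.card_compl, Finset.card_insert_of_notMem hk, Finset.card_pair hij]; rfl
  have hout : ∀ t, t ∉ s → t = k ∨ t = i ∨ t = j := by intro t; simp [hs]; tauto
  have hsX : ∀ t, t ∉ s → frob (u t) X = 0 := by
    intro t ht
    rcases hout t ht with rfl | rfl | rfl <;> assumption
  have hfl : ∀ Y, frob (v k) (M * Y) = frob (Mᵀ * v k) Y := by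
    intro Y
    simp only [frob_eq, Matrix.mul_apply, Fin.sum_univ_two, transpose_apply]; ring
  obtain ⟨Y, hY, hYk, hMYk, -⟩ := exists_common_zero₃ (v k) (Mᵀ * v k) 0
  rw [← hfl] at hMYk
  have hr : ∀ Y, frob (v k) Y = 0 → ∀ t ∈ s,
      frob (u t) X * frob (v t) (M * Y) = frob (u t) (X * M) * frob (v t) Y := by
    intro Y hY t ht
    refine h.ratio_eq hXd hsX hcard (fun r hr => ?_) ht
    rcases hout r hr with rfl | rfl | rfl
    · rw [hY, mul_zero]
    · rw [hXi', zero_mul]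
    · rw [hXj', zero_mul]
  refine hY (h.injective_of_det hXd hsX Y fun t ht => ?_)
  have h1 := hr Y hYk t ht
  have h2 := hr _ hMYk t ht
  rw [← Matrix.mul_assoc, sq_eq, Matrix.sub_mul, frob_sub, Matrix.smul_mul, Matrix.smul_mul,
    frob_smul, frob_smul, Matrix.one_mul] at h2
  have hft := h.frob_ne_zero_of_det hXd hsX hcard ht
  have hZ : (frob (u t) (X * M) • X - frob (u t) X • (X * M)).det ≠ 0 := by
    refine hdet _ ?_ ?_ ?_
    · intro h0
      have := congrArg (frob (X * M)) h0
      rw [frob_sub, frob_smul, frob_smul, frob_zero, frob_comm (X * M) X, hf, mul_zero, zero_sub,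
        neg_eq_zero] at this
      exact hX' (frob_self_eq_zero ((mul_eq_zero.mp this).resolve_left hft))
    · rw [frob_sub, frob_smul, frob_smul, hXi, hXi']; ring
    · rw [frob_sub, frob_smul, frob_smul, hXj, hXj']; ring
  have hZ' : (frob (u t) (X * M) • X - frob (u t) X • (X * M)).det =
      X.det * ((frob (u t) (X * M)) ^ 2 - M.trace * frob (u t) X * frob (u t) (X * M)
        + M.det * (frob (u t) X) ^ 2) := by
    generalize frob (u t) (X * M) = a
    generalize frob (u t) X = b
    simp only [det_fin_two, Matrix.sub_apply, Matrix.smul_apply, smul_eq_mul, Matrix.mul_apply,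
      Fin.sum_univ_two, trace, diag_apply]
    ring
  rw [hZ'] at hZ
  have hq := (mul_ne_zero_iff.mp hZ).2
  refine (mul_eq_zero.mp ?_).resolve_left hq
  linear_combination (-frob (u t) (X * M) + M.trace * frob (u t) X) * h1 - frob (u t) X * h2

open Classical in
/-- In one of the three factors, some three matrices are linearly dependent. -/
lemma dep_or (h : IsDec u v w) : Dep u ∨ Dep v ∨ Dep w := by
  by_contra! hdep
  obtain ⟨hdu, hdv, hdw⟩ := hdep
  obtain ⟨i, j, hij, hx, ha⟩ := h.exists_pair hdu
  obtain ⟨P, hP, hPi, hPj⟩ := exists_det_ne_zero_of_pair hx ha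
  obtain ⟨X, hX, hXd, hXi, hXj⟩ := h.exists_singular hij
  obtain ⟨x, a, hx0, ha0, rfl⟩ := exists_vecMulVec hX hXd
  simp only [frob_vecMulVec] at hXi hXj
  obtain ⟨k, hk, hka⟩ : ∃ k, x ᵥ* u k ≠ 0 ∧ (x ᵥ* u k) ⬝ᵥ a = 0 := by
    by_cases hi : x ᵥ* u i = 0
    · exact ⟨j, hx x hx0 hi, hXj⟩
    · exact ⟨i, hi, hXi⟩
  obtain ⟨t, hta, htw⟩ : ∃ t, (x ᵥ* u t) ⬝ᵥ a ≠ 0 ∧ w t *ᵥ perp x ≠ 0 := by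
    by_contra! hc
    have hS2 := h.card_le_two_of_mulVec (perp_ne_zero hx0)
      (s := {t | w t *ᵥ perp x = 0}) (by simp)
    refine hdv (h.dep_of_two hX hS2 fun t ht => ?_)
    rw [frob_vecMulVec]
    by_contra hta
    exact ht (by simpa using hc t hta)
  have hti : t ≠ i := by rintro rfl; exact hta hXi
  have htj : t ≠ j := by rintro rfl; exact hta hXj
  set F : Finset (Fin 7) := (insert t {i, j})ᶜ with hF
  have hFcard : F.card = 4 := by
    rw [hF, Finset.card_compl, Finset.card_insert_of_notMem (by simp [hti, htj]),
      Finset.card_pair hij]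
    rfl
  have hout : ∀ r, r ∉ F → r = t ∨ r = i ∨ r = j := by intro r; simp [hF]; tauto
  have hrel := h.relation x a (w t *ᵥ perp x)
  have kill : ∀ (Y : M2) (s : Finset (Fin 7)), (∀ r, r ∉ s → r ≠ t → (x ᵥ* u r) ⬝ᵥ a = 0) →
      (∀ r ∈ s, frob (v r) Y = 0) → frob (v t) Y = 0 := by
    intro Y s hs hY
    have := congrArg (frob Y) hrel
    rw [frob_zero, frob_sum, Finset.sum_eq_single t] at this
    · rw [frob_smul, frob_comm] at this
      exact (mul_eq_zero.mp this).resolve_left (mul_ne_zero hta (dot_self_ne_zero htw))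
    · intro r _ hrt
      rw [frob_smul, frob_comm]
      by_cases hr : r ∈ s
      · rw [hY r hr, mul_zero]
      · rw [hs r hr hrt, zero_mul, zero_mul]
    · simp
  have hFinj : ∀ Y, (∀ r ∈ F, frob (v r) Y = 0) → Y = 0 := by
    intro Y hY
    have hYt := kill Y F (fun r hr hrt => by
      rcases hout r hr with rfl | rfl | rfl
      · exact absurd rfl hrt
      · exact hXi
      · exact hXj) hY
    refine h.injective_of_det hP (s := {i, j}ᶜ) (fun r hr => ?_) Y fun r hr => ?_
    · have : r = i ∨ r = j := by simpa [or_comm, -not_and, not_and_or] using hr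
      rcases this with rfl | rfl <;> assumption
    · by_cases hrF : r ∈ F
      · exact hY r hrF
      · rcases hout r hrF with rfl | rfl | rfl
        · exact hYt
        · simp at hr
        · simp at hr
  have hpar : ∀ r, area (w r *ᵥ perp x) (w t *ᵥ perp x) ≠ 0 → (x ᵥ* u r) ⬝ᵥ a = 0 := by
    intro r hr
    by_cases hrF : r ∈ F
    · have hrel' := h.relation x a (perp (w t *ᵥ perp x))
      rw [area_eq_neg_dot, neg_ne_zero] at hr
      rw [← Finset.sum_subset (Finset.subset_univ F)] at hrel'
      · exact (mul_eq_zero.mp (coeff_eq_zero hFcard hFinj hrel' hrF)).resolve_right hr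
      · intro l _ hl
        rcases hout l hl with rfl | rfl | rfl
        · rw [dot_perp_self, mul_zero, zero_smul]
        · rw [hXi, zero_mul, zero_smul]
        · rw [hXj, zero_mul, zero_smul]
    · rcases hout r hrF with rfl | rfl | rfl
      · simp [area, mul_comm] at hr
      · exact hXi
      · exact hXj
  have hgood := area_ne_zero_of_dot hk hka hta
  obtain ⟨r₁, h1k, h1t, -, ha1⟩ := h.exists_area_ne_zero hgood htw t
  obtain ⟨r₂, h2k, h2t, h21, ha2⟩ := h.exists_area_ne_zero hgood htw r₁
  set T : Finset (Fin 7) := {k, r₁, r₂} with hT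
  have hTcard : T.card = 3 := by
    rw [hT, Finset.card_insert_of_notMem (by simp [h1k.symm, h2k.symm]),
      Finset.card_pair h21.symm]
  have htT : t ∉ T := by
    simp only [hT, Finset.mem_insert, Finset.mem_singleton, not_or]
    exact ⟨by rintro rfl; exact hta hka, h1t.symm, h2t.symm⟩
  have hTa : ∀ r ∈ T, (x ᵥ* u r) ⬝ᵥ a = 0 := by
    intro r hr
    simp only [hT, Finset.mem_insert, Finset.mem_singleton] at hr
    rcases hr with rfl | rfl | rfl
    · exact hka
    · exact hpar _ ha1
    · exact hpar _ ha2
  obtain ⟨Y, hY, hYT⟩ := exists_common_zero (insert t T)ᶜ (by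
    rw [Finset.card_compl, Finset.card_insert_of_notMem htT, hTcard, Fintype.card_fin]
    omega) v
  have hYT' : ∀ r, r ∉ T → frob (v r) Y = 0 := by
    intro r hr
    by_cases hrt : r = t
    · rw [hrt]
      refine kill Y _ (fun r hr hrt => ?_) hYT
      exact hTa r (by simpa [hrt] using hr)
    · exact hYT r (by simp [hr, hrt])
  have hYd : Y.det = 0 := by
    by_contra hd
    have := h.rotate.four_le_card_of_det hd hYT'
    omega
  by_cases hall : ∀ r ∈ T, frob (v r) Y ≠ 0
  · obtain ⟨y, b, hy, hb, rfl⟩ := exists_vecMulVec hY hYd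
    have := h.rotate.rotate.card_le_two_of_vecMul (perp_ne_zero hb) (s := T) fun r hr => ?_
    · omega
    by_contra hwr
    refine hdu (Dep.of_sum (s := T) hTcard.le (r := r) (c := fun l => frob (v l) (vecMulVec y b) *
      frob (w l) (vecMulVec (perp b) (perp b ᵥ* w r))) ?_ ?_ ?_)
    · rw [frob_vecMulVec (w r)]
      exact mul_ne_zero (hall r hr) (dot_self_ne_zero hwr)
    · have hz := h.rotate.mul_eq (vecMulVec y b) (vecMulVec (perp b) (perp b ᵥ* w r))
      rw [vecMulVec_mul_vecMulVec, dot_perp_self, zero_smul, vecMulVec_zero] at hz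
      simpa [transpose_sum] using (congrArg transpose hz).symm
    · intro l hl
      rw [hYT' l hl, zero_mul]
  · push Not at hall
    obtain ⟨r, hr, hrY⟩ := hall
    refine hdw (h.rotate.dep_of_two hY (s := T.erase r) ?_ fun l hl => ?_)
    · rw [Finset.card_erase_of_mem hr]; omega
    · by_cases hlr : l = r
      · rw [hlr, hrY]
      · exact hYT' l fun hlT => hl (Finset.mem_erase.mpr ⟨hlr, hlT⟩)

end IsDec

end DeGroot

namespace DeGroot

/-- Two families of triples agree up to the isotropy action, rescaling and permutation. -/
def Rel (u v w u' v' w' : Fin 7 → M2) : Prop :=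
  ∃ (A B C : GL (Fin 2) ℝ) (σ : Equiv.Perm (Fin 7)) (α β γ : Fin 7 → ℝ),
    (∀ t, α t * β t * γ t = 1) ∧
    ∀ t, u' (σ t) = α t • ((A : M2) * u t * (B⁻¹ : GL (Fin 2) ℝ)) ∧
      v' (σ t) = β t • ((B : M2) * v t * (C⁻¹ : GL (Fin 2) ℝ)) ∧
      w' (σ t) = γ t • ((C : M2) * w t * (A⁻¹ : GL (Fin 2) ℝ))

lemma gl_mul_inv (A : GL (Fin 2) ℝ) : (A : M2) * (A⁻¹ : GL (Fin 2) ℝ) = 1 := by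
  rw [← Units.val_mul, mul_inv_cancel, Units.val_one]

lemma gl_inv_mul (A : GL (Fin 2) ℝ) : ((A⁻¹ : GL (Fin 2) ℝ) : M2) * A = 1 := by
  rw [← Units.val_mul, inv_mul_cancel, Units.val_one]

lemma gl_inv_smul {A B : GL (Fin 2) ℝ} {M N : M2} {c c' : ℝ} (hc : c' * c = 1)
    (h : N = c • ((A : M2) * M * (B⁻¹ : GL (Fin 2) ℝ))) :
    M = c' • ((A⁻¹ : GL (Fin 2) ℝ) * N * ((B⁻¹)⁻¹ : GL (Fin 2) ℝ)) := by
  rw [h, inv_inv, Matrix.mul_smul, Matrix.smul_mul, smul_smul, hc, one_smul]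
  simp only [Matrix.mul_assoc, gl_inv_mul, Matrix.mul_one]
  rw [← Matrix.mul_assoc, gl_inv_mul, Matrix.one_mul]

lemma frob_mul_mul (P M Q X : M2) : frob (P * M * Q) X = frob M (Pᵀ * X * Qᵀ) := by
  simp only [frob_eq, Matrix.mul_apply, Fin.sum_univ_two, transpose_apply]
  ring

namespace Rel

variable {u v w u' v' w' u'' v'' w'' : Fin 7 → M2}

lemma symm (h : Rel u v w u' v' w') : Rel u' v' w' u v w := by
  obtain ⟨A, B, C, σ, α, β, γ, h1, h2⟩ := h
  refine ⟨A⁻¹, B⁻¹, C⁻¹, σ⁻¹, fun t => β (σ⁻¹ t) * γ (σ⁻¹ t), fun t => α (σ⁻¹ t) * γ (σ⁻¹ t),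
    fun t => α (σ⁻¹ t) * β (σ⁻¹ t), fun t => ?_, fun t => ?_⟩
  · linear_combination (α (σ⁻¹ t) * β (σ⁻¹ t) * γ (σ⁻¹ t) + 1) * h1 (σ⁻¹ t)
  · have h3 := h1 (σ⁻¹ t)
    have h4 := h2 (σ⁻¹ t)
    rw [show σ (σ⁻¹ t) = t from σ.apply_symm_apply t] at h4
    exact ⟨gl_inv_smul (by linear_combination h3) h4.1,
      gl_inv_smul (by linear_combination h3) h4.2.1,
      gl_inv_smul (by linear_combination h3) h4.2.2⟩

lemma trans (h : Rel u v w u' v' w') (h' : Rel u' v' w' u'' v'' w'') :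
    Rel u v w u'' v'' w'' := by
  obtain ⟨A, B, C, σ, α, β, γ, h1, h2⟩ := h
  obtain ⟨A', B', C', σ', α', β', γ', h1', h2'⟩ := h'
  refine ⟨A' * A, B' * B, C' * C, σ' * σ, fun t => α' (σ t) * α t, fun t => β' (σ t) * β t,
    fun t => γ' (σ t) * γ t, fun t => ?_, fun t => ?_⟩
  · linear_combination (α' (σ t) * β' (σ t) * γ' (σ t)) * h1 t + h1' (σ t)
  · obtain ⟨ha, hb, hc⟩ := h2 t
    obtain ⟨ha', hb', hc'⟩ := h2' (σ t)
    rw [Equiv.Perm.mul_apply, ha', hb', hc', ha, hb, hc]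
    simp only [Matrix.mul_smul, Matrix.smul_mul, smul_smul, _root_.mul_inv_rev, Units.val_mul,
      Matrix.mul_assoc, and_self]

lemma rotate (h : Rel u v w u' v' w') : Rel v w u v' w' u' := by
  obtain ⟨A, B, C, σ, α, β, γ, h1, h2⟩ := h
  exact ⟨B, C, A, σ, β, γ, α, fun t => by linear_combination h1 t,
    fun t => ⟨(h2 t).2.1, (h2 t).2.2, (h2 t).1⟩⟩

lemma perm (σ : Equiv.Perm (Fin 7)) : Rel u v w (u ∘ σ) (v ∘ σ) (w ∘ σ) :=
  ⟨1, 1, 1, σ⁻¹, 1, 1, 1, by simp, by simp⟩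

lemma sandwich (A B C : GL (Fin 2) ℝ) : Rel u v w
    (fun t => (A : M2) * u t * (B⁻¹ : GL (Fin 2) ℝ))
    (fun t => (B : M2) * v t * (C⁻¹ : GL (Fin 2) ℝ))
    (fun t => (C : M2) * w t * (A⁻¹ : GL (Fin 2) ℝ)) :=
  ⟨A, B, C, 1, 1, 1, 1, by simp, by simp⟩

lemma scale {α β γ : Fin 7 → ℝ} (h : ∀ t, α t * β t * γ t = 1) :
    Rel u v w (fun t => α t • u t) (fun t => β t • v t) (fun t => γ t • w t) :=
  ⟨1, 1, 1, 1, α, β, γ, h, by simp⟩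

lemma isDec (h : Rel u v w u' v' w') (hd : IsDec u v w) : IsDec u' v' w' := by
  obtain ⟨A, B, C, σ, α, β, γ, h1, h2⟩ := h
  intro X Y Z
  have key := hd ((A : M2)ᵀ * X * ((B⁻¹ : GL (Fin 2) ℝ) : M2)ᵀ)
    ((B : M2)ᵀ * Y * ((C⁻¹ : GL (Fin 2) ℝ) : M2)ᵀ) ((C : M2)ᵀ * Z * ((A⁻¹ : GL (Fin 2) ℝ) : M2)ᵀ)
  have hB : ((B⁻¹ : GL (Fin 2) ℝ) : M2)ᵀ * (B : M2)ᵀ = 1 := by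
    rw [← transpose_mul, gl_mul_inv, transpose_one]
  have hC : ((C⁻¹ : GL (Fin 2) ℝ) : M2)ᵀ * (C : M2)ᵀ = 1 := by
    rw [← transpose_mul, gl_mul_inv, transpose_one]
  have hA : ((A⁻¹ : GL (Fin 2) ℝ) : M2)ᵀ * (A : M2)ᵀ = 1 := by
    rw [← transpose_mul, gl_mul_inv, transpose_one]
  have e : (A : M2)ᵀ * X * ((B⁻¹ : GL (Fin 2) ℝ) : M2)ᵀ *
      ((B : M2)ᵀ * Y * ((C⁻¹ : GL (Fin 2) ℝ) : M2)ᵀ) *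
      ((C : M2)ᵀ * Z * ((A⁻¹ : GL (Fin 2) ℝ) : M2)ᵀ) =
      (A : M2)ᵀ * X * (((B⁻¹ : GL (Fin 2) ℝ) : M2)ᵀ * (B : M2)ᵀ) * Y *
      (((C⁻¹ : GL (Fin 2) ℝ) : M2)ᵀ * (C : M2)ᵀ) * Z * ((A⁻¹ : GL (Fin 2) ℝ) : M2)ᵀ := by
    simp only [Matrix.mul_assoc]
  have htr : trace ((A : M2)ᵀ * X * Y * Z * ((A⁻¹ : GL (Fin 2) ℝ) : M2)ᵀ) = trace (X * Y * Z) := by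
    rw [Matrix.trace_mul_comm, ← Matrix.mul_assoc, ← Matrix.mul_assoc, ← Matrix.mul_assoc, hA,
      Matrix.one_mul]
  rw [e, hB, hC, Matrix.mul_one, Matrix.mul_one, htr] at key
  rw [← key, ← Equiv.sum_comp σ]
  refine Finset.sum_congr rfl fun t _ => ?_
  obtain ⟨ha, hb, hc⟩ := h2 t
  rw [ha, hb, hc, frob_comm, frob_smul, frob_comm X, frob_comm (β t • _), frob_smul, frob_comm Y,
    frob_comm (γ t • _), frob_smul, frob_comm Z, frob_mul_mul, frob_mul_mul, frob_mul_mul]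
  linear_combination (frob (u t) ((A : M2)ᵀ * X * ((B⁻¹ : GL (Fin 2) ℝ) : M2)ᵀ) *
    frob (v t) ((B : M2)ᵀ * Y * ((C⁻¹ : GL (Fin 2) ℝ) : M2)ᵀ) *
    frob (w t) ((C : M2)ᵀ * Z * ((A⁻¹ : GL (Fin 2) ℝ) : M2)ᵀ)) * h1 t

end Rel

/-- The matrices of `u` after splitting off a dependent triple and diagonalising. -/
def Split (u : Fin 7 → M2) : Prop :=
  (∀ t ∈ ({0, 1, 2, 5, 6} : Finset (Fin 7)), u t 0 0 = 0) ∧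
  (∀ t ∈ ({0, 1, 2, 3, 4} : Finset (Fin 7)), u t 1 1 = 0) ∧
  u 3 0 0 ≠ 0 ∧ u 4 0 0 ≠ 0 ∧ u 5 1 1 ≠ 0 ∧ u 6 1 1 ≠ 0

open Classical in
lemma IsDec.exists_split {u v w : Fin 7 → M2} (h : IsDec u v w) (hdep : Dep u) :
    ∃ u' v' w', Rel u v w u' v' w' ∧ Split u' := by
  obtain ⟨s, c, hs, ⟨t₀, ht₀, hct⟩, hsum⟩ := hdep
  obtain ⟨T, hsT, -, hT⟩ := Finset.exists_subsuperset_card_eq (Finset.subset_univ s)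
    (n := 3) hs (by simp)
  have hT2 : (T.erase t₀).card = 2 := by rw [Finset.card_erase_of_mem (hsT ht₀), hT]
  obtain ⟨p, q, hpq, hTe⟩ := Finset.card_eq_two.mp hT2
  have hkill : ∀ X, frob (u p) X = 0 → frob (u q) X = 0 → ∀ t ∈ T, frob (u t) X = 0 := by
    intro X hp hq
    have he : ∀ t ∈ T, t ≠ t₀ → frob (u t) X = 0 := by
      intro t ht htt
      have : t ∈ T.erase t₀ := Finset.mem_erase.mpr ⟨htt, ht⟩
      rw [hTe, Finset.mem_insert, Finset.mem_singleton] at this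
      rcases this with rfl | rfl <;> assumption
    intro t ht
    by_cases htt : t = t₀
    · subst htt
      have := congrArg (frob X) hsum
      rw [frob_zero, frob_sum, Finset.sum_eq_single_of_mem t ht₀] at this
      · rw [frob_smul, frob_comm] at this
        exact (mul_eq_zero.mp this).resolve_left hct
      · intro r hr hrt
        rw [frob_smul, frob_comm, he r (hsT hr) hrt, mul_zero]
    · exact he t ht htt
  obtain ⟨X₀, hX₀, h0p, h0q, -⟩ := exists_common_zero₃ (u p) (u q) 0
  obtain ⟨X₁, hX₁, h1p, h1q, hf⟩ := exists_common_zero₃ (u p) (u q) X₀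
  obtain ⟨P, hP, hPA⟩ := exists_det_ne_zero_of_pencil hX₀ hX₁ hf
    (by
      rintro ⟨x, hx, hA⟩
      have := h.card_le_two_of_vecMul hx (s := T) fun t ht =>
        hA _ (hkill _ h0p h0q t ht) (hkill _ h1p h1q t ht)
      omega)
    (by
      rintro ⟨a, ha, hA⟩
      have := h.rotate.card_le_two_of_mulVec ha (s := T) fun t ht =>
        hA _ (hkill _ h0p h0q t ht) (hkill _ h1p h1q t ht)
      omega)
  have hPT : ∀ t ∈ T, frob (u t) P = 0 := hkill P (hPA _ h0p h1p) (hPA _ h0q h1q)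
  obtain ⟨Q, hQ, hQp, hQq, hPQ⟩ := exists_common_zero₃ (u p) (u q) P
  have hQT := hkill Q hQp hQq
  obtain ⟨M, rfl⟩ : ∃ M, Q = P * M := by
    refine ⟨P⁻¹ * Q, ?_⟩
    rw [Matrix.mul_nonsing_inv_cancel_left _ _ (isUnit_iff_ne_zero.mpr hP)]
  have hcard : Tᶜ.card = 4 := by rw [Finset.card_compl, hT]; rfl
  have hPT' : ∀ t, t ∉ Tᶜ → frob (u t) P = 0 := fun t ht => hPT t (by simpa using ht)
  have hinj := h.injective_of_det hP hPT'
  have hfP : ∀ t ∈ Tᶜ, frob (u t) P ≠ 0 := fun t ht => h.frob_ne_zero_of_det hP hPT' hcard ht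
  set d : Fin 7 → ℝ := fun t => frob (u t) (P * M) / frob (u t) P with hd
  have hdP : ∀ t ∈ Tᶜ, frob (u t) (P * M) = d t * frob (u t) P := fun t ht => by
    rw [hd, div_mul_cancel₀ _ (hfP t ht)]
  have hratio : ∀ t ∈ Tᶜ, ∀ Y, frob (v t) (M * Y) = d t * frob (v t) Y := by
    intro t ht Y
    have := h.ratio_eq (M := M) (Y := Y) hP hPT' hcard
      (fun r hr => by rw [hQT r (by simpa using hr), zero_mul]) ht
    rw [hdP t ht] at this
    exact mul_left_cancel₀ (hfP t ht) (by linear_combination this)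
  have hroot : ∀ t ∈ Tᶜ, d t * d t = M.trace * d t - M.det := by
    intro t ht
    obtain ⟨Y, hY⟩ := exists_prescribed hcard hinj 1
    have h1 := hratio t ht Y
    have h2 := hratio t ht (M * Y)
    rw [← Matrix.mul_assoc, sq_eq, Matrix.sub_mul, frob_sub, Matrix.smul_mul, Matrix.smul_mul,
      frob_smul, frob_smul, Matrix.one_mul, h1, hY t ht] at h2
    simp only [Pi.one_apply] at h2
    linear_combination -h2
  obtain ⟨a, ha, b, hb, hab⟩ : ∃ a ∈ Tᶜ, ∃ b ∈ Tᶜ, d a ≠ d b := by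
    by_contra! hc
    obtain ⟨a, ha⟩ : Tᶜ.Nonempty := Finset.card_pos.mp (by omega)
    have hM : M = d a • (1 : M2) := by
      rw [← sub_eq_zero]
      refine hinj _ fun t ht => ?_
      have := hratio t ht 1
      rw [Matrix.mul_one] at this
      rw [frob_sub, frob_smul, this, hc t ht a ha, sub_self]
    rw [hM, Matrix.mul_smul, Matrix.mul_one, frob_smul] at hPQ
    have hda : d a ≠ 0 := by
      intro h0
      rw [hM, h0] at hQ
      simp at hQ
    have hP0 := frob_self_eq_zero ((mul_eq_zero.mp hPQ).resolve_left hda)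
    rw [hP0] at hP
    simp at hP
  have htr : M.trace = d a + d b := by
    refine mul_left_cancel₀ (sub_ne_zero.mpr hab) ?_
    linear_combination hroot b hb - hroot a ha
  have hdet : M.det = d a * d b := by
    have := hroot a ha
    rw [htr] at this
    clear_value d
    linear_combination this
  have htwo : ∀ t ∈ Tᶜ, d t = d a ∨ d t = d b := by
    intro t ht
    have := hroot t ht
    rw [htr, hdet] at this
    have h0 : (d t - d a) * (d t - d b) = 0 := by linear_combination this
    simpa [sub_eq_zero] using h0
  have hEd : ∀ t ∈ Tᶜ, (P * M - d t • P).det = 0 := by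
    intro t ht
    have e : (P * M - d t • P).det = P.det * (d t * d t - M.trace * d t + M.det) := by
      generalize d t = e
      simp only [det_fin_two, Matrix.sub_apply, Matrix.smul_apply, smul_eq_mul, Matrix.mul_apply,
        Fin.sum_univ_two, trace, diag_apply]
      ring
    rw [e, hroot t ht]; ring
  have hE0 : ∀ t, P * M - d t • P ≠ 0 := by
    intro t h0
    have h1 := congrArg (frob (P * M)) h0
    rw [frob_sub, frob_smul, frob_comm (P * M) P, hPQ, mul_zero, sub_zero, frob_zero] at h1
    exact hQ (frob_self_eq_zero h1)
  have hET : ∀ r, ∀ t ∈ T, frob (u t) (P * M - d r • P) = 0 := by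
    intro r t ht
    rw [frob_sub, frob_smul, hQT t ht, hPT t ht]; ring
  have hEf : ∀ r, ∀ t ∈ Tᶜ, frob (u t) (P * M - d r • P) = (d t - d r) * frob (u t) P := by
    intro r t ht
    rw [frob_sub, frob_smul, hdP t ht]; ring
  set SA : Finset (Fin 7) := {t ∈ Tᶜ | d t = d a} with hSA
  set SB : Finset (Fin 7) := {t ∈ Tᶜ | d t = d b} with hSB
  have hSA2 : 2 ≤ SA.card := h.two_le_card (hE0 b) fun t ht => by
    by_cases htT : t ∈ T
    · exact hET b t htT
    · have htc := Finset.mem_compl.mpr htT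
      have : d t = d b := (htwo t htc).resolve_left fun h1 => ht (by simp [hSA, htT, h1])
      rw [hEf b t htc, this]; ring
  have hSB2 : 2 ≤ SB.card := h.two_le_card (hE0 a) fun t ht => by
    by_cases htT : t ∈ T
    · exact hET a t htT
    · have htc := Finset.mem_compl.mpr htT
      have : d t = d a := (htwo t htc).resolve_right fun h1 => ht (by simp [hSB, htT, h1])
      rw [hEf a t htc, this]; ring
  have hsumc : SA.card + SB.card ≤ 4 := by
    rw [← hcard, ← Finset.card_union_of_disjoint]
    · exact Finset.card_le_card (Finset.union_subset (Finset.filter_subset _ _)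
        (Finset.filter_subset _ _))
    · rw [Finset.disjoint_left]
      intro t h1 h2
      exact hab ((Finset.mem_filter.mp h1).2.symm.trans (Finset.mem_filter.mp h2).2)
  obtain ⟨i₀, i₁, i₂, -, -, -, hTi⟩ := Finset.card_eq_three.mp hT
  obtain ⟨i₃, i₄, -, hAi⟩ := Finset.card_eq_two.mp (show SA.card = 2 by omega)
  obtain ⟨i₅, i₆, -, hBi⟩ := Finset.card_eq_two.mp (show SB.card = 2 by omega)
  have hsurj : Function.Surjective ![i₀, i₁, i₂, i₃, i₄, i₅, i₆] := by
    intro t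
    have : t ∈ T ∨ t ∈ SA ∨ t ∈ SB := by
      by_cases htT : t ∈ T
      · exact Or.inl htT
      · rcases htwo t (Finset.mem_compl.mpr htT) with h1 | h1
        · exact Or.inr (Or.inl (by simp [hSA, htT, h1]))
        · exact Or.inr (Or.inr (by simp [hSB, htT, h1]))
    rw [hTi, hAi, hBi] at this
    simp only [Finset.mem_insert, Finset.mem_singleton] at this
    rcases this with (rfl | rfl | rfl) | (rfl | rfl) | (rfl | rfl)
    exacts [⟨0, rfl⟩, ⟨1, rfl⟩, ⟨2, rfl⟩, ⟨3, rfl⟩, ⟨4, rfl⟩, ⟨5, rfl⟩, ⟨6, rfl⟩]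
  let σ : Equiv.Perm (Fin 7) := Equiv.ofBijective _ (Finite.surjective_iff_bijective.mp hsurj)
  obtain ⟨x, α, -, -, hE⟩ := exists_vecMulVec (hE0 b) (hEd b hb)
  obtain ⟨x', α', -, -, hE'⟩ := exists_vecMulVec (hE0 a) (hEd a ha)
  have hareas : area x x' * area α α' ≠ 0 := by
    have e : vecMulVec x (-α) + vecMulVec x' α' = (d b - d a) • P := by
      rw [vecMulVec_neg, ← hE, ← hE', sub_smul]; abel
    have := congrArg det e
    rw [det_vecMulVec_add, det_smul] at this
    have e2 : area (-α) α' = - area α α' := by simp only [area, Pi.neg_apply]; ring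
    rw [e2] at this
    intro h0
    have h1 : (d b - d a) ^ Fintype.card (Fin 2) * det P ≠ 0 :=
      mul_ne_zero (pow_ne_zero _ (sub_ne_zero.mpr hab.symm)) hP
    exact h1 (by linear_combination -this - h0)
  let A : GL (Fin 2) ℝ := GeneralLinearGroup.mkOfDetNeZero !![x 0, x 1; x' 0, x' 1] (by
    rw [det_fin_two_of]; exact (mul_ne_zero_iff.mp hareas).1)
  let B : GL (Fin 2) ℝ := (GeneralLinearGroup.mkOfDetNeZero !![α 0, α' 0; α 1, α' 1] (by
    rw [det_fin_two_of, mul_comm (α' 0)]; exact (mul_ne_zero_iff.mp hareas).2))⁻¹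
  refine ⟨_, _, _, (Rel.perm σ).trans (Rel.sandwich A B 1), ?_⟩
  have hA : (A : M2) = !![x 0, x 1; x' 0, x' 1] := rfl
  have hB : ((B⁻¹ : GL (Fin 2) ℝ) : M2) = !![α 0, α' 0; α 1, α' 1] := by rw [inv_inv]; rfl
  have e00 : ∀ t, ((A : M2) * u t * (B⁻¹ : GL (Fin 2) ℝ)) 0 0 = frob (u t) (P * M - d b • P) := by
    intro t
    rw [hE, frob_eq, hA, hB]
    simp [Matrix.mul_apply, Matrix.vecMul, dotProduct, Fin.sum_univ_two, vecMulVec_apply]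
    ring
  have e11 : ∀ t, ((A : M2) * u t * (B⁻¹ : GL (Fin 2) ℝ)) 1 1 = frob (u t) (P * M - d a • P) := by
    intro t
    rw [hE', frob_eq, hA, hB]
    simp [Matrix.mul_apply, Matrix.vecMul, dotProduct, Fin.sum_univ_two, vecMulVec_apply]
    ring
  have hmT : ∀ t ∈ ({i₀, i₁, i₂} : Finset (Fin 7)), t ∈ T := by rw [hTi]; exact fun _ h => h
  have hmA : ∀ t ∈ ({i₃, i₄} : Finset (Fin 7)), t ∈ Tᶜ ∧ d t = d a := by
    rw [← hAi]; exact fun t h => Finset.mem_filter.mp h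
  have hmB : ∀ t ∈ ({i₅, i₆} : Finset (Fin 7)), t ∈ Tᶜ ∧ d t = d b := by
    rw [← hBi]; exact fun t h => Finset.mem_filter.mp h
  have zT : ∀ t ∈ ({i₀, i₁, i₂} : Finset (Fin 7)), ∀ r, frob (u t) (P * M - d r • P) = 0 :=
    fun t ht r => hET r t (hmT t ht)
  have zA : ∀ t ∈ ({i₃, i₄} : Finset (Fin 7)), frob (u t) (P * M - d a • P) = 0 ∧
      frob (u t) (P * M - d b • P) ≠ 0 := fun t ht => by
    rw [hEf _ t (hmA t ht).1, hEf _ t (hmA t ht).1, (hmA t ht).2]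
    exact ⟨by ring, mul_ne_zero (sub_ne_zero.mpr hab) (hfP t (hmA t ht).1)⟩
  have zB : ∀ t ∈ ({i₅, i₆} : Finset (Fin 7)), frob (u t) (P * M - d b • P) = 0 ∧
      frob (u t) (P * M - d a • P) ≠ 0 := fun t ht => by
    rw [hEf _ t (hmB t ht).1, hEf _ t (hmB t ht).1, (hmB t ht).2]
    exact ⟨by ring, mul_ne_zero (sub_ne_zero.mpr hab.symm) (hfP t (hmB t ht).1)⟩
  refine ⟨?_, ?_, ?_, ?_, ?_, ?_⟩
  · intro t ht
    simp only [e00, Function.comp_apply]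
    simp only [Finset.mem_insert, Finset.mem_singleton] at ht
    rcases ht with rfl | rfl | rfl | rfl | rfl
    exacts [zT i₀ (by simp) b, zT i₁ (by simp) b, zT i₂ (by simp) b, (zB i₅ (by simp)).1,
      (zB i₆ (by simp)).1]
  · intro t ht
    simp only [e11, Function.comp_apply]
    simp only [Finset.mem_insert, Finset.mem_singleton] at ht
    rcases ht with rfl | rfl | rfl | rfl | rfl
    exacts [zT i₀ (by simp) a, zT i₁ (by simp) a, zT i₂ (by simp) a, (zA i₃ (by simp)).1,
      (zA i₄ (by simp)).1]
  · simp only [e00, Function.comp_apply]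
    exact (zA i₃ (by simp)).2
  · simp only [e00, Function.comp_apply]
    exact (zA i₄ (by simp)).2
  · simp only [e11, Function.comp_apply]
    exact (zB i₅ (by simp)).2
  · simp only [e11, Function.comp_apply]
    exact (zB i₆ (by simp)).2

end DeGroot

namespace DeGroot

variable {u v w : Fin 7 → M2}

section TwoTerm

variable {p q c d : Fin 2 → ℝ}

lemma dual_of_sum_eq_one (H : ∀ j j', p j * c j' + q j * d j' = (1 : M2) j j') :
    p ⬝ᵥ c = 1 ∧ q ⬝ᵥ d = 1 ∧ p ⬝ᵥ d = 0 ∧ q ⬝ᵥ c = 0 := by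
  have h1 : (!![p 0, q 0; p 1, q 1] : M2) * !![c 0, c 1; d 0, d 1] = 1 := by
    ext i j
    rw [← H i j]
    fin_cases i <;> fin_cases j <;> simp [Matrix.mul_apply, Fin.sum_univ_two]
  have h2 := mul_eq_one_comm.mp h1
  have e : ∀ i j, ((!![c 0, c 1; d 0, d 1] : M2) * !![p 0, q 0; p 1, q 1]) i j = (1 : M2) i j :=
    fun i j => by rw [h2]
  have e00 := e 0 0
  have e01 := e 0 1
  have e10 := e 1 0
  have e11 := e 1 1
  simp [Matrix.mul_apply, Fin.sum_univ_two] at e00 e01 e10 e11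
  simp only [dot_eq]
  refine ⟨?_, ?_, ?_, ?_⟩ <;> linarith

lemma area_mul_area_of_sum_eq_one (H : ∀ j j', p j * c j' + q j * d j' = (1 : M2) j j') :
    area p q * area c d = 1 := by
  have h00 := H 0 0
  have h01 := H 0 1
  have h10 := H 1 0
  have h11 := H 1 1
  simp at h00 h01 h10 h11
  simp only [area]
  linear_combination h00 * (p 1 * c 1 + q 1 * d 1) + h11 - (p 1 * c 0 + q 1 * d 0) * h01

/-- The coefficients in a vanishing combination of the right factors of a resolution of the
identity vanish. -/
lemma eq_zero_of_sum_eq_one (H : ∀ j j', p j * c j' + q j * d j' = (1 : M2) j j') {r s : ℝ}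
    (h : ∀ j', r * c j' + s * d j' = 0) : r = 0 ∧ s = 0 := by
  obtain ⟨h1, h2, h3, h4⟩ := dual_of_sum_eq_one H
  rw [dot_eq] at h1 h2 h3 h4
  constructor
  · linear_combination p 0 * h 0 + p 1 * h 1 - r * h1 - s * h3
  · linear_combination q 0 * h 0 + q 1 * h 1 - r * h4 - s * h2

lemma sum_eq_one_symm (H : ∀ j j', p j * c j' + q j * d j' = (1 : M2) j j') :
    ∀ j j', c j * p j' + d j * q j' = (1 : M2) j j' := by
  intro j j'
  rw [← Matrix.transpose_one, Matrix.transpose_apply, ← H j' j]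
  ring

end TwoTerm

lemma IsDec.brent (h : IsDec u v w) (i k k' j j' i' : Fin 2) :
    ∑ t, u t i k * v t k' j * w t j' i' =
      if k = k' ∧ i = i' then (1 : M2) j j' else 0 := by
  have := h (single i k 1) (single k' j 1) (single j' i' 1)
  have e : ∀ (M : M2) a b, frob M (single a b 1) = M a b := by
    intro M a b
    simp only [frob_eq, single_apply]
    fin_cases a <;> fin_cases b <;> simp
  simp only [e] at this
  rw [this]
  fin_cases i <;> fin_cases k <;> fin_cases k' <;> fin_cases j <;> fin_cases j' <;>
    fin_cases i' <;> simp [trace]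

/-- Consequences of a splitting for the supports of the other factors. -/
structure Frame (u v w : Fin 7 → M2) : Prop where
  split : Split u
  v3 : ∀ j, v 3 1 j = 0
  v4 : ∀ j, v 4 1 j = 0
  v5 : ∀ j, v 5 0 j = 0
  v6 : ∀ j, v 6 0 j = 0
  w3 : ∀ j, w 3 j 1 = 0
  w4 : ∀ j, w 4 j 1 = 0
  w5 : ∀ j, w 5 j 0 = 0
  w6 : ∀ j, w 6 j 0 = 0
  one00 : ∀ j j', (u 3 0 0 * v 3 0 j) * w 3 j' 0 + (u 4 0 0 * v 4 0 j) * w 4 j' 0 = (1 : M2) j j'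
  one11 : ∀ j j', (u 5 1 1 * v 5 1 j) * w 5 j' 1 + (u 6 1 1 * v 6 1 j) * w 6 j' 1 = (1 : M2) j j'
  a00 : ∀ j j', u 0 0 1 * v 0 0 j * w 0 j' 0 + u 1 0 1 * v 1 0 j * w 1 j' 0 +
    u 2 0 1 * v 2 0 j * w 2 j' 0 + u 3 0 1 * v 3 0 j * w 3 j' 0 + u 4 0 1 * v 4 0 j * w 4 j' 0 = 0
  a10 : ∀ j j', u 0 0 1 * v 0 1 j * w 0 j' 0 + u 1 0 1 * v 1 1 j * w 1 j' 0 +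
    u 2 0 1 * v 2 1 j * w 2 j' 0 = (1 : M2) j j'
  a01 : ∀ j j', u 0 0 1 * v 0 0 j * w 0 j' 1 + u 1 0 1 * v 1 0 j * w 1 j' 1 +
    u 2 0 1 * v 2 0 j * w 2 j' 1 = 0
  a11 : ∀ j j', u 0 0 1 * v 0 1 j * w 0 j' 1 + u 1 0 1 * v 1 1 j * w 1 j' 1 +
    u 2 0 1 * v 2 1 j * w 2 j' 1 + u 5 0 1 * v 5 1 j * w 5 j' 1 + u 6 0 1 * v 6 1 j * w 6 j' 1 = 0
  b00 : ∀ j j', u 0 1 0 * v 0 0 j * w 0 j' 0 + u 1 1 0 * v 1 0 j * w 1 j' 0 +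
    u 2 1 0 * v 2 0 j * w 2 j' 0 + u 3 1 0 * v 3 0 j * w 3 j' 0 + u 4 1 0 * v 4 0 j * w 4 j' 0 = 0
  b10 : ∀ j j', u 0 1 0 * v 0 1 j * w 0 j' 0 + u 1 1 0 * v 1 1 j * w 1 j' 0 +
    u 2 1 0 * v 2 1 j * w 2 j' 0 = 0
  b01 : ∀ j j', u 0 1 0 * v 0 0 j * w 0 j' 1 + u 1 1 0 * v 1 0 j * w 1 j' 1 +
    u 2 1 0 * v 2 0 j * w 2 j' 1 = (1 : M2) j j'
  b11 : ∀ j j', u 0 1 0 * v 0 1 j * w 0 j' 1 + u 1 1 0 * v 1 1 j * w 1 j' 1 +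
    u 2 1 0 * v 2 1 j * w 2 j' 1 + u 5 1 0 * v 5 1 j * w 5 j' 1 + u 6 1 0 * v 6 1 j * w 6 j' 1 = 0

lemma Split.frame (hs : Split u) (h : IsDec u v w) : Frame u v w := by
  obtain ⟨hz0, hz1, h3, h4, h5, h6⟩ := id hs
  have z0 := hz0 0 (by simp)
  have z1 := hz0 1 (by simp)
  have z2 := hz0 2 (by simp)
  have z5 := hz0 5 (by simp)
  have z6 := hz0 6 (by simp)
  have y0 := hz1 0 (by simp)
  have y1 := hz1 1 (by simp)
  have y2 := hz1 2 (by simp)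
  have y3 := hz1 3 (by simp)
  have y4 := hz1 4 (by simp)
  have B00 := fun k' j j' i' => h.brent 0 0 k' j j' i'
  have B11 := fun k' j j' i' => h.brent 1 1 k' j j' i'
  simp only [Fin.sum_univ_seven, z0, z1, z2, z5, z6, y0, y1, y2, y3, y4, zero_mul, zero_add,
    add_zero] at B00 B11
  have one00 := fun j j' => B00 0 j j' 0
  have one11 := fun j j' => B11 1 j j' 1
  simp only [and_self, if_true] at one00 one11
  have v34 : ∀ j, u 3 0 0 * v 3 1 j = 0 ∧ u 4 0 0 * v 4 1 j = 0 := fun j =>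
    eq_zero_of_sum_eq_one one00 (c := fun j' => w 3 j' 0) (d := fun j' => w 4 j' 0)
      fun j' => by simpa using B00 1 j j' 0
  have w34 : ∀ j, w 3 j 1 = 0 ∧ w 4 j 1 = 0 := fun j =>
    eq_zero_of_sum_eq_one (p := fun j' => w 3 j' 0) (q := fun j' => w 4 j' 0)
      (c := fun j => u 3 0 0 * v 3 0 j) (d := fun j => u 4 0 0 * v 4 0 j)
      (fun i i' => by rw [← sum_eq_one_symm one00 i i'])
      fun j' => by have := B00 0 j' j 1; simp at this; linear_combination this
  have v56 : ∀ j, u 5 1 1 * v 5 0 j = 0 ∧ u 6 1 1 * v 6 0 j = 0 := fun j =>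
    eq_zero_of_sum_eq_one one11 (c := fun j' => w 5 j' 1) (d := fun j' => w 6 j' 1)
      fun j' => by simpa using B11 0 j j' 1
  have w56 : ∀ j, w 5 j 0 = 0 ∧ w 6 j 0 = 0 := fun j =>
    eq_zero_of_sum_eq_one (p := fun j' => w 5 j' 1) (q := fun j' => w 6 j' 1)
      (c := fun j => u 5 1 1 * v 5 1 j) (d := fun j => u 6 1 1 * v 6 1 j)
      (fun i i' => by rw [← sum_eq_one_symm one11 i i'])
      fun j' => by have := B11 1 j' j 0; simp at this; linear_combination this
  have v3 := fun j => (mul_eq_zero.mp (v34 j).1).resolve_left h3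
  have v4 := fun j => (mul_eq_zero.mp (v34 j).2).resolve_left h4
  have v5 := fun j => (mul_eq_zero.mp (v56 j).1).resolve_left h5
  have v6 := fun j => (mul_eq_zero.mp (v56 j).2).resolve_left h6
  have w3 := fun j => (w34 j).1
  have w4 := fun j => (w34 j).2
  have w5 := fun j => (w56 j).1
  have w6 := fun j => (w56 j).2
  have B01 := fun k' j j' i' => h.brent 0 1 k' j j' i'
  have B10 := fun k' j j' i' => h.brent 1 0 k' j j' i'
  simp only [Fin.sum_univ_seven] at B01 B10
  exact ⟨hs, v3, v4, v5, v6, w3, w4, w5, w6, one00, one11,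
    fun j j' => by simpa [v3, v4, v5, v6, w3, w4, w5, w6] using B01 0 j j' 0,
    fun j j' => by simpa [v3, v4, v5, v6, w3, w4, w5, w6] using B01 1 j j' 0,
    fun j j' => by simpa [v3, v4, v5, v6, w3, w4, w5, w6] using B01 0 j j' 1,
    fun j j' => by simpa [v3, v4, v5, v6, w3, w4, w5, w6] using B01 1 j j' 1,
    fun j j' => by simpa [v3, v4, v5, v6, w3, w4, w5, w6] using B10 0 j j' 0,
    fun j j' => by simpa [v3, v4, v5, v6, w3, w4, w5, w6] using B10 1 j j' 0,
    fun j j' => by simpa [v3, v4, v5, v6, w3, w4, w5, w6] using B10 0 j j' 1,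
    fun j j' => by simpa [v3, v4, v5, v6, w3, w4, w5, w6] using B10 1 j j' 1⟩

/-- Cauchy–Binet for three terms, with the vanishing of a second weighted sum. -/
lemma exists_pair_of_three {a b : Fin 3 → ℝ} {h n : Fin 3 → Fin 2 → ℝ}
    (H1 : ∀ j j', b 0 * h 0 j * n 0 j' + b 1 * h 1 j * n 1 j' + b 2 * h 2 j * n 2 j' =
      (1 : M2) j j')
    (H0 : ∀ j j', a 0 * h 0 j * n 0 j' + a 1 * h 1 j * n 1 j' + a 2 * h 2 j * n 2 j' = 0) :
    (b 0 * b 1 ≠ 0 ∧ a 0 * a 1 = 0) ∨ (b 0 * b 2 ≠ 0 ∧ a 0 * a 2 = 0) ∨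
      (b 1 * b 2 ≠ 0 ∧ a 1 * a 2 = 0) := by
  have h00 := H1 0 0
  have h01 := H1 0 1
  have h10 := H1 1 0
  have h11 := H1 1 1
  simp at h00 h01 h10 h11
  have g00 := H0 0 0
  have g01 := H0 0 1
  have g10 := H0 1 0
  have g11 := H0 1 1
  have key : b 0 * b 1 * (area (h 0) (h 1) * area (n 0) (n 1)) +
      b 0 * b 2 * (area (h 0) (h 2) * area (n 0) (n 2)) +
      b 1 * b 2 * (area (h 1) (h 2) * area (n 1) (n 2)) = 1 := by
    simp only [area]
    linear_combination h00 * (b 0 * h 0 1 * n 0 1 + b 1 * h 1 1 * n 1 1 + b 2 * h 2 1 * n 2 1) +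
      h11 - (b 0 * h 0 1 * n 0 0 + b 1 * h 1 1 * n 1 0 + b 2 * h 2 1 * n 2 0) * h01
  have k01 : a 0 * a 1 * (area (h 0) (h 1) * area (n 0) (n 1)) = 0 := by
    simp only [area]
    linear_combination g00 * (a 0 * h 0 1 * n 0 1 + a 1 * h 1 1 * n 1 1)
      - (a 0 * h 0 1 * n 0 0 + a 1 * h 1 1 * n 1 0) * g01
      - a 2 * h 2 0 * n 2 0 * g11 + a 2 * h 2 0 * n 2 1 * g10
  have k02 : a 0 * a 2 * (area (h 0) (h 2) * area (n 0) (n 2)) = 0 := by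
    simp only [area]
    linear_combination g00 * (a 0 * h 0 1 * n 0 1 + a 2 * h 2 1 * n 2 1)
      - (a 0 * h 0 1 * n 0 0 + a 2 * h 2 1 * n 2 0) * g01
      - a 1 * h 1 0 * n 1 0 * g11 + a 1 * h 1 0 * n 1 1 * g10
  have k12 : a 1 * a 2 * (area (h 1) (h 2) * area (n 1) (n 2)) = 0 := by
    simp only [area]
    linear_combination g00 * (a 1 * h 1 1 * n 1 1 + a 2 * h 2 1 * n 2 1)
      - (a 1 * h 1 1 * n 1 0 + a 2 * h 2 1 * n 2 0) * g01
      - a 0 * h 0 0 * n 0 0 * g11 + a 0 * h 0 0 * n 0 1 * g10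
  by_contra! hc
  obtain ⟨c1, c2, c3⟩ := hc
  have e1 : b 0 * b 1 * (area (h 0) (h 1) * area (n 0) (n 1)) = 0 := by
    by_cases hb : b 0 * b 1 = 0
    · rw [hb, zero_mul]
    · rw [(mul_eq_zero.mp k01).resolve_left (c1 hb), mul_zero]
  have e2 : b 0 * b 2 * (area (h 0) (h 2) * area (n 0) (n 2)) = 0 := by
    by_cases hb : b 0 * b 2 = 0
    · rw [hb, zero_mul]
    · rw [(mul_eq_zero.mp k02).resolve_left (c2 hb), mul_zero]
  have e3 : b 1 * b 2 * (area (h 1) (h 2) * area (n 1) (n 2)) = 0 := by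
    by_cases hb : b 1 * b 2 = 0
    · rw [hb, zero_mul]
    · rw [(mul_eq_zero.mp k12).resolve_left (c3 hb), mul_zero]
  rw [e1, e2, e3] at key
  norm_num at key

end DeGroot

namespace DeGroot

variable {u v w : Fin 7 → M2}

lemma Split.comp (hs : Split u) (σ : Equiv.Perm (Fin 7))
    (hσ : (∀ t ∈ ({0, 1, 2, 5, 6} : Finset (Fin 7)), σ t ∈ ({0, 1, 2, 5, 6} : Finset (Fin 7))) ∧
      (∀ t ∈ ({0, 1, 2, 3, 4} : Finset (Fin 7)), σ t ∈ ({0, 1, 2, 3, 4} : Finset (Fin 7))) ∧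
      (∀ t ∈ ({3, 4} : Finset (Fin 7)), σ t ∈ ({3, 4} : Finset (Fin 7))) ∧
      (∀ t ∈ ({5, 6} : Finset (Fin 7)), σ t ∈ ({5, 6} : Finset (Fin 7)))) :
    Split (u ∘ σ) := by
  obtain ⟨hz0, hz1, h3, h4, h5, h6⟩ := hs
  obtain ⟨s0, s1, s34, s56⟩ := hσ
  have m0 : ∀ t ∈ ({3, 4} : Finset (Fin 7)), u t 0 0 ≠ 0 := by simp [h3, h4]
  have m1 : ∀ t ∈ ({5, 6} : Finset (Fin 7)), u t 1 1 ≠ 0 := by simp [h5, h6]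
  exact ⟨fun t ht => hz0 _ (s0 t ht), fun t ht => hz1 _ (s1 t ht), m0 _ (s34 3 (by simp)),
    m0 _ (s34 4 (by simp)), m1 _ (s56 5 (by simp)), m1 _ (s56 6 (by simp))⟩

/-- The off-diagonal zero pattern of the dependent triple of a split family. -/
structure Cyc (u : Fin 7 → M2) : Prop where
  a0 : u 0 0 1 ≠ 0
  a1 : u 1 0 1 = 0
  a2 : u 2 0 1 ≠ 0
  b0 : u 0 1 0 = 0
  b1 : u 1 1 0 ≠ 0
  b2 : u 2 1 0 ≠ 0

lemma Frame.exists_cyc (fr : Frame u v w) :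
    ∃ σ : Equiv.Perm (Fin 7), Split (u ∘ σ) ∧ Cyc (u ∘ σ) := by
  have hA := exists_pair_of_three (b := ![u 0 0 1, u 1 0 1, u 2 0 1])
    (a := ![u 0 1 0, u 1 1 0, u 2 1 0]) (h := ![v 0 1, v 1 1, v 2 1])
    (n := ![fun j => w 0 j 0, fun j => w 1 j 0, fun j => w 2 j 0])
    (by simpa using fr.a10) (by simpa using fr.b10)
  have hB := exists_pair_of_three (a := ![u 0 0 1, u 1 0 1, u 2 0 1])
    (b := ![u 0 1 0, u 1 1 0, u 2 1 0]) (h := ![v 0 0, v 1 0, v 2 0])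
    (n := ![fun j => w 0 j 1, fun j => w 1 j 1, fun j => w 2 j 1])
    (by simpa using fr.b01) (by simpa using fr.a01)
  have key : ∀ (σ : Equiv.Perm (Fin 7)) (i j k : Fin 7), σ 0 = i → σ 1 = j → σ 2 = k →
      Split (u ∘ σ) → (u i 0 1 ≠ 0 ∧ u j 0 1 = 0 ∧ u k 0 1 ≠ 0 ∧
        u i 1 0 = 0 ∧ u j 1 0 ≠ 0 ∧ u k 1 0 ≠ 0) →
      ∃ σ : Equiv.Perm (Fin 7), Split (u ∘ σ) ∧ Cyc (u ∘ σ) := by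
    rintro σ _ _ _ rfl rfl rfl hs ⟨h1, h2, h3, h4, h5, h6⟩
    exact ⟨σ, hs, h1, h2, h3, h4, h5, h6⟩
  simp only [Matrix.cons_val_zero, Matrix.cons_val_one, Matrix.cons_val, ne_eq, mul_eq_zero,
    not_or] at hA hB
  have c012 := key 1 0 1 2 (by decide) (by decide) (by decide) (fr.split.comp _ (by decide))
  have c102 := key (.swap 0 1) 1 0 2 (by decide) (by decide) (by decide)
    (fr.split.comp _ (by decide))
  have c021 := key (.swap 1 2) 0 2 1 (by decide) (by decide) (by decide)
    (fr.split.comp _ (by decide))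
  have c210 := key (.swap 0 2) 2 1 0 (by decide) (by decide) (by decide)
    (fr.split.comp _ (by decide))
  have c120 := key (.swap 0 1 * .swap 1 2) 1 2 0 (by decide) (by decide) (by decide)
    (fr.split.comp _ (by decide))
  have c201 := key (.swap 0 2 * .swap 1 2) 2 0 1 (by decide) (by decide) (by decide)
    (fr.split.comp _ (by decide))
  clear key
  rcases hA with ⟨⟨_, _⟩, _ | _⟩ | ⟨⟨_, _⟩, _ | _⟩ | ⟨⟨_, _⟩, _ | _⟩ <;>
  rcases hB with ⟨⟨_, _⟩, _ | _⟩ | ⟨⟨_, _⟩, _ | _⟩ | ⟨⟨_, _⟩, _ | _⟩ <;>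
  first
  | contradiction
  | (refine c012 ⟨?_, ?_, ?_, ?_, ?_, ?_⟩ <;> assumption)
  | (refine c102 ⟨?_, ?_, ?_, ?_, ?_, ?_⟩ <;> assumption)
  | (refine c021 ⟨?_, ?_, ?_, ?_, ?_, ?_⟩ <;> assumption)
  | (refine c210 ⟨?_, ?_, ?_, ?_, ?_, ?_⟩ <;> assumption)
  | (refine c120 ⟨?_, ?_, ?_, ?_, ?_, ?_⟩ <;> assumption)
  | (refine c201 ⟨?_, ?_, ?_, ?_, ?_, ?_⟩ <;> assumption)

lemma exists_ne_zero_of_area {x y : Fin 2 → ℝ} (h : area x y ≠ 0) : x ≠ 0 ∧ y ≠ 0 := by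
  constructor <;> rintro rfl <;> simp [area] at h

lemma parallel_of_sum_eq_zero {a a' : ℝ} {h n h' n' : Fin 2 → ℝ} (ha : a ≠ 0) (ha' : a' ≠ 0)
    (hh : h' ≠ 0) (hn : n' ≠ 0) (H : ∀ j j', a * h j * n j' + a' * h' j * n' j' = 0) :
    ∃ l l' : ℝ, h = l • h' ∧ n = l' • n' ∧ a * l * l' + a' = 0 := by
  obtain ⟨i, hi⟩ := Function.ne_iff.mp hh
  obtain ⟨i', hi'⟩ := Function.ne_iff.mp hn
  simp only [Pi.zero_apply] at hi hi'
  have h0 : a * h i * n i' ≠ 0 := by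
    rw [eq_neg_of_add_eq_zero_left (H i i')]
    exact neg_ne_zero.mpr (mul_ne_zero (mul_ne_zero ha' hi) hi')
  have hni : n i' ≠ 0 := right_ne_zero_of_mul h0
  have hhi : h i ≠ 0 := right_ne_zero_of_mul (left_ne_zero_of_mul h0)
  refine ⟨-(a' * n' i') / (a * n i'), -(a' * h' i) / (a * h i), ?_, ?_, ?_⟩
  · ext j
    simp only [Pi.smul_apply, smul_eq_mul]
    field_simp
    linear_combination H j i'
  · ext j
    simp only [Pi.smul_apply, smul_eq_mul]
    field_simp
    linear_combination H i j
  · field_simp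
    linear_combination a' * H i i'

section Half

variable {p q m h r₃ c₃ r₄ c₄ : Fin 2 → ℝ} {α β γ δ A₃ A₄ B₃ B₄ x₃ x₄ : ℝ}

lemma half_pattern (hα : α ≠ 0) (hγ : γ ≠ 0) (hmq : area m q ≠ 0) (hhp : area h p ≠ 0)
    (G1 : ∀ j j', p j * (α * m j' + β * q j') + A₃ * r₃ j * c₃ j' + A₄ * r₄ j * c₄ j' = 0)
    (G2 : ∀ j j', (γ * h j + δ * p j) * q j' + B₃ * r₃ j * c₃ j' + B₄ * r₄ j * c₄ j' = 0)
    (F : ∀ j j', x₃ * r₃ j * c₃ j' + x₄ * r₄ j * c₄ j' = (1 : M2) j j') :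
    (A₃ = 0 ∧ A₄ ≠ 0 ∧ B₃ ≠ 0 ∧ B₄ = 0) ∨ (A₃ ≠ 0 ∧ A₄ = 0 ∧ B₃ = 0 ∧ B₄ ≠ 0) := by
  have hF := area_mul_area_of_sum_eq_one (p := fun j => x₃ * r₃ j) (q := fun j => x₄ * r₄ j) F
  obtain ⟨d1, d2, d3, d4⟩ := dual_of_sum_eq_one (p := fun j => x₃ * r₃ j)
    (q := fun j => x₄ * r₄ j) F
  rw [dot_eq] at d1 d2 d3 d4
  have hr : area r₃ r₄ * area c₃ c₄ ≠ 0 := by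
    intro h0
    have : x₃ * x₄ * (area r₃ r₄ * area c₃ c₄) = 1 := by
      simp only [area] at hF ⊢; linear_combination hF
    rw [h0] at this
    norm_num at this
  have hx : x₃ ≠ 0 ∧ x₄ ≠ 0 := by
    constructor <;> rintro rfl <;> simp [area] at hF
  obtain ⟨hr3, hr4⟩ := exists_ne_zero_of_area (left_ne_zero_of_mul hr)
  obtain ⟨hh, hp⟩ := exists_ne_zero_of_area hhp
  obtain ⟨hm, hq⟩ := exists_ne_zero_of_area hmq
  have hyq : area (fun j => α * m j + β * q j) q ≠ 0 := by
    have : area (fun j => α * m j + β * q j) q = α * area m q := by simp only [area]; ring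
    rw [this]
    exact mul_ne_zero hα hmq
  have hzp : area (fun j => γ * h j + δ * p j) p ≠ 0 := by
    have : area (fun j => γ * h j + δ * p j) p = γ * area h p := by simp only [area]; ring
    rw [this]
    exact mul_ne_zero hγ hhp
  have hys : ∀ s, s ≠ 0 →
      ¬ ((fun j => α * m j + β * q j) ⬝ᵥ s = 0 ∧ q ⬝ᵥ s = 0) :=
    fun s hs hc => hs (eq_zero_of_area_ne_zero hyq hc.1 hc.2)
  obtain ⟨iz, hiz⟩ := Function.ne_iff.mp (exists_ne_zero_of_area hzp).1
  obtain ⟨ip, hip⟩ := Function.ne_iff.mp hp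
  simp only [Pi.zero_apply] at hiz hip
  have hA : A₃ * A₄ = 0 := by
    refine (mul_eq_zero.mp (?_ : A₃ * A₄ * (area r₃ r₄ * area c₃ c₄) = 0)).resolve_right hr
    simp only [area]
    linear_combination G1 0 0 * (A₃ * r₃ 1 * c₃ 1 + A₄ * r₄ 1 * c₄ 1) -
      G1 0 1 * (A₃ * r₃ 1 * c₃ 0 + A₄ * r₄ 1 * c₄ 0) -
      p 0 * (α * m 0 + β * q 0) * G1 1 1 + p 0 * (α * m 1 + β * q 1) * G1 1 0
  have hB : B₃ * B₄ = 0 := by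
    refine (mul_eq_zero.mp (?_ : B₃ * B₄ * (area r₃ r₄ * area c₃ c₄) = 0)).resolve_right hr
    simp only [area]
    linear_combination G2 0 0 * (B₃ * r₃ 1 * c₃ 1 + B₄ * r₄ 1 * c₄ 1) -
      G2 0 1 * (B₃ * r₃ 1 * c₃ 0 + B₄ * r₄ 1 * c₄ 0) -
      (γ * h 0 + δ * p 0) * q 0 * G2 1 1 + (γ * h 0 + δ * p 0) * q 1 * G2 1 0
  have hA' : ¬ (A₃ = 0 ∧ A₄ = 0) := by
    rintro ⟨rfl, rfl⟩
    refine (exists_ne_zero_of_area hyq).1 (funext fun j => ?_)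
    refine (mul_eq_zero.mp (?_ : p ip * (α * m j + β * q j) = 0)).resolve_left hip
    linear_combination G1 ip j
  have hB' : ¬ (B₃ = 0 ∧ B₄ = 0) := by
    rintro ⟨rfl, rfl⟩
    refine hq (funext fun j => ?_)
    refine (mul_eq_zero.mp (?_ : (γ * h iz + δ * p iz) * q j = 0)).resolve_left hiz
    linear_combination G2 iz j
  have h3 : ¬ (A₃ = 0 ∧ B₃ = 0) := by
    rintro ⟨rfl, rfl⟩
    refine hys r₃ hr3 ⟨?_, ?_⟩
    · refine (mul_eq_zero.mp (?_ : p ip * _ = 0)).resolve_left hip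
      refine (mul_eq_zero.mp (?_ : x₃ * _ = 0)).resolve_left hx.1
      rw [dot_eq]
      linear_combination x₃ * r₃ 0 * G1 ip 0 + x₃ * r₃ 1 * G1 ip 1 - A₄ * r₄ ip * d3
    · refine (mul_eq_zero.mp (?_ : (γ * h iz + δ * p iz) * _ = 0)).resolve_left hiz
      refine (mul_eq_zero.mp (?_ : x₃ * _ = 0)).resolve_left hx.1
      rw [dot_eq]
      linear_combination x₃ * r₃ 0 * G2 iz 0 + x₃ * r₃ 1 * G2 iz 1 - B₄ * r₄ iz * d3
  have h4 : ¬ (A₄ = 0 ∧ B₄ = 0) := by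
    rintro ⟨rfl, rfl⟩
    refine hys r₄ hr4 ⟨?_, ?_⟩
    · refine (mul_eq_zero.mp (?_ : p ip * _ = 0)).resolve_left hip
      refine (mul_eq_zero.mp (?_ : x₄ * _ = 0)).resolve_left hx.2
      rw [dot_eq]
      linear_combination x₄ * r₄ 0 * G1 ip 0 + x₄ * r₄ 1 * G1 ip 1 - A₃ * r₃ ip * d4
    · refine (mul_eq_zero.mp (?_ : (γ * h iz + δ * p iz) * _ = 0)).resolve_left hiz
      refine (mul_eq_zero.mp (?_ : x₄ * _ = 0)).resolve_left hx.2
      rw [dot_eq]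
      linear_combination x₄ * r₄ 0 * G2 iz 0 + x₄ * r₄ 1 * G2 iz 1 - B₃ * r₃ iz * d4
  rw [mul_eq_zero] at hA hB
  tauto

lemma half_dual (hα : α ≠ 0) (hγ : γ ≠ 0) (hmq : area m q ≠ 0) (hhp : area h p ≠ 0)
    (G1 : ∀ j j', p j * (α * m j' + β * q j') + A₄ * r₄ j * c₄ j' = 0)
    (G2 : ∀ j j', (γ * h j + δ * p j) * q j' + B₃ * r₃ j * c₃ j' = 0)
    (F : ∀ j j', x₃ * r₃ j * c₃ j' + x₄ * r₄ j * c₄ j' = (1 : M2) j j') :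
    p ⬝ᵥ c₃ = 0 ∧ q ⬝ᵥ r₄ = 0 ∧ (fun j => α * m j + β * q j) ⬝ᵥ r₃ = 0 ∧
      (fun j => γ * h j + δ * p j) ⬝ᵥ c₄ = 0 := by
  obtain ⟨-, -, d3, d4⟩ := dual_of_sum_eq_one (p := fun j => x₃ * r₃ j)
    (q := fun j => x₄ * r₄ j) F
  have hF := area_mul_area_of_sum_eq_one (p := fun j => x₃ * r₃ j) (q := fun j => x₄ * r₄ j) F
  have hx : x₃ ≠ 0 ∧ x₄ ≠ 0 := by
    constructor <;> rintro rfl <;> simp [area] at hF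
  rw [dot_eq] at d3 d4
  have hyq : area (fun j => α * m j + β * q j) q ≠ 0 := by
    have : area (fun j => α * m j + β * q j) q = α * area m q := by simp only [area]; ring
    rw [this]
    exact mul_ne_zero hα hmq
  have hzp : area (fun j => γ * h j + δ * p j) p ≠ 0 := by
    have : area (fun j => γ * h j + δ * p j) p = γ * area h p := by simp only [area]; ring
    rw [this]
    exact mul_ne_zero hγ hhp
  obtain ⟨iz, hiz⟩ := Function.ne_iff.mp (exists_ne_zero_of_area hzp).1
  obtain ⟨ip, hip⟩ := Function.ne_iff.mp (exists_ne_zero_of_area hhp).2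
  obtain ⟨iq, hiq⟩ := Function.ne_iff.mp (exists_ne_zero_of_area hmq).2
  obtain ⟨iy, hiy⟩ := Function.ne_iff.mp (exists_ne_zero_of_area hyq).1
  simp only [Pi.zero_apply] at hiz hip hiq hiy
  simp only [dot_eq]
  refine ⟨?_, ?_, ?_, ?_⟩
  · refine (mul_eq_zero.mp (?_ : (α * m iy + β * q iy) * _ = 0)).resolve_left hiy
    refine (mul_eq_zero.mp (?_ : x₄ * _ = 0)).resolve_left hx.2
    linear_combination x₄ * c₃ 0 * G1 0 iy + x₄ * c₃ 1 * G1 1 iy - A₄ * c₄ iy * d4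
  · refine (mul_eq_zero.mp (?_ : (γ * h iz + δ * p iz) * _ = 0)).resolve_left hiz
    refine (mul_eq_zero.mp (?_ : x₄ * _ = 0)).resolve_left hx.2
    linear_combination x₄ * r₄ 0 * G2 iz 0 + x₄ * r₄ 1 * G2 iz 1 - B₃ * r₃ iz * d4
  · refine (mul_eq_zero.mp (?_ : p ip * _ = 0)).resolve_left hip
    refine (mul_eq_zero.mp (?_ : x₃ * _ = 0)).resolve_left hx.1
    linear_combination x₃ * r₃ 0 * G1 ip 0 + x₃ * r₃ 1 * G1 ip 1 - A₄ * r₄ ip * d3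
  · refine (mul_eq_zero.mp (?_ : q iq * _ = 0)).resolve_left hiq
    refine (mul_eq_zero.mp (?_ : x₃ * _ = 0)).resolve_left hx.1
    linear_combination x₃ * c₄ 0 * G2 0 iq + x₃ * c₄ 1 * G2 1 iq - B₃ * c₃ iq * d3

end Half

end DeGroot

namespace DeGroot

variable {u v w : Fin 7 → M2} {l l' κ κ' : ℝ}

/-- The relations among the dependent triple expressed through two pairs of ratios. -/
structure Params (u v w : Fin 7 → M2) (l l' κ κ' : ℝ) : Prop where
  h0 : v 0 0 = l • v 2 0
  n0 : (fun j => w 0 j 1) = l' • fun j => w 2 j 1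
  k1 : v 1 1 = κ • v 2 1
  m1 : (fun j => w 1 j 0) = κ' • fun j => w 2 j 0
  eqa : u 0 0 1 * l * l' + u 2 0 1 = 0
  eqb : u 1 1 0 * κ * κ' + u 2 1 0 = 0
  one10 : ∀ j j', (u 0 0 1 * v 0 1 j) * w 0 j' 0 + (u 2 0 1 * v 2 1 j) * w 2 j' 0 = (1 : M2) j j'
  one01 : ∀ j j', (u 1 1 0 * v 1 0 j) * w 1 j' 1 + (u 2 1 0 * v 2 0 j) * w 2 j' 1 = (1 : M2) j j'
  a00 : ∀ j j', v 2 0 j * ((u 0 0 1 * l) * w 0 j' 0 + u 2 0 1 * w 2 j' 0) +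
    u 3 0 1 * v 3 0 j * w 3 j' 0 + u 4 0 1 * v 4 0 j * w 4 j' 0 = 0
  b00 : ∀ j j', ((u 1 1 0 * κ') * v 1 0 j + u 2 1 0 * v 2 0 j) * w 2 j' 0 +
    u 3 1 0 * v 3 0 j * w 3 j' 0 + u 4 1 0 * v 4 0 j * w 4 j' 0 = 0
  b11 : ∀ j j', v 2 1 j * ((u 1 1 0 * κ) * w 1 j' 1 + u 2 1 0 * w 2 j' 1) +
    u 5 1 0 * v 5 1 j * w 5 j' 1 + u 6 1 0 * v 6 1 j * w 6 j' 1 = 0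
  a11 : ∀ j j', ((u 0 0 1 * l') * v 0 1 j + u 2 0 1 * v 2 1 j) * w 2 j' 1 +
    u 5 0 1 * v 5 1 j * w 5 j' 1 + u 6 0 1 * v 6 1 j * w 6 j' 1 = 0
  hk : area (v 0 1) (v 2 1) ≠ 0
  hm : area (fun j => w 0 j 0) (fun j => w 2 j 0) ≠ 0
  hh : area (v 1 0) (v 2 0) ≠ 0
  hn : area (fun j => w 1 j 1) (fun j => w 2 j 1) ≠ 0

lemma area_smul_smul (a b : ℝ) (x y : Fin 2 → ℝ) :
    area (fun j => a * x j) (fun j => b * y j) = a * b * area x y := by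
  simp only [area]; ring

lemma Frame.params (fr : Frame u v w) (cy : Cyc u) : ∃ l l' κ κ', Params u v w l l' κ κ' := by
  have one10 : ∀ j j', (u 0 0 1 * v 0 1 j) * w 0 j' 0 + (u 2 0 1 * v 2 1 j) * w 2 j' 0 =
      (1 : M2) j j' := fun j j' => by simpa [cy.a1] using fr.a10 j j'
  have one01 : ∀ j j', (u 1 1 0 * v 1 0 j) * w 1 j' 1 + (u 2 1 0 * v 2 0 j) * w 2 j' 1 =
      (1 : M2) j j' := fun j j' => by simpa [cy.b0] using fr.b01 j j'
  have r10 := area_mul_area_of_sum_eq_one (p := fun j => u 0 0 1 * v 0 1 j)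
    (q := fun j => u 2 0 1 * v 2 1 j) (c := fun j => w 0 j 0) (d := fun j => w 2 j 0) one10
  have r01 := area_mul_area_of_sum_eq_one (p := fun j => u 1 1 0 * v 1 0 j)
    (q := fun j => u 2 1 0 * v 2 0 j) (c := fun j => w 1 j 1) (d := fun j => w 2 j 1) one01
  rw [area_smul_smul] at r10 r01
  have s10 := r10 ▸ one_ne_zero (α := ℝ)
  have s01 := r01 ▸ one_ne_zero (α := ℝ)
  have hk := right_ne_zero_of_mul (left_ne_zero_of_mul s10)
  have hm := right_ne_zero_of_mul s10
  have hh := right_ne_zero_of_mul (left_ne_zero_of_mul s01)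
  have hn := right_ne_zero_of_mul s01
  obtain ⟨l, l', h0, n0, eqa⟩ := parallel_of_sum_eq_zero (h := v 0 0) (n := fun j => w 0 j 1)
    (h' := v 2 0) (n' := fun j => w 2 j 1) cy.a0 cy.a2 (exists_ne_zero_of_area hh).2
    (exists_ne_zero_of_area hn).2 (fun j j' => by simpa [cy.a1] using fr.a01 j j')
  obtain ⟨κ, κ', k1, m1, eqb⟩ := parallel_of_sum_eq_zero (h := v 1 1) (n := fun j => w 1 j 0)
    (h' := v 2 1) (n' := fun j => w 2 j 0) cy.b1 cy.b2 (exists_ne_zero_of_area hk).2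
    (exists_ne_zero_of_area hm).2 (fun j j' => by simpa [cy.b0] using fr.b10 j j')
  refine ⟨l, l', κ, κ', h0, n0, k1, m1, eqa, eqb, one10, one01, ?_, ?_, ?_, ?_, hk, hm, hh, hn⟩
  · intro j j'
    have := fr.a00 j j'
    rw [cy.a1, h0, Pi.smul_apply, smul_eq_mul] at this
    linear_combination this
  · intro j j'
    have := fr.b00 j j'
    have e := congrFun m1 j'
    simp only [Pi.smul_apply, smul_eq_mul] at e
    rw [cy.b0, e] at this
    linear_combination this
  · intro j j'
    have := fr.b11 j j'
    rw [cy.b0, k1, Pi.smul_apply, smul_eq_mul] at this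
    linear_combination this
  · intro j j'
    have := fr.a11 j j'
    have e := congrFun n0 j'
    simp only [Pi.smul_apply, smul_eq_mul] at e
    rw [cy.a1, e] at this
    linear_combination this

lemma Params.ne_zero (cy : Cyc u) (pr : Params u v w l l' κ κ') :
    l ≠ 0 ∧ l' ≠ 0 ∧ κ ≠ 0 ∧ κ' ≠ 0 := by
  have ha := pr.eqa
  have hb := pr.eqb
  refine ⟨?_, ?_, ?_, ?_⟩ <;> rintro rfl
  · exact cy.a2 (by linear_combination ha)
  · exact cy.a2 (by linear_combination ha)
  · exact cy.b2 (by linear_combination hb)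
  · exact cy.b2 (by linear_combination hb)

/-- The complete zero pattern of the first factor. -/
structure Pattern (u : Fin 7 → M2) : Prop where
  split : Split u
  cyc : Cyc u
  a3 : u 3 0 1 = 0
  b3 : u 3 1 0 ≠ 0
  a4 : u 4 0 1 ≠ 0
  b4 : u 4 1 0 = 0
  a5 : u 5 0 1 = 0
  b5 : u 5 1 0 ≠ 0
  a6 : u 6 0 1 ≠ 0
  b6 : u 6 1 0 = 0

lemma Params.exists_pattern (fr : Frame u v w) (cy : Cyc u) (pr : Params u v w l l' κ κ') :
    ∃ σ : Equiv.Perm (Fin 7), Pattern (u ∘ σ) := by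
  obtain ⟨hl, hl', hκ, hκ'⟩ := pr.ne_zero cy
  have H1 := half_pattern (h := v 1 0) (p := v 2 0) (m := fun j => w 0 j 0)
    (q := fun j => w 2 j 0) (r₃ := v 3 0) (r₄ := v 4 0) (c₃ := fun j => w 3 j 0)
    (c₄ := fun j => w 4 j 0) (mul_ne_zero cy.a0 hl) (mul_ne_zero cy.b1 hκ') pr.hm pr.hh
    pr.a00 pr.b00 fr.one00
  have H2 := half_pattern (h := v 0 1) (p := v 2 1) (m := fun j => w 1 j 1)
    (q := fun j => w 2 j 1) (r₃ := v 5 1) (r₄ := v 6 1) (c₃ := fun j => w 5 j 1)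
    (c₄ := fun j => w 6 j 1) (mul_ne_zero cy.b1 hκ) (mul_ne_zero cy.a0 hl') pr.hn pr.hk
    pr.b11 pr.a11 fr.one11
  obtain ⟨a0, a1, a2, b0, b1, b2⟩ := cy
  rcases H1 with ⟨h1, h2, h3, h4⟩ | ⟨h1, h2, h3, h4⟩ <;>
    rcases H2 with ⟨g1, g2, g3, g4⟩ | ⟨g1, g2, g3, g4⟩
  · exact ⟨.swap 5 6, fr.split.comp _ (by decide), ⟨a0, a1, a2, b0, b1, b2⟩,
      h1, h3, h2, h4, g4, g2, g3, g1⟩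
  · exact ⟨1, fr.split.comp _ (by decide), ⟨a0, a1, a2, b0, b1, b2⟩,
      h1, h3, h2, h4, g3, g1, g4, g2⟩
  · obtain ⟨σ, hσ, e0, e1, e2, e3, e4, e5, e6⟩ : ∃ σ : Equiv.Perm (Fin 7), Split (u ∘ σ) ∧
        σ 0 = 0 ∧ σ 1 = 1 ∧ σ 2 = 2 ∧ σ 3 = 4 ∧ σ 4 = 3 ∧ σ 5 = 6 ∧ σ 6 = 5 :=
      ⟨.swap 3 4 * .swap 5 6, fr.split.comp _ (by decide), by decide⟩
    refine ⟨σ, hσ, ⟨?_, ?_, ?_, ?_, ?_, ?_⟩, ?_, ?_, ?_, ?_, ?_, ?_, ?_, ?_⟩ <;>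
      simp only [Function.comp_apply, e0, e1, e2, e3, e4, e5, e6] <;> assumption
  · exact ⟨.swap 3 4, fr.split.comp _ (by decide), ⟨a0, a1, a2, b0, b1, b2⟩,
      h2, h4, h1, h3, g3, g1, g4, g2⟩

lemma IsDec.exists_pattern (h : IsDec u v w) (hdep : Dep u) :
    ∃ u' v' w', Rel u v w u' v' w' ∧ Pattern u' := by
  obtain ⟨u₁, v₁, w₁, h₁, s₁⟩ := h.exists_split hdep
  obtain ⟨σ, s₂, cy⟩ := (s₁.frame (h₁.isDec h)).exists_cyc
  have h₂ := h₁.trans (.perm σ)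
  have fr := s₂.frame (h₂.isDec h)
  obtain ⟨l, l', κ, κ', pr⟩ := fr.params cy
  obtain ⟨τ, pt⟩ := pr.exists_pattern fr cy
  exact ⟨_, _, _, h₂.trans (.perm τ), pt⟩

/-- The orthogonality relations between the second and third factors. -/
structure Ortho (u v w : Fin 7 → M2) (l l' κ κ' : ℝ) : Prop where
  h2c3 : v 2 0 ⬝ᵥ (fun j => w 3 j 0) = 0
  m2r4 : (fun j => w 2 j 0) ⬝ᵥ v 4 0 = 0
  yr3 : (fun j => (u 0 0 1 * l) * w 0 j 0 + u 2 0 1 * w 2 j 0) ⬝ᵥ v 3 0 = 0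
  zc4 : (fun j => (u 1 1 0 * κ') * v 1 0 j + u 2 1 0 * v 2 0 j) ⬝ᵥ (fun j => w 4 j 0) = 0
  k2c6 : v 2 1 ⬝ᵥ (fun j => w 6 j 1) = 0
  n2r5 : (fun j => w 2 j 1) ⬝ᵥ v 5 1 = 0
  yr6 : (fun j => (u 1 1 0 * κ) * w 1 j 1 + u 2 1 0 * w 2 j 1) ⬝ᵥ v 6 1 = 0
  zc5 : (fun j => (u 0 0 1 * l') * v 0 1 j + u 2 0 1 * v 2 1 j) ⬝ᵥ (fun j => w 5 j 1) = 0

lemma Params.ortho (fr : Frame u v w) (pt : Pattern u) (pr : Params u v w l l' κ κ') :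
    Ortho u v w l l' κ κ' := by
  obtain ⟨hl, hl', hκ, hκ'⟩ := pr.ne_zero pt.cyc
  obtain ⟨e1, e2, e3, e4⟩ := half_dual (h := v 1 0) (p := v 2 0) (m := fun j => w 0 j 0)
    (q := fun j => w 2 j 0) (r₃ := v 3 0) (r₄ := v 4 0) (c₃ := fun j => w 3 j 0)
    (c₄ := fun j => w 4 j 0) (mul_ne_zero pt.cyc.a0 hl) (mul_ne_zero pt.cyc.b1 hκ') pr.hm pr.hh
    (fun j j' => by simpa [pt.a3] using pr.a00 j j')
    (fun j j' => by simpa [pt.b4] using pr.b00 j j') fr.one00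
  obtain ⟨f1, f2, f3, f4⟩ := half_dual (h := v 0 1) (p := v 2 1) (m := fun j => w 1 j 1)
    (q := fun j => w 2 j 1) (r₃ := v 6 1) (r₄ := v 5 1) (c₃ := fun j => w 6 j 1)
    (c₄ := fun j => w 5 j 1) (mul_ne_zero pt.cyc.b1 hκ) (mul_ne_zero pt.cyc.a0 hl') pr.hn pr.hk
    (fun j j' => by simpa [pt.b6] using pr.b11 j j')
    (fun j j' => by simpa [pt.a5] using pr.a11 j j')
    (fun j j' => by rw [add_comm]; exact fr.one11 j j')
  exact ⟨e1, e2, e3, e4, f1, f2, f3, f4⟩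

end DeGroot

namespace DeGroot

variable {u v w : Fin 7 → M2} {l l' κ κ' : ℝ}

lemma Pattern.of_entries (pt : Pattern u) {u' : Fin 7 → M2} {c : Fin 2 → Fin 2 → ℝ}
    (hc : ∀ i j, c i j ≠ 0) (h : ∀ t i j, u' t i j = c i j * u t i j) : Pattern u' := by
  have z : ∀ {t i j}, u t i j = 0 → u' t i j = 0 := fun h0 => by rw [h, h0, mul_zero]
  have nz : ∀ {t i j}, u t i j ≠ 0 → u' t i j ≠ 0 := fun h0 => by
    rw [h]; exact mul_ne_zero (hc _ _) h0
  obtain ⟨⟨s1, s2, s3, s4, s5, s6⟩, ⟨c1, c2, c3, c4, c5, c6⟩, p1, p2, p3, p4, p5, p6, p7, p8⟩ := pt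
  exact ⟨⟨fun t ht => z (s1 t ht), fun t ht => z (s2 t ht), nz s3, nz s4, nz s5, nz s6⟩,
    ⟨nz c1, z c2, nz c3, z c4, nz c5, nz c6⟩, z p1, nz p2, nz p3, z p4, z p5, nz p6, nz p7, z p8⟩

/-- The normal form reached after fixing bases of all three spaces. -/
structure Normal (u v : Fin 7 → M2) : Prop where
  pattern : Pattern u
  a2 : u 2 0 1 = 1
  b2 : u 2 1 0 = -1
  v2 : v 2 = !![0, 1; 1, 1]
  v3 : v 3 0 1 = 0
  v4 : v 4 0 0 = 0

/-- Expansion of a vector in a pair of dual bases. -/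
lemma expand {r c r' c' : Fin 2 → ℝ} {x x' : ℝ}
    (F : ∀ j j', x * r j * c j' + x' * r' j * c' j' = (1 : M2) j j') (y : Fin 2 → ℝ) :
    ∀ j, y j = x * (y ⬝ᵥ c) * r j + x' * (y ⬝ᵥ c') * r' j := by
  have h00 := F 0 0
  have h01 := F 0 1
  have h10 := F 1 0
  have h11 := F 1 1
  simp at h00 h01 h10 h11
  simp only [dot_eq]
  refine Fin.forall_fin_two.mpr ⟨?_, ?_⟩
  · linear_combination -y 0 * h00 - y 1 * h01
  · linear_combination -y 0 * h10 - y 1 * h11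

lemma Pattern.exists_normal (pt : Pattern u) (h : IsDec u v w) :
    ∃ u' v' w', Rel u v w u' v' w' ∧ Normal u' v' := by
  have fr := pt.split.frame h
  obtain ⟨l, l', κ, κ', pr⟩ := fr.params pt.cyc
  have ot := pr.ortho fr pt
  have F := fr.one00
  have FT := sum_eq_one_symm (p := fun j => u 3 0 0 * v 3 0 j) (q := fun j => u 4 0 0 * v 4 0 j)
    (c := fun j => w 3 j 0) (d := fun j => w 4 j 0) F
  obtain ⟨-, k2m2, -, k2m0⟩ := dual_of_sum_eq_one (p := fun j => u 0 0 1 * v 0 1 j)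
    (q := fun j => u 2 0 1 * v 2 1 j) (c := fun j => w 0 j 0) (d := fun j => w 2 j 0) pr.one10
  obtain ⟨r3c3, r4c4, r3c4, r4c3⟩ := dual_of_sum_eq_one (p := fun j => u 3 0 0 * v 3 0 j)
    (q := fun j => u 4 0 0 * v 4 0 j) (c := fun j => w 3 j 0) (d := fun j => w 4 j 0) F
  have hF := area_mul_area_of_sum_eq_one (p := fun j => u 3 0 0 * v 3 0 j)
    (q := fun j => u 4 0 0 * v 4 0 j) (c := fun j => w 3 j 0) (d := fun j => w 4 j 0) F
  have h2c3 := ot.h2c3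
  have m2r4 := ot.m2r4
  have yr3 := ot.yr3
  have x3 := pt.split.2.2.1
  have x4 := pt.split.2.2.2.1
  have a2 := pt.cyc.a2
  have b2 := pt.cyc.b2
  simp only [dot_eq] at k2m2 k2m0 r3c3 r4c4 r3c4 r4c3 h2c3 m2r4 yr3
  have eh := expand F (v 2 0)
  have em := expand (r := fun j => w 3 j 0) (c := fun j => v 3 0 j) (r' := fun j => w 4 j 0)
    (c' := fun j => v 4 0 j) (x := u 3 0 0) (x' := u 4 0 0)
    (fun j j' => by rw [← FT j j']; ring) (fun j => w 2 j 0)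
  have ey := expand (r := fun j => w 3 j 0) (c := fun j => v 3 0 j) (r' := fun j => w 4 j 0)
    (c' := fun j => v 4 0 j) (x := u 3 0 0) (x' := u 4 0 0)
    (fun j j' => by rw [← FT j j']; ring)
    (fun j => (u 0 0 1 * l) * w 0 j 0 + u 2 0 1 * w 2 j 0)
  simp only [dot_eq] at eh em ey
  rw [h2c3] at eh
  rw [m2r4] at em
  rw [yr3] at ey
  replace r3c4 : v 3 0 0 * w 4 0 0 + v 3 0 1 * w 4 1 0 = 0 :=
    (mul_eq_zero.mp (by linear_combination r3c4)).resolve_left x3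
  replace r4c3 : v 4 0 0 * w 3 0 0 + v 4 0 1 * w 3 1 0 = 0 :=
    (mul_eq_zero.mp (by linear_combination r4c3)).resolve_left x4
  obtain ⟨f, hf⟩ : ∃ f, f = u 3 0 0 * (v 2 1 0 * w 3 0 0 + v 2 1 1 * w 3 1 0) := ⟨_, rfl⟩
  obtain ⟨g, hg⟩ : ∃ g, g = u 4 0 0 * (v 2 1 0 * w 4 0 0 + v 2 1 1 * w 4 1 0) := ⟨_, rfl⟩
  obtain ⟨s, hs⟩ : ∃ s, s = u 4 0 0 * (v 2 0 0 * w 4 0 0 + v 2 0 1 * w 4 1 0) := ⟨_, rfl⟩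
  have hf0 : f ≠ 0 := by
    intro h0
    rw [h0] at hf
    refine one_ne_zero (α := ℝ) ?_
    linear_combination -k2m2 + u 2 0 1 * v 2 1 0 * em 0 + u 2 0 1 * v 2 1 1 * em 1 -
      u 2 0 1 * (w 2 0 0 * v 3 0 0 + w 2 1 0 * v 3 0 1) * hf
  have hg0 : g ≠ 0 := by
    intro h0
    rw [h0] at hg
    refine a2 ?_
    linear_combination (-u 2 0 1) * k2m2 - u 0 0 1 * l * k2m0 +
      u 2 0 1 * v 2 1 0 * ey 0 + u 2 0 1 * v 2 1 1 * ey 1 - u 2 0 1 *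
      ((u 0 0 1 * l * w 0 0 0 + u 2 0 1 * w 2 0 0) * v 4 0 0 +
        (u 0 0 1 * l * w 0 1 0 + u 2 0 1 * w 2 1 0) * v 4 0 1) * hg
  have hs0 : s ≠ 0 := by
    intro h0
    rw [h0] at hs
    refine (exists_ne_zero_of_area pr.hh).2 (funext fun j => ?_)
    rw [Pi.zero_apply, eh j, ← hs]
    ring
  have hdet : (!![u 3 0 0 * w 3 0 0 / f, u 4 0 0 * w 4 0 0 / g;
      u 3 0 0 * w 3 1 0 / f, u 4 0 0 * w 4 1 0 / g] : M2).det ≠ 0 := by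
    have e : (!![u 3 0 0 * w 3 0 0 / f, u 4 0 0 * w 4 0 0 / g;
      u 3 0 0 * w 3 1 0 / f, u 4 0 0 * w 4 1 0 / g] : M2).det = u 3 0 0 * u 4 0 0 / (f * g) *
        area (fun j => w 3 j 0) (fun j => w 4 j 0) := by
      rw [det_fin_two_of, area]
      field_simp
    rw [e]
    refine mul_ne_zero (div_ne_zero (mul_ne_zero x3 x4) (mul_ne_zero hf0 hg0)) ?_
    exact right_ne_zero_of_mul (hF ▸ one_ne_zero)
  let C : GL (Fin 2) ℝ := (GeneralLinearGroup.mkOfDetNeZero _ hdet)⁻¹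
  let B : GL (Fin 2) ℝ := GeneralLinearGroup.mkOfDetNeZero !![g / s, 0; 0, 1]
    (by simp [det_fin_two_of, hg0, hs0])
  let B' : GL (Fin 2) ℝ := GeneralLinearGroup.mkOfDetNeZero !![s / g, 0; 0, 1]
    (by simp [det_fin_two_of, hg0, hs0])
  let A : GL (Fin 2) ℝ := GeneralLinearGroup.mkOfDetNeZero
    !![1 / u 2 0 1, 0; 0, -(g / s) / u 2 1 0] (by simp [det_fin_two_of, hg0, hs0, a2, b2])
  have hA : (A : M2) = !![1 / u 2 0 1, 0; 0, -(g / s) / u 2 1 0] := rfl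
  have hB : (B : M2) = !![g / s, 0; 0, 1] := rfl
  have hB'v : (B' : M2) = !![s / g, 0; 0, 1] := rfl
  have hB' : B⁻¹ = B' := by
    rw [inv_eq_iff_mul_eq_one]
    ext i j
    rw [Units.val_mul, hB, hB'v]
    fin_cases i <;> fin_cases j <;> simp [Matrix.mul_apply, Fin.sum_univ_two, hg0, hs0]
  have hC : ((C⁻¹ : GL (Fin 2) ℝ) : M2) = !![u 3 0 0 * w 3 0 0 / f, u 4 0 0 * w 4 0 0 / g;
      u 3 0 0 * w 3 1 0 / f, u 4 0 0 * w 4 1 0 / g] := by rw [inv_inv]; rfl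
  refine ⟨_, _, _, Rel.sandwich A B C, ?_, ?_, ?_, ?_, ?_, ?_⟩
  · refine pt.of_entries (c := fun i j => (A : M2) i i * (B' : M2) j j) ?_ ?_
    · intro i j
      rw [hA, hB'v]
      fin_cases i <;> fin_cases j <;> simp [hg0, hs0, a2, b2]
    · intro t i j
      rw [hB', hA, hB'v]
      simp only [Matrix.mul_apply, Fin.sum_univ_two]
      fin_cases i <;> fin_cases j <;> simp <;> ring
  · simp only [hB', hA, hB'v]
    simp only [Matrix.mul_apply, Fin.sum_univ_two]
    simp [a2]
  · simp only [hB', hA, hB'v]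
    simp only [Matrix.mul_apply, Fin.sum_univ_two]
    simp
    field_simp
  · simp only [hC, hB]
    ext i j
    simp only [Matrix.mul_apply, Fin.sum_univ_two]
    fin_cases i <;> fin_cases j <;> simp <;> field_simp
    · linear_combination g * u 3 0 0 * h2c3
    · rw [hs]
    · rw [hf]
    · rw [hg]
  · simp only [hC, hB]
    simp only [Matrix.mul_apply, Fin.sum_univ_two]
    simp
    field_simp
    linear_combination u 4 0 0 * r3c4
  · simp only [hC, hB]
    simp only [Matrix.mul_apply, Fin.sum_univ_two]
    simp
    field_simp
    linear_combination g * u 3 0 0 * r4c3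

end DeGroot

namespace DeGroot

/-- The first factors of a fixed decomposition. -/
def cu : Fin 7 → M2 :=
  ![!![0, 1; 0, 0], !![0, 0; 1, 0], !![0, 1; -1, 0], !![1, 0; -1, 0], !![1, -1; 0, 0],
    !![0, 0; -1, 1], !![0, -1; 0, 1]]

/-- The second factors of a fixed decomposition. -/
def cv : Fin 7 → M2 :=
  ![!![0, 1; 0, 1], !![1, 1; 1, 1], !![0, 1; 1, 1], !![1, 0; 0, 0], !![0, 1; 0, 0],
    !![0, 0; 1, 1], !![0, 0; 1, 0]]

/-- The third factors of a fixed decomposition. -/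
def cw : Fin 7 → M2 :=
  ![!![-1, -1; 1, 1], !![1, 1; 0, 0], !![1, 1; 0, -1], !![1, 0; 0, 0], !![0, 0; 1, 0],
    !![0, 0; 0, 1], !![0, 1; 0, -1]]

lemma isDec_canonical : IsDec cu cv cw := by
  intro X Y Z
  simp [cu, cv, cw, Fin.sum_univ_seven, frob_eq, trace, Fin.sum_univ_two, Matrix.mul_apply]
  ring

lemma dep_cv : Dep cv :=
  ⟨{0, 2, 6}, ![1, 0, -1, 0, 0, 0, 1], by decide, ⟨0, by simp⟩, by
    ext i j
    fin_cases i <;> fin_cases j <;> simp [cv]⟩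

lemma dep_cw : Dep cw :=
  ⟨{1, 2, 5}, ![0, 1, -1, 0, 0, -1, 0], by decide, ⟨1, by simp⟩, by
    ext i j
    fin_cases i <;> fin_cases j <;> simp [cw]⟩

lemma IsDec.eq_cw {w : Fin 7 → M2} (h : IsDec cu cv w) : w = cw := by
  have e := fun j' i' i k k' j => (h.brent i k k' j j' i').trans
    (isDec_canonical.brent i k k' j j' i').symm
  simp only [Fin.sum_univ_seven] at e
  have key : ∀ j' i' t, w t j' i' = cw t j' i' := by
    intro j' i'
    have e1 := e j' i' 0 0 0 0
    have e2 := e j' i' 0 0 0 1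
    have e3 := e j' i' 1 1 1 1
    have e4 := e j' i' 1 1 1 0
    have e5 := e j' i' 1 0 0 0
    have e6 := e j' i' 1 0 0 1
    have e7 := e j' i' 0 1 0 1
    generalize cw = w' at *
    simp [cu, cv] at e1 e2 e3 e4 e5 e6 e7
    intro t
    fin_cases t <;> simp <;> linarith
  ext t j' i'
  exact key j' i' t

variable {u v w : Fin 7 → M2}

lemma Normal.exists_scale (nm : Normal u v) (h : IsDec u v w) :
    ∃ α β : Fin 7 → ℝ, (∀ t, α t * β t ≠ 0) ∧ (∀ t, α t • u t = cu t) ∧ ∀ t, β t • v t = cv t := by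
  obtain ⟨pt, a2, b2, v2, v3, v4⟩ := nm
  have fr := pt.split.frame h
  obtain ⟨l, l', κ, κ', pr⟩ := fr.params pt.cyc
  have ot := pr.ortho fr pt
  obtain ⟨d1, d2, d3, d4⟩ := dual_of_sum_eq_one (p := fun j => u 0 0 1 * v 0 1 j)
    (q := fun j => u 2 0 1 * v 2 1 j) (c := fun j => w 0 j 0) (d := fun j => w 2 j 0) pr.one10
  obtain ⟨e1, e2, e3, e4⟩ := dual_of_sum_eq_one (p := fun j => u 1 1 0 * v 1 0 j)
    (q := fun j => u 2 1 0 * v 2 0 j) (c := fun j => w 1 j 1) (d := fun j => w 2 j 1) pr.one01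
  obtain ⟨f1, f2, f3, -⟩ := dual_of_sum_eq_one (p := fun j => u 3 0 0 * v 3 0 j)
    (q := fun j => u 4 0 0 * v 4 0 j) (c := fun j => w 3 j 0) (d := fun j => w 4 j 0) fr.one00
  obtain ⟨g1, g2, g3, g4⟩ := dual_of_sum_eq_one (p := fun j => u 5 1 1 * v 5 1 j)
    (q := fun j => u 6 1 1 * v 6 1 j) (c := fun j => w 5 j 1) (d := fun j => w 6 j 1) fr.one11
  obtain ⟨-, m2r4, yr3, zc4, k2c6, n2r5, yr6, -⟩ := ot
  have v200 : v 2 0 0 = 0 := by simp [v2]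
  have v201 : v 2 0 1 = 1 := by simp [v2]
  have v210 : v 2 1 0 = 1 := by simp [v2]
  have v211 : v 2 1 1 = 1 := by simp [v2]
  have h00 := congrFun pr.h0 0
  have h01 := congrFun pr.h0 1
  have k10 := congrFun pr.k1 0
  have k11 := congrFun pr.k1 1
  have eqb := pr.eqb
  have A00 := pr.a00 1 1
  have B00 := pr.b00 0 0
  have B11 := pr.b11 0 1
  have A11 := pr.a11 0 0
  simp only [dot_eq, Pi.smul_apply, smul_eq_mul, a2, b2, v200, v201, v210, v211, v3, v4, pt.a3,
    pt.b4, pt.a5, pt.b6, zero_mul, mul_zero, add_zero, zero_add, one_mul, mul_one]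
    at d2 d3 d4 d1 e1 e2 e3 e4 f1 f2 f3 g1 g2 g3 g4 m2r4 yr3 zc4 k2c6 n2r5 yr6 h00 h01 k10 k11 eqb
      A00 B00 B11 A11
  obtain ⟨⟨s1, s2, x3, x4, y5, y6⟩, ⟨a0, a1, -, b0, b1, -⟩, a3, -, -, b4, a5, -, -, b6⟩ := pt
  have v300 : v 3 0 0 ≠ 0 := right_ne_zero_of_mul (left_ne_zero_of_mul (f1 ▸ one_ne_zero))
  have v401 : v 4 0 1 ≠ 0 := right_ne_zero_of_mul (left_ne_zero_of_mul (f2 ▸ one_ne_zero))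
  have w410 : w 4 1 0 ≠ 0 := right_ne_zero_of_mul (f2 ▸ one_ne_zero)
  have w210 : w 2 1 0 = 0 := (mul_eq_zero.mp m2r4).resolve_right v401
  have w200 : w 2 0 0 = 1 := by linear_combination d2 - w210
  rw [w210, w200] at d3
  have v010 : v 0 1 0 = 0 := by simpa [a0] using d3
  have w211 : w 2 1 1 = -1 := by linear_combination -e2
  have w111 : w 1 1 1 = 0 := by linear_combination -e4
  have w611 : w 6 1 1 = -w 6 0 1 := by linear_combination k2c6
  rw [w611] at g2 g3
  have w601 : w 6 0 1 ≠ 0 := by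
    intro h0
    rw [h0] at g2
    norm_num at g2
  have v511 : v 5 1 1 = v 5 1 0 := by
    have : u 5 1 1 * w 6 0 1 * (v 5 1 1 - v 5 1 0) = 0 := by linear_combination -g3
    simpa [y5, w601, sub_eq_zero] using this
  rw [v511] at g1 n2r5
  have v510 : v 5 1 0 ≠ 0 := by
    intro h0
    rw [h0] at g1
    norm_num at g1
  have w201 : w 2 0 1 = 1 := mul_right_cancel₀ v510 (by rw [w211] at n2r5; linear_combination n2r5)
  rw [w201, w211] at e3
  have v100 : v 1 0 0 = v 1 0 1 := mul_left_cancel₀ b1 (by linear_combination e3)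
  have e5 : u 0 0 1 * l * w 0 0 0 = -1 := by
    have := (mul_eq_zero.mp yr3).resolve_right v300
    rw [w200] at this
    linear_combination this
  have w010 : w 0 1 0 = -w 0 0 0 := by linear_combination d4
  have l0 : l ≠ 0 := by rintro rfl; norm_num at e5
  have w000 : w 0 0 0 ≠ 0 := right_ne_zero_of_mul (e5 ▸ neg_ne_zero.mpr one_ne_zero)
  have v011 : v 0 1 1 = l := by
    refine mul_left_cancel₀ a0 (mul_right_cancel₀ w000 ?_)
    rw [w010, v010] at d1
    linear_combination -d1 - e5
  have w400 : w 4 0 0 = 0 := by simpa [x3, v300] using f3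
  rw [w400] at zc4
  have e6 : u 1 1 0 * κ' * v 1 0 1 = 1 := by
    have : (u 1 1 0 * κ' * v 1 0 1 - 1) * w 4 1 0 = 0 := by linear_combination zc4
    simpa [w410, sub_eq_zero] using this
  have κ0 : κ ≠ 0 := by rintro rfl; norm_num at eqb
  have κ'0 : κ' ≠ 0 := by rintro rfl; norm_num at eqb
  have v101 : v 1 0 1 = κ := by
    refine mul_left_cancel₀ b1 (mul_right_cancel₀ κ'0 ?_)
    linear_combination e6 - eqb
  rw [v100, v101, w111] at e1
  have v611 : v 6 1 1 = 0 := by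
    rw [w111, w201, w211] at yr6
    linear_combination yr6 - v 6 1 0 * e1
  rw [v611] at g2 g4
  have v610 : v 6 1 0 ≠ 0 := by
    intro h0
    rw [h0] at g2
    norm_num at g2
  have w501 : w 5 0 1 = 0 := by simpa [y6, v610] using g4
  rw [w501] at g1
  have w511 : w 5 1 1 ≠ 0 := by
    intro h0
    rw [h0] at g1
    norm_num at g1
  have w300 : w 3 0 0 ≠ 0 := right_ne_zero_of_mul (f1 ▸ one_ne_zero)
  have a4 : u 4 0 1 = -u 4 0 0 := by
    refine mul_right_cancel₀ v401 (mul_right_cancel₀ w410 ?_)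
    rw [w010, w210] at A00
    linear_combination A00 + e5 + f2
  have b3 : u 3 1 0 = -u 3 0 0 := by
    refine mul_right_cancel₀ v300 (mul_right_cancel₀ w300 ?_)
    rw [w200, v100] at B00
    linear_combination B00 - e6 + f1
  have b5 : u 5 1 0 = -u 5 1 1 := by
    refine mul_right_cancel₀ v510 (mul_right_cancel₀ w511 ?_)
    rw [w111, w211] at B11
    linear_combination B11 + g1
  have a6 : u 6 0 1 = -u 6 1 1 := by
    refine mul_right_cancel₀ v610 (mul_right_cancel₀ w601 ?_)
    rw [v010, w201] at A11
    linear_combination A11 + g2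
  refine ⟨![1 / u 0 0 1, 1 / u 1 1 0, 1, 1 / u 3 0 0, 1 / u 4 0 0, 1 / u 5 1 1, 1 / u 6 1 1],
    ![1 / l, 1 / κ, 1, 1 / v 3 0 0, 1 / v 4 0 1, 1 / v 5 1 0, 1 / v 6 1 0], ?_, ?_, ?_⟩
  · intro t
    fin_cases t <;> simp [a0, b1, x3, x4, y5, y6, l0, κ0, v300, v401, v510, v610]
  · simp at s1 s2
    intro t
    ext i j
    fin_cases t <;> fin_cases i <;> fin_cases j <;>
      simp [cu, s1, s2, a1, a3, b0, b4, a5, b6, a2, b2, a4, b3, b5, a6, a0, b1, x3, x4, y5, y6]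
  · intro t
    ext i j
    fin_cases t <;> fin_cases i <;> fin_cases j <;>
      simp [cv, h00, h01, k10, k11, v200, v201, v210, v211, v3, v4, v010, v011, v100, v101, v511,
        v611, fr.v3, fr.v4, fr.v5, fr.v6, l0, κ0, v300, v401, v510, v610]

lemma IsDec.rel_canonical_of_dep (h : IsDec u v w) (hdep : Dep u) : Rel u v w cu cv cw := by
  obtain ⟨u₁, v₁, w₁, r₁, pt⟩ := h.exists_pattern hdep
  obtain ⟨u₂, v₂, w₂, r₂, nm⟩ := pt.exists_normal (r₁.isDec h)
  have r := r₁.trans r₂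
  obtain ⟨α, β, h0, hu, hv⟩ := nm.exists_scale (r.isDec h)
  have r₃ := r.trans (.scale (α := α) (β := β) (γ := fun t => 1 / (α t * β t))
    fun t => mul_one_div_cancel (h0 t))
  rw [funext hu, funext hv] at r₃
  have hw := (r₃.isDec h).eq_cw
  rwa [hw] at r₃

lemma IsDec.rel_canonical (h : IsDec u v w) : Rel u v w cu cv cw := by
  have c := isDec_canonical
  rcases h.dep_or with hd | hd | hd
  · exact h.rel_canonical_of_dep hd
  · exact (h.rotate.rel_canonical_of_dep hd).rotate.rotate.trans
      (c.rotate.rotate.rel_canonical_of_dep dep_cw)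
  · exact (h.rotate.rotate.rel_canonical_of_dep hd).rotate.trans
      (c.rotate.rel_canonical_of_dep dep_cv)

end DeGroot

/-- de Groot's transitivity theorem: the isotropy group acts transitively on
rank-7 decompositions of the 2×2 matrix-multiplication tensor over ℝ. -/
theorem deGroot_transitivity
    (u v w : Fin 7 → Matrix (Fin 2) (Fin 2) ℝ)
    (hu : ∀ X Y Z : Matrix (Fin 2) (Fin 2) ℝ,
      ∑ t : Fin 7, frob (u t) X * frob (v t) Y * frob (w t) Z =
        Matrix.trace (X * Y * Z))
    (s p q : Fin 7 → Matrix (Fin 2) (Fin 2) ℝ)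
    (hs : ∀ X Y Z : Matrix (Fin 2) (Fin 2) ℝ,
      ∑ t : Fin 7, frob (s t) X * frob (p t) Y * frob (q t) Z =
        Matrix.trace (X * Y * Z)) :
    ∃ (U V W : Matrix (Fin 2) (Fin 2) ℝ), IsUnit U ∧ IsUnit V ∧ IsUnit W ∧
      ∃ (σ : Equiv.Perm (Fin 7)) (α β γ : Fin 7 → ℝ),
        (∀ t, α t ≠ 0 ∧ β t ≠ 0 ∧ γ t ≠ 0 ∧ α t * β t * γ t = 1) ∧
        (∀ t, u (σ t) = α t • ((Uᵀ)⁻¹ * s t * Vᵀ) ∧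
              v (σ t) = β t • ((Vᵀ)⁻¹ * p t * Wᵀ) ∧
              w (σ t) = γ t • ((Wᵀ)⁻¹ * q t * Uᵀ)) := by
  obtain ⟨A, B, C, σ, α, β, γ, h1, h2⟩ :=
    (DeGroot.IsDec.rel_canonical hs).trans (DeGroot.IsDec.rel_canonical hu).symm
  have key : ∀ A : GL (Fin 2) ℝ,
      ((((A⁻¹ : GL (Fin 2) ℝ) : Matrix (Fin 2) (Fin 2) ℝ)ᵀ)ᵀ)⁻¹ = A := fun A => by
    rw [transpose_transpose, ← coe_units_inv, inv_inv]
  have hunit : ∀ A : GL (Fin 2) ℝ,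
      IsUnit ((A⁻¹ : GL (Fin 2) ℝ) : Matrix (Fin 2) (Fin 2) ℝ)ᵀ := fun A =>
    (Matrix.isUnit_transpose _).mpr A⁻¹.isUnit
  refine ⟨_, _, _, hunit A, hunit B, hunit C, σ, α, β, γ, fun t => ?_, fun t => ?_⟩
  · have h0 : α t * β t * γ t ≠ 0 := h1 t ▸ one_ne_zero
    exact ⟨left_ne_zero_of_mul (left_ne_zero_of_mul h0),
      right_ne_zero_of_mul (left_ne_zero_of_mul h0), right_ne_zero_of_mul h0, h1 t⟩
  · rw [key, key, key, transpose_transpose, transpose_transpose, transpose_transpose]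
    exact h2 t
end
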